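/- There exists an absolute constant C > 0 such that for every prime p and every set A ⊆ F_p² with p ≤ |A| ≤ p^{4/3}, the number of non-degenerate isosceles triangles satisfies |T*(A) − |A|³/p| ≤ C·( p^{2/3}|A|^{5/3} + p^{1/4}|A|² ). -/

import Mathlib

namespace Stmt6

/-- The (algebraic) squared distance in the plane `F²`. -/
def dist2 {F : Type*} [CommRing F] (x y : F × F) : F :=
  (x.1 - y.1) ^ 2 + (x.2 - y.2) ^ 2

/-- The dot product on `F²`. -/
def dot {F : Type*} [CommRing F] (x y : F × F) : F :=
  x.1 * y.1 + x.2 * y.2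

/-- `T*(A)`: the number of non-degenerate isosceles triangles
`(a,b,c) ∈ A³` with `d(a,b) = d(a,c)` and `(b-c)·(b-c) ≠ 0`. -/
noncomputable def Tstar {F : Type*} [CommRing F] (A : Finset (F × F)) : ℕ :=
  Set.ncard {t : (F × F) × (F × F) × (F × F) |
    t.1 ∈ A ∧ t.2.1 ∈ A ∧ t.2.2 ∈ A ∧
    dist2 t.1 t.2.1 = dist2 t.1 t.2.2 ∧
    dot (t.2.1 - t.2.2) (t.2.1 - t.2.2) ≠ 0}

section Rays

open MvPolynomial

variable {K : Type*} [Field K]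

/-- Restriction of a trivariate polynomial to the ray `t ↦ (t, β + θ t, w + θ β + θ² t)`
encoded by the triple `(θ, β, w)`. -/
noncomputable def restrict (l : K × K × K) : MvPolynomial (Fin 3) K →ₐ[K] Polynomial K :=
  aeval ![Polynomial.X, Polynomial.C l.2.1 + Polynomial.C l.1 * Polynomial.X,
    Polynomial.C (l.2.2 + l.1 * l.2.1) + Polynomial.C (l.1 ^ 2) * Polynomial.X]

/-- The point with parameter `t` on the ray encoded by `l`. -/
def rayPt (l : K × K × K) (t : K) : Fin 3 → K :=
  ![t, l.2.1 + l.1 * t, l.2.2 + l.1 * l.2.1 + l.1 ^ 2 * t]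

theorem eval_restrict (l : K × K × K) (F : MvPolynomial (Fin 3) K) (t : K) :
    (restrict l F).eval t = eval (rayPt l t) F := by
  have h : ((Polynomial.aeval t).comp (restrict l) : MvPolynomial (Fin 3) K →ₐ[K] K) =
      aeval (rayPt l t) := by
    ext i
    fin_cases i <;> simp [restrict, rayPt]
  have := DFunLike.congr_fun h F
  simpa [Polynomial.coe_aeval_eq_eval, MvPolynomial.coe_aeval_eq_eval] using! this

theorem natDegree_restrict_le (l : K × K × K) {F : MvPolynomial (Fin 3) K} {d : ℕ}
    (hF : F.totalDegree ≤ d) : (restrict l F).natDegree ≤ d := by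
  have := aeval_natDegree_le (n := 1) F hF
    ![Polynomial.X, Polynomial.C l.2.1 + Polynomial.C l.1 * Polynomial.X,
    Polynomial.C (l.2.2 + l.1 * l.2.1) + Polynomial.C (l.1 ^ 2) * Polynomial.X] (by
      intro i
      fin_cases i
      · simp
      · simp only [Fin.mk_one, Matrix.cons_val_one, Matrix.cons_val_zero]
        compute_degree
      · simp only [Fin.reduceFinMk, Matrix.cons_val]
        compute_degree)
  simpa [restrict] using this

/-- A polynomial of degree at most `d` vanishing at more than `d` points of a ray vanishes on it. -/
theorem restrict_eq_zero_of_card (l : K × K × K) {F : MvPolynomial (Fin 3) K} {d : ℕ}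
    (hF : F.totalDegree ≤ d) (T : Finset K) (hT : d < T.card)
    (h : ∀ t ∈ T, eval (rayPt l t) F = 0) : restrict l F = 0 := by
  refine Polynomial.eq_zero_of_natDegree_lt_card_of_eval_eq_zero' _ T (fun t ht => ?_)
    ((natDegree_restrict_le l hF).trans_lt hT)
  rw [eval_restrict, h t ht]

theorem card_totalDegree_le (D : ℕ) :
    6 * Nat.card {s : Fin 3 →₀ ℕ | (s.sum fun _ e => e) ≤ D} = (D + 1) * (D + 2) * (D + 3) := by
  have hset : {s : Fin 3 →₀ ℕ | (s.sum fun _ e => e) ≤ D} =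
      ((Finset.range (D + 1)).biUnion fun k => Finset.finsuppAntidiag Finset.univ k :
        Finset (Fin 3 →₀ ℕ)) := by
    ext s
    simp [Finsupp.sum_fintype]
  rw [hset, Nat.card_coe_set_eq, Set.ncard_coe_finset, Finset.card_biUnion]
  · simp only [Finset.card_finsuppAntidiag_nat_eq_choose, Finset.card_univ, Fintype.card_fin]
    clear hset
    induction D with
    | zero => simp
    | succ n ih =>
      rw [Finset.sum_range_succ, mul_add, ih]
      have h2 : (3 + (n + 1) - 1).choose (n + 1) = (n + 3).choose 2 := by
        rw [← Nat.choose_symm_of_eq_add (a := 2) (b := n + 1) (by omega)]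
        congr 1
        omega
      rw [h2]
      have h3 : (n + 3).choose 2 * 2 = (n + 3) * (n + 2) := by
        rw [Nat.choose_two_right]
        exact Nat.div_mul_cancel (Nat.even_mul_pred_self (n + 3)).two_dvd
      nlinarith
  · intro i _ j _ hij
    rw [Function.onFun, Finset.disjoint_left]
    intro s hs hs'
    simp at hs hs'
    omega

theorem six_mul_finrank (D : ℕ) :
    6 * Module.finrank K (restrictTotalDegree (Fin 3) K D) = (D + 1) * (D + 2) * (D + 3) := by
  rw [restrictTotalDegree, Module.finrank_eq_nat_card_basis (basisRestrictSupport K _)]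
  exact card_totalDegree_le D

theorem exists_vanishing (S : Finset (K × K × K)) (d : ℕ) (h : 6 * S.card < (d + 2) * (d + 3)) :
    ∃ F : MvPolynomial (Fin 3) K, F ≠ 0 ∧ F.totalDegree ≤ d ∧ ∀ l ∈ S, restrict l F = 0 := by
  let Φ : restrictTotalDegree (Fin 3) K d →ₗ[K] (S × Fin (d + 1) → K) :=
    LinearMap.pi fun q => (Polynomial.lcoeff K q.2).comp
      ((restrict q.1.1).toLinearMap.comp (Submodule.subtype _))
  have hlt : Module.finrank K (S × Fin (d + 1) → K) <
      Module.finrank K (restrictTotalDegree (Fin 3) K d) := by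
    have h6 := six_mul_finrank (K := K) d
    rw [Module.finrank_fintype_fun_eq_card, Fintype.card_prod, Fintype.card_coe, Fintype.card_fin]
    nlinarith
  obtain ⟨F, hF, hF0⟩ :=
    (Submodule.ne_bot_iff _).1 (LinearMap.ker_ne_bot_of_finrank_lt hlt (f := Φ))
  have hd := (mem_restrictTotalDegree _ _ _).1 F.2
  refine ⟨F, by simpa using hF0, hd, fun l hl => ?_⟩
  ext i
  by_cases hi : i < d + 1
  · exact congr_fun (LinearMap.mem_ker.1 hF) (⟨l, hl⟩, ⟨i, hi⟩)
  · rw [Polynomial.coeff_eq_zero_of_natDegree_lt, Polynomial.coeff_zero]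
    have := natDegree_restrict_le l hd
    omega

theorem exists_linear_separator {l l' : K × K × K} (h : l ≠ l') :
    ∃ L : MvPolynomial (Fin 3) K, L.totalDegree ≤ 1 ∧ restrict l' L = 0 ∧ restrict l L ≠ 0 := by
  have hdeg : ∀ (i : Fin 3) (a b : K),
      (X i - C a * X 0 - C b : MvPolynomial (Fin 3) K).totalDegree ≤ 1 := by
    intro i a b
    refine (totalDegree_sub_C_le _ _).trans ((totalDegree_sub _ _).trans (max_le ?_ ?_))
    · simp
    · refine (totalDegree_mul _ _).trans ?_
      simp
  by_cases h1 : l.1 = l'.1 ∧ l.2.1 = l'.2.1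
  · refine ⟨X 2 - C (l'.1 ^ 2) * X 0 - C (l'.2.2 + l'.1 * l'.2.1), hdeg _ _ _, ?_, ?_⟩
    · simp [restrict]
    · intro h0
      have := congr_arg (Polynomial.eval 0) h0
      rw [eval_restrict] at this
      simp [rayPt, h1.1, h1.2, sub_eq_zero] at this
      exact h (Prod.ext h1.1 (Prod.ext h1.2 this))
  · refine ⟨X 1 - C l'.1 * X 0 - C l'.2.1, hdeg _ _ _, ?_, ?_⟩
    · simp [restrict]
    · intro h0
      have e0 := congr_arg (Polynomial.eval 0) h0
      have e1 := congr_arg (Polynomial.eval 1) h0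
      rw [eval_restrict] at e0 e1
      simp [rayPt, sub_eq_zero] at e0 e1
      refine h1 ⟨?_, e0⟩
      rw [e0] at e1
      linear_combination e1

end Rays

section Bezout

open MvPolynomial

variable {K : Type*} [Field K]

theorem finrank_map_mul {F : MvPolynomial (Fin 3) K} (hF : F ≠ 0)
    (V : Submodule K (MvPolynomial (Fin 3) K)) :
    Module.finrank K (V.map (LinearMap.mulLeft K F)) = Module.finrank K V :=
  (Submodule.equivMapOfInjective (LinearMap.mulLeft K F)
    (fun _ _ h => mul_left_cancel₀ hF h) V).finrank_eq.symm

/-- Polynomials of degree at most `D` vanishing on the rays in `S`. -/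
noncomputable def vanishingSpace (S : Finset (K × K × K)) (D : ℕ) :
    Submodule K (MvPolynomial (Fin 3) K) :=
  restrictTotalDegree (Fin 3) K D ⊓ ⨅ l ∈ S, LinearMap.ker (restrict l).toLinearMap

theorem mem_vanishingSpace {S : Finset (K × K × K)} {D : ℕ} {G : MvPolynomial (Fin 3) K} :
    G ∈ vanishingSpace S D ↔ G.totalDegree ≤ D ∧ ∀ l ∈ S, restrict l G = 0 := by
  simp [vanishingSpace, mem_restrictTotalDegree]

instance (S : Finset (K × K × K)) (D : ℕ) : FiniteDimensional K (vanishingSpace S D) :=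
  Submodule.finiteDimensional_of_le
    (inf_le_left : vanishingSpace S D ≤ restrictTotalDegree (Fin 3) K D)

theorem finrank_add_le_finrank_vanishingSpace {F H : MvPolynomial (Fin 3) K} (hF : Prime F)
    (hFH : ¬ F ∣ H) (S : Finset (K × K × K)) (hS : ∀ l ∈ S, restrict l F = 0 ∧ restrict l H = 0)
    (D : ℕ) (hD : F.totalDegree + H.totalDegree ≤ D) :
    Module.finrank K (restrictTotalDegree (Fin 3) K (D - F.totalDegree)) +
      Module.finrank K (restrictTotalDegree (Fin 3) K (D - H.totalDegree)) ≤
    Module.finrank K (vanishingSpace S D) +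
      Module.finrank K (restrictTotalDegree (Fin 3) K (D - F.totalDegree - H.totalDegree)) := by
  have hH0 : H ≠ 0 := by
    rintro rfl
    exact hFH (dvd_zero F)
  set U := (restrictTotalDegree (Fin 3) K (D - F.totalDegree)).map (LinearMap.mulLeft K F) with hU
  set V := (restrictTotalDegree (Fin 3) K (D - H.totalDegree)).map (LinearMap.mulLeft K H) with hV
  have hsum := Submodule.finrank_sup_add_finrank_inf_eq U V
  rw [hU, finrank_map_mul hF.ne_zero, ← hU, hV, finrank_map_mul hH0, ← hV] at hsum
  rw [← hsum]
  refine add_le_add (Submodule.finrank_mono (sup_le ?_ ?_)) ?_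
  · rintro _ ⟨P, hP, rfl⟩
    rw [SetLike.mem_coe, mem_restrictTotalDegree] at hP
    refine mem_vanishingSpace.2 ⟨?_, fun l hl => by simp [(hS l hl).1]⟩
    rw [LinearMap.mulLeft_apply]
    have := totalDegree_mul F P
    omega
  · rintro _ ⟨P, hP, rfl⟩
    rw [SetLike.mem_coe, mem_restrictTotalDegree] at hP
    refine mem_vanishingSpace.2 ⟨?_, fun l hl => by simp [(hS l hl).2]⟩
    rw [LinearMap.mulLeft_apply]
    have := totalDegree_mul H P
    omega
  · rw [← finrank_map_mul (mul_ne_zero hF.ne_zero hH0) (restrictTotalDegree _ _ _)]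
    refine Submodule.finrank_mono ?_
    rintro _ ⟨⟨P, hP, rfl⟩, ⟨Q, hQ, hQP⟩⟩
    rw [SetLike.mem_coe, mem_restrictTotalDegree] at hP hQ
    rw [LinearMap.mulLeft_apply, LinearMap.mulLeft_apply] at hQP
    obtain ⟨R, rfl⟩ := (hF.dvd_or_dvd (hQP ▸ dvd_mul_right F P : F ∣ H * Q)).resolve_left hFH
    refine ⟨R, ?_, ?_⟩
    · rw [SetLike.mem_coe, mem_restrictTotalDegree]
      by_cases hR : R = 0
      · simp [hR]
      · rw [totalDegree_mul_of_isDomain hF.ne_zero hR] at hQ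
        omega
    · rw [LinearMap.mulLeft_apply, LinearMap.mulLeft_apply, ← hQP]
      ring

theorem finrank_vanishingSpace_add_le (S : Finset (K × K × K)) (D : ℕ) (hD : S.card ≤ D + 1) :
    Module.finrank K (vanishingSpace S D) + S.card * (D + 2 - S.card) ≤
      Module.finrank K (restrictTotalDegree (Fin 3) K D) := by
  classical
  have hL : ∀ l l' : K × K × K, ∃ L : MvPolynomial (Fin 3) K, l ≠ l' →
      (L.totalDegree ≤ 1 ∧ restrict l' L = 0 ∧ restrict l L ≠ 0) := fun l l' => by
    by_cases h : l = l'
    · exact ⟨0, fun h' => (h' h).elim⟩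
    · obtain ⟨L, hL⟩ := exists_linear_separator h
      exact ⟨L, fun _ => hL⟩
  choose L hL using hL
  set m := D + 2 - S.card with hm
  let v : S × Fin m → MvPolynomial (Fin 3) K := fun q =>
    X 0 ^ (q.2 : ℕ) * ∏ l' ∈ S.erase q.1.1, L q.1.1 l'
  let Ψ : (S × Fin m → K) →ₗ[K] MvPolynomial (Fin 3) K := Fintype.linearCombination K v
  have hΨdeg : LinearMap.range Ψ ≤ restrictTotalDegree (Fin 3) K D := by
    rintro _ ⟨c, rfl⟩
    simp only [Ψ, Fintype.linearCombination_apply]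
    refine Submodule.sum_mem _ fun q _ => Submodule.smul_mem _ _ ?_
    rw [mem_restrictTotalDegree]
    refine (totalDegree_mul _ _).trans ?_
    have h1 : (∏ l' ∈ S.erase q.1.1, L q.1.1 l').totalDegree ≤ S.card - 1 := by
      refine (totalDegree_finsetProd _ _).trans ?_
      rw [← Finset.card_erase_of_mem q.1.2, Finset.card_eq_sum_ones]
      exact Finset.sum_le_sum fun l' hl' => (hL _ _ (Finset.ne_of_mem_erase hl').symm).1
    have h2 : (X 0 ^ (q.2 : ℕ) : MvPolynomial (Fin 3) K).totalDegree = q.2 := totalDegree_X_pow _ _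
    have h3 := q.2.2
    have h4 := Finset.card_pos.2 ⟨_, q.1.2⟩
    omega
  have hv : ∀ (l : S) (q : S × Fin m), q.1 ≠ l → restrict l.1 (v q) = 0 := by
    intro l q hq
    have hmem : l.1 ∈ S.erase q.1.1 :=
      Finset.mem_erase.2 ⟨fun h => hq (Subtype.ext h.symm), l.2⟩
    simp only [v, map_mul, map_prod]
    rw [Finset.prod_eq_zero hmem, mul_zero]
    exact (hL q.1.1 l.1 (Finset.ne_of_mem_erase hmem).symm).2.1
  have hkey : ∀ c, (∀ l ∈ S, restrict l (Ψ c) = 0) → c = 0 := by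
    intro c hc
    ext ⟨l, i⟩
    have h := hc l.1 l.2
    simp only [Ψ, Fintype.linearCombination_apply, map_sum, map_smul] at h
    rw [Fintype.sum_prod_type, Finset.sum_eq_single l] at h
    · have hprod : (∏ l' ∈ S.erase l.1, restrict l.1 (L l.1 l')) ≠ 0 :=
        Finset.prod_ne_zero_iff.2 fun l' hl' => (hL _ _ (Finset.ne_of_mem_erase hl').symm).2.2
      have hX : restrict l.1 (X 0 : MvPolynomial (Fin 3) K) = Polynomial.X := by simp [restrict]
      simp only [v, map_mul, map_pow, map_prod, hX, ← smul_mul_assoc, ← Finset.sum_mul] at h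
      have h := (mul_eq_zero.1 h).resolve_right hprod
      have h := congr_arg (fun P => Polynomial.coeff P i) h
      simpa [Polynomial.finsetSum_coeff, Polynomial.coeff_X_pow, Fin.val_inj] using h
    · intro l' _ hl'
      exact Finset.sum_eq_zero fun i _ => by rw [hv l (l', i) hl', smul_zero]
    · exact fun h => (h (Finset.mem_univ _)).elim
  have hdisj : vanishingSpace S D ⊓ LinearMap.range Ψ = ⊥ := by
    rw [eq_bot_iff]
    rintro _ ⟨hG, ⟨c, rfl⟩⟩
    rw [hkey c (mem_vanishingSpace.1 hG).2, map_zero]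
    exact Submodule.zero_mem _
  have hinj : Function.Injective Ψ := by
    rw [← LinearMap.ker_eq_bot, LinearMap.ker_eq_bot']
    exact fun c hc => hkey c fun l _ => by rw [hc, map_zero]
  have hsum := Submodule.finrank_sup_add_finrank_inf_eq (vanishingSpace S D) (LinearMap.range Ψ)
  rw [hdisj, finrank_bot, add_zero, LinearMap.finrank_range_of_inj hinj,
    Module.finrank_fintype_fun_eq_card, Fintype.card_prod, Fintype.card_coe, Fintype.card_fin]
    at hsum
  rw [← hsum]
  exact Submodule.finrank_mono (sup_le inf_le_left hΨdeg)

/-- A prime `F` and a polynomial `H` not divisible by it vanish together on at most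
`deg F * deg H` rays. -/
theorem card_common_rays_le {F H : MvPolynomial (Fin 3) K} (hF : Prime F) (hFH : ¬ F ∣ H)
    (S : Finset (K × K × K)) (hS : ∀ l ∈ S, restrict l F = 0 ∧ restrict l H = 0) :
    S.card ≤ F.totalDegree * H.totalDegree := by
  by_contra! hlt
  have hnm : S.card ≤ S.card ^ 2 := by nlinarith
  have h1 := finrank_add_le_finrank_vanishingSpace hF hFH S hS
    (S.card ^ 2 + F.totalDegree + H.totalDegree) (by omega)
  have h2 := finrank_vanishingSpace_add_le S (S.card ^ 2 + F.totalDegree + H.totalDegree) (by omega)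
  generalize F.totalDegree = δ at *
  generalize H.totalDegree = e at *
  generalize S.card = n at *
  obtain ⟨m, hm⟩ : ∃ m, m = n ^ 2 := ⟨_, rfl⟩
  rw [← hm] at h1 h2 hnm
  rw [show m + δ + e - δ = m + e by omega, show m + δ + e - e = m + δ by omega,
    show m + e - e = m by omega] at h1
  have i1 := six_mul_finrank (K := K) (m + δ + e)
  have i2 := six_mul_finrank (K := K) (m + e)
  have i3 := six_mul_finrank (K := K) (m + δ)
  have i4 := six_mul_finrank (K := K) m
  obtain ⟨k, hk⟩ : ∃ k, m + δ + e + 2 = n + k := ⟨m + δ + e + 2 - n, by omega⟩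
  rw [show m + δ + e + 2 - n = k by omega] at h2
  have h4 : 6 * (n * k) + (m + e + 1) * (m + e + 2) * (m + e + 3) +
      (m + δ + 1) * (m + δ + 2) * (m + δ + 3) ≤
      (m + δ + e + 1) * (m + δ + e + 2) * (m + δ + e + 3) + (m + 1) * (m + 2) * (m + 3) := by
    omega
  zify at h4 hlt hk hm
  have hk' : (k : ℤ) = m + δ + e + 2 - n := by linarith
  rw [hk'] at h4
  have h5 : 2 * (n * ((m : ℤ) + δ + e + 2 - n)) ≤ δ * e * (2 * m + δ + e + 4) := by linarith
  have h6 : (δ * e : ℤ) + 1 ≤ n := hlt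
  have h7 := mul_nonneg (sub_nonneg.2 h6) (by positivity : (0 : ℤ) ≤ m + δ + e + 2)
  have h8 : (0 : ℤ) ≤ δ * e * (δ + e) := by positivity
  nlinarith

end Bezout

section Ode

open Polynomial

variable {K : Type*} [Field K]

theorem eq_zero_of_ode {φ q r g : K[X]} {t : K} {d : ℕ}
    (hd : ∀ k : ℕ, 0 < k → k ≤ d → (k : K) ≠ 0) (hg : g.natDegree ≤ d)
    (hode : φ * derivative (derivative g) =
      q * derivative g + r * g)
    (hφ : φ.eval t ≠ 0) (h0 : g.eval t = 0) (h1 : (derivative g).eval t = 0) :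
    g = 0 := by
  classical
  by_contra hne
  obtain ⟨m, hm⟩ : ∃ m, g.rootMultiplicity t = m + 2 := by
    have := (one_lt_rootMultiplicity_iff_isRoot hne).2 ⟨h0, h1⟩
    exact ⟨g.rootMultiplicity t - 2, by omega⟩
  have hmd : m + 2 ≤ d := by
    rw [← hm, ← count_roots]
    exact ((Multiset.count_le_card _ _).trans (card_roots' g)).trans hg
  obtain ⟨h, hgh, hht⟩ := exists_eq_pow_rootMultiplicity_mul_and_not_dvd g hne t
  rw [hm] at hgh
  have hg1 : derivative g =
      (X - C t) ^ (m + 1) * (((m + 2 : ℕ) : K[X]) * h + (X - C t) * derivative h) := by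
    rw [hgh, derivative_mul, derivative_X_sub_C_pow]
    simp only [map_natCast, Nat.reduceSubDiff]
    ring
  have hg2 : derivative (derivative g) =
      (X - C t) ^ m * (((m + 1 : ℕ) : K[X]) * (((m + 2 : ℕ) : K[X]) * h)) +
      (X - C t) ^ (m + 1) * ((((m + 1 : ℕ) : K[X]) + 1) * derivative h +
        ((m + 2 : ℕ) : K[X]) * derivative h + (X - C t) * derivative (derivative h)) := by
    rw [hg1, derivative_mul, derivative_X_sub_C_pow]
    simp only [derivative_add, derivative_mul, derivative_natCast, derivative_X_sub_C,
      map_natCast, Nat.add_sub_cancel]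
    push_cast
    ring
  have hdvd : (X - C t) ^ (m + 1) ∣ φ * derivative (derivative g) := by
    rw [hode]
    refine dvd_add (Dvd.dvd.mul_left ?_ _) (Dvd.dvd.mul_left ?_ _)
    · exact hg1 ▸ dvd_mul_right _ _
    · rw [hgh, pow_succ _ (m + 1), mul_assoc]
      exact dvd_mul_right _ _
  have hcop : IsCoprime ((X - C t) ^ (m + 1)) φ := by
    refine IsCoprime.pow_left ((irreducible_X_sub_C t).coprime_iff_not_dvd.2 ?_)
    rwa [dvd_iff_isRoot]
  have hdvd := hcop.dvd_of_dvd_mul_left hdvd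
  rw [hg2, dvd_add_left (dvd_mul_right _ _), pow_succ] at hdvd
  have hdvd := (mul_dvd_mul_iff_left (pow_ne_zero m (X_sub_C_ne_zero t))).1 hdvd
  rw [dvd_iff_isRoot] at hdvd hht
  simp only [IsRoot, eval_mul, eval_natCast] at hdvd hht
  exact mul_ne_zero (hd _ (by omega) (by omega)) (mul_ne_zero (hd _ (by omega) hmd) hht) hdvd

end Ode

section Derivatives

open MvPolynomial

variable {K : Type*} [Field K]

theorem totalDegree_pderiv_le (i : Fin 3) (F : MvPolynomial (Fin 3) K) :
    (pderiv i F).totalDegree ≤ F.totalDegree - 1 := by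
  rw [totalDegree, Finset.sup_le_iff]
  intro s hs
  rw [mem_support_iff, coeff_pderiv] at hs
  have h := le_totalDegree (mem_support_iff.2 (left_ne_zero_of_mul hs))
  simp only [Finsupp.sum_fintype, Finsupp.add_apply, Finset.sum_add_distrib,
    Finsupp.single_apply, Finset.sum_ite_eq, Finset.mem_univ, if_true, implies_true] at h ⊢
  omega

/-- The derivative in direction `(1, θ, θ²)`. -/
noncomputable def dirDeriv (θ : K) (F : MvPolynomial (Fin 3) K) : MvPolynomial (Fin 3) K :=
  pderiv 0 F + C θ * pderiv 1 F + C (θ ^ 2) * pderiv 2 F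

theorem derivative_restrict (l : K × K × K) (F : MvPolynomial (Fin 3) K) :
    Polynomial.derivative (restrict l F) = restrict l (dirDeriv l.1 F) := by
  induction F using MvPolynomial.induction_on with
  | C a => simp [dirDeriv, restrict]
  | add P Q hP hQ =>
    rw [map_add, map_add, hP, hQ]
    simp only [dirDeriv, map_add, map_mul]
    ring
  | mul_X P i hP =>
    rw [map_mul, Polynomial.derivative_mul, hP]
    have hX : Polynomial.derivative (restrict l (X i)) =
        restrict l (dirDeriv l.1 (X i : MvPolynomial (Fin 3) K)) := by
      fin_cases i <;> simp [dirDeriv, restrict, pderiv_X, Polynomial.derivative_pow]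
    rw [hX, ← map_mul, ← map_mul, ← map_add]
    congr 1
    simp only [dirDeriv, pderiv_mul]
    ring

/-- Coefficients of the remainder, as polynomials in the direction `θ`, of
`f₃³ ∂_θ² F` modulo `∂_θ F`; the remainder is `flexRem F 0 + θ * flexRem F 1`. -/
noncomputable def flexRem (F : MvPolynomial (Fin 3) K) (i : Fin 2) : MvPolynomial (Fin 3) K :=
  let f₁ := pderiv 0 F
  let f₂ := pderiv 1 F
  let f₃ := pderiv 2 F
  let p₀ := pderiv 0 f₁
  let p₁ := pderiv 0 f₂ + pderiv 1 f₁
  let p₂ := pderiv 0 f₃ + pderiv 1 f₂ + pderiv 2 f₁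
  let p₃ := pderiv 1 f₃ + pderiv 2 f₂
  let p₄ := pderiv 2 f₃
  let a₃ := f₃ * p₃ - p₄ * f₂
  let a₂ := f₃ * p₂ - p₄ * f₁
  let b₂ := f₃ * a₂ - a₃ * f₂
  ![f₃ ^ 3 * p₀ - b₂ * f₁, f₃ * (f₃ ^ 2 * p₁ - a₃ * f₁) - b₂ * f₂] i

theorem exists_flexRem_eq (F : MvPolynomial (Fin 3) K) (θ : K) :
    ∃ q, pderiv 2 F ^ 3 * dirDeriv θ (dirDeriv θ F) =
      q * dirDeriv θ F + (flexRem F 0 + C θ * flexRem F 1) := by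
  refine ⟨pderiv 2 F ^ 2 * pderiv 2 (pderiv 2 F) * C θ ^ 2 + pderiv 2 F *
    (pderiv 2 F * (pderiv 1 (pderiv 2 F) + pderiv 2 (pderiv 1 F)) -
      pderiv 2 (pderiv 2 F) * pderiv 1 F) * C θ +
    (pderiv 2 F * (pderiv 2 F * (pderiv 0 (pderiv 2 F) + pderiv 1 (pderiv 1 F) +
      pderiv 2 (pderiv 0 F)) - pderiv 2 (pderiv 2 F) * pderiv 0 F) -
      (pderiv 2 F * (pderiv 1 (pderiv 2 F) + pderiv 2 (pderiv 1 F)) -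
      pderiv 2 (pderiv 2 F) * pderiv 1 F) * pderiv 1 F), ?_⟩
  simp only [dirDeriv, flexRem, map_add, pderiv_C_mul, map_pow, Matrix.cons_val_zero,
    Matrix.cons_val_one]
  have h : ∀ (i : Fin 3) (P : MvPolynomial (Fin 3) K),
      pderiv i (C θ ^ 2 * P) = C θ ^ 2 * pderiv i P := fun i P => by
    rw [← map_pow, pderiv_C_mul]
  simp only [h]
  ring

theorem totalDegree_flexRem_le (F : MvPolynomial (Fin 3) K) (i : Fin 2) :
    (flexRem F i).totalDegree ≤ 4 * F.totalDegree := by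
  set d := F.totalDegree with hd
  have hf : ∀ i, (pderiv i F).totalDegree ≤ d := fun i =>
    (totalDegree_pderiv_le i F).trans (Nat.sub_le _ _)
  have hp : ∀ i j, (pderiv i (pderiv j F)).totalDegree ≤ d := fun i j =>
    (totalDegree_pderiv_le i _).trans ((Nat.sub_le _ _).trans (hf j))
  have hadd : ∀ {P Q : MvPolynomial (Fin 3) K} {m : ℕ}, P.totalDegree ≤ m → Q.totalDegree ≤ m →
      (P + Q).totalDegree ≤ m := fun hP hQ => (totalDegree_add _ _).trans (max_le hP hQ)
  have hsub : ∀ {P Q : MvPolynomial (Fin 3) K} {m : ℕ}, P.totalDegree ≤ m → Q.totalDegree ≤ m →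
      (P - Q).totalDegree ≤ m := fun hP hQ => (totalDegree_sub _ _).trans (max_le hP hQ)
  have hmul : ∀ {P Q : MvPolynomial (Fin 3) K} {m k : ℕ}, P.totalDegree ≤ m → Q.totalDegree ≤ k →
      (P * Q).totalDegree ≤ m + k := fun hP hQ => (totalDegree_mul _ _).trans (add_le_add hP hQ)
  have hpow : ∀ (k : ℕ), (pderiv 2 F ^ k).totalDegree ≤ k * d := fun k =>
    (totalDegree_pow _ _).trans (Nat.mul_le_mul_left k (hf 2))
  have ha : ∀ {P : MvPolynomial (Fin 3) K} (i : Fin 3), P.totalDegree ≤ d →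
      (pderiv 2 F * P - pderiv 2 (pderiv 2 F) * pderiv i F).totalDegree ≤ d + d := fun i hP =>
    hsub (hmul (hf 2) hP) (hmul (hp _ _) (hf i))
  have ha3 := ha 1 (hadd (hp 1 2) (hp 2 1))
  have ha2 := ha 0 (hadd (hadd (hp 0 2) (hp 1 1)) (hp 2 0))
  have hb : (pderiv 2 F * (pderiv 2 F * (pderiv 0 (pderiv 2 F) + pderiv 1 (pderiv 1 F) +
      pderiv 2 (pderiv 0 F)) - pderiv 2 (pderiv 2 F) * pderiv 0 F) -
      (pderiv 2 F * (pderiv 1 (pderiv 2 F) + pderiv 2 (pderiv 1 F)) -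
      pderiv 2 (pderiv 2 F) * pderiv 1 F) * pderiv 1 F).totalDegree ≤ 3 * d :=
    hsub ((hmul (hf 2) ha2).trans (by omega)) ((hmul ha3 (hf 1)).trans (by omega))
  fin_cases i
  · refine hsub ((hmul (hpow 3) (hp 0 0)).trans (by omega)) ((hmul hb (hf 0)).trans (by omega))
  · refine hsub ((hmul (hf 2) (hsub (m := 3 * d) ?_ ?_)).trans (by omega))
      ((hmul hb (hf 1)).trans (by omega))
    · exact (hmul (hpow 2) (hadd (hp 0 1) (hp 1 0))).trans (by omega)
    · exact (hmul ha3 (hf 0)).trans (by omega)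

/-- If `F` divides both flex remainders, a tangent direction at a point with `f₃ ≠ 0` spans a ray
contained in the zero set of `F`. -/
theorem restrict_eq_zero_of_tangent {F : MvPolynomial (Fin 3) K} {d : ℕ}
    (hd : ∀ k : ℕ, 0 < k → k ≤ d → (k : K) ≠ 0) (hF : F.totalDegree ≤ d)
    (h0 : F ∣ flexRem F 0) (h1 : F ∣ flexRem F 1) (l : K × K × K) (t : K)
    (hx : eval (rayPt l t) F = 0) (hx1 : eval (rayPt l t) (dirDeriv l.1 F) = 0)
    (hx3 : eval (rayPt l t) (pderiv 2 F) ≠ 0) : restrict l F = 0 := by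
  obtain ⟨q, hq⟩ := exists_flexRem_eq F l.1
  obtain ⟨r, hr⟩ : F ∣ flexRem F 0 + C l.1 * flexRem F 1 := dvd_add h0 (h1.mul_left _)
  rw [hr] at hq
  refine eq_zero_of_ode (φ := restrict l (pderiv 2 F ^ 3)) (q := restrict l q) (r := restrict l r)
    (t := t) hd (natDegree_restrict_le l hF) ?_ ?_ ?_ ?_
  · rw [derivative_restrict, derivative_restrict, ← map_mul, hq, map_add, map_mul, map_mul]
    ring
  · rw [eval_restrict, map_pow]
    exact pow_ne_zero 3 hx3
  · rw [eval_restrict, hx]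
  · rw [derivative_restrict, eval_restrict, hx1]

theorem eq_C_of_pderiv_eq_zero {F : MvPolynomial (Fin 3) K} {d : ℕ}
    (hd : ∀ k : ℕ, 0 < k → k ≤ d → (k : K) ≠ 0) (hF : F.totalDegree ≤ d)
    (h : ∀ i, pderiv i F = 0) : F.totalDegree = 0 := by
  by_contra hne
  obtain ⟨s, hs, hsF⟩ : ∃ s ∈ F.support, s ≠ 0 := by
    by_contra! hall
    refine hne (Nat.le_zero.1 (Finset.sup_le fun s hs => ?_))
    rw [hall s hs]
    simp
  obtain ⟨i, hi⟩ : ∃ i, s i ≠ 0 := by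
    by_contra! hall
    exact hsF (Finsupp.ext hall)
  have hsi : s - Finsupp.single i 1 + Finsupp.single i 1 = s :=
    tsub_add_cancel_of_le (Finsupp.single_le_iff.2 (Nat.one_le_iff_ne_zero.2 hi))
  have hc := coeff_pderiv (i := i) F (s - Finsupp.single i 1)
  rw [h i, coeff_zero, hsi] at hc
  have hle : s i ≤ d := by
    refine le_trans ?_ ((le_totalDegree hs).trans hF)
    rw [Finsupp.sum_fintype _ _ fun _ => rfl]
    exact Finset.single_le_sum (f := fun j => s j) (fun _ _ => Nat.zero_le _) (Finset.mem_univ i)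
  have hcast : (((s - Finsupp.single i 1 : Fin 3 →₀ ℕ) i : ℕ) : K) + 1 = (s i : K) := by
    simp only [Finsupp.tsub_apply, Finsupp.single_eq_same]
    exact_mod_cast congr_arg (Nat.cast (R := K)) (Nat.sub_add_cancel (Nat.pos_of_ne_zero hi))
  rw [hcast] at hc
  exact mul_ne_zero (mem_support_iff.1 hs) (hd _ (Nat.pos_of_ne_zero hi) hle) hc.symm

end Derivatives

section Incidence

open MvPolynomial

variable {K : Type*} [Field K]

/-- Vanishes exactly when two rays with different directions meet. -/
def meetForm (l l' : K × K × K) : K := l.2.2 - l'.2.2 - (l'.1 * l.2.1 - l.1 * l'.2.1)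

theorem meetForm_swap (l l' : K × K × K) : meetForm l l' = -meetForm l' l := by
  simp only [meetForm]
  ring

/-- The ray through `x` in direction `(1, θ, θ²)`. -/
def rayThrough (x : Fin 3 → K) (θ : K) : K × K × K := (θ, x 1 - θ * x 0, x 2 - θ * x 1)

/-- The two linear forms cutting out the ray `l`. -/
noncomputable def rayDen (l : K × K × K) : MvPolynomial (Fin 3) K := X 1 - C l.1 * X 0 - C l.2.1

/-- See `rayDen`. -/
noncomputable def rayNum (l : K × K × K) : MvPolynomial (Fin 3) K := X 2 - C l.1 * X 1 - C l.2.2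

theorem rayPt_rayThrough (x : Fin 3 → K) (θ : K) : rayPt (rayThrough x θ) (x 0) = x := by
  ext i
  fin_cases i <;> simp [rayPt, rayThrough]; ring

theorem rayThrough_rayPt (l : K × K × K) (t : K) : rayThrough (rayPt l t) l.1 = l := by
  refine Prod.ext rfl (Prod.ext ?_ ?_) <;> simp [rayPt, rayThrough]; ring

theorem meetForm_rayThrough (x : Fin 3 → K) (θ : K) (l : K × K × K) :
    meetForm (rayThrough x θ) l = eval x (rayNum l) - θ * eval x (rayDen l) := by
  simp [meetForm, rayThrough, rayNum, rayDen]
  ring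

theorem meetForm_eq_zero_of_rayPt_eq {l l' : K × K × K} {s t : K} (h : rayPt l s = rayPt l' t) :
    meetForm l l' = 0 := by
  have h0 := congr_fun h 0
  have h1 := congr_fun h 1
  have h2 := congr_fun h 2
  simp [rayPt] at h0 h1 h2
  subst h0
  simp only [meetForm]
  linear_combination h2 - (l.1 + l'.1) * h1

theorem exists_rayPt_eq {l l' : K × K × K} (hθ : l.1 ≠ l'.1) (h : meetForm l l' = 0) :
    ∃ t, rayPt l t = rayPt l' t := by
  have hne := sub_ne_zero.2 hθ
  refine ⟨(l'.2.1 - l.2.1) / (l.1 - l'.1), ?_⟩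
  simp only [meetForm] at h
  ext i
  fin_cases i
  · simp [rayPt]
  · simp [rayPt]
    field_simp
    ring
  · simp [rayPt]
    field_simp
    linear_combination (l.1 - l'.1) * h

theorem eval_rayDen_rayPt (l : K × K × K) (t : K) : eval (rayPt l t) (rayDen l) = 0 := by
  simp [rayDen, rayPt]

theorem eval_rayNum_rayPt (l : K × K × K) (t : K) : eval (rayPt l t) (rayNum l) = 0 := by
  simp [rayNum, rayPt]
  ring

theorem totalDegree_linear_le (i j : Fin 3) (a b : K) :
    (X i - C a * X j - C b : MvPolynomial (Fin 3) K).totalDegree ≤ 1 := by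
  refine (totalDegree_sub_C_le _ _).trans ((totalDegree_sub _ _).trans (max_le ?_ ?_))
  · simp
  · refine (totalDegree_mul _ _).trans ?_
    simp

/-- The tangency form: for a ray `l`, the value at `x` detects whether the direction from `x`
determined by `l` is tangent to `F = 0`. -/
noncomputable def tangentForm (F : MvPolynomial (Fin 3) K) (l : K × K × K) :
    MvPolynomial (Fin 3) K :=
  rayDen l ^ 2 * pderiv 0 F + rayDen l * rayNum l * pderiv 1 F + rayNum l ^ 2 * pderiv 2 F

theorem totalDegree_tangentForm_le (F : MvPolynomial (Fin 3) K) (l : K × K × K) :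
    (tangentForm F l).totalDegree ≤ F.totalDegree + 2 := by
  have hf : ∀ i, (pderiv i F).totalDegree ≤ F.totalDegree := fun i =>
    (totalDegree_pderiv_le i F).trans (Nat.sub_le _ _)
  have hd : (rayDen l).totalDegree ≤ 1 := totalDegree_linear_le _ _ _ _
  have hn : (rayNum l).totalDegree ≤ 1 := totalDegree_linear_le _ _ _ _
  have h : ∀ {P Q : MvPolynomial (Fin 3) K} (i : Fin 3), P.totalDegree ≤ 1 → Q.totalDegree ≤ 1 →
      (P * Q * pderiv i F).totalDegree ≤ F.totalDegree + 2 := fun {P Q} i hP hQ => by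
    have h1 := totalDegree_mul (P * Q) (pderiv i F)
    have h2 := totalDegree_mul P Q
    have := hf i
    omega
  rw [tangentForm, sq, sq]
  exact (totalDegree_add _ _).trans (max_le ((totalDegree_add _ _).trans
    (max_le (h 0 hd hd) (h 1 hd hn))) (h 2 hn hn))

end Incidence

section Links

variable {α β : Type*}

open Classical in
/-- The neighbours of `i` in `S`. -/
noncomputable def nbrs (Adj : α → β → Prop) (S : Finset β) (i : α) : Finset β :=
  S.filter (Adj i)

theorem mem_nbrs {Adj : α → β → Prop} {S : Finset β} {i : α} {j : β} :
    j ∈ nbrs Adj S i ↔ j ∈ S ∧ Adj i j := by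
  classical
  exact Finset.mem_filter

/-- The number of adjacent pairs in `S × T`. -/
noncomputable def links (Adj : α → β → Prop) (S : Finset α) (T : Finset β) : ℕ :=
  ∑ i ∈ S, (nbrs Adj T i).card

theorem links_comm {Adj : α → α → Prop} (hsymm : ∀ i j, Adj i j → Adj j i) (S T : Finset α) :
    links Adj S T = links Adj T S := by
  classical
  have h := Finset.sum_card_bipartiteAbove_eq_sum_card_bipartiteBelow Adj (s := S) (t := T)
  simp only [Finset.bipartiteAbove, Finset.bipartiteBelow] at h
  simp only [links, nbrs]
  rw [h]
  exact Finset.sum_congr rfl fun j _ => congr_arg Finset.card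
    (Finset.filter_congr fun i _ => ⟨hsymm i j, hsymm j i⟩)

theorem links_union_left [DecidableEq α] {Adj : α → α → Prop} {S T : Finset α}
    (h : Disjoint S T) (U : Finset α) :
    links Adj (S ∪ T) U = links Adj S U + links Adj T U :=
  Finset.sum_union h

theorem links_union_self [DecidableEq α] {Adj : α → α → Prop} (hsymm : ∀ i j, Adj i j → Adj j i)
    {S T : Finset α} (h : Disjoint S T) :
    links Adj (S ∪ T) (S ∪ T) = links Adj S S + links Adj T T + 2 * links Adj T S := by
  rw [links_union_left h, links_comm hsymm S, links_comm hsymm T, links_union_left h,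
    links_union_left h, links_comm hsymm S T]
  ring

theorem links_self_le_add [DecidableEq α] {Adj : α → α → Prop}
    (hsymm : ∀ i j, Adj i j → Adj j i) {S U : Finset α} (h : U ⊆ S) :
    links Adj S S ≤ links Adj U U + 2 * links Adj (S \ U) S := by
  have h1 := links_union_self hsymm (Finset.disjoint_sdiff (s := U) (t := S))
  have h2 := links_union_left (Adj := Adj) (Finset.disjoint_sdiff (s := U) (t := S)) (S \ U)
  rw [Finset.union_sdiff_of_subset h] at h1 h2
  have h3 := links_comm hsymm S (S \ U)
  have h4 := links_comm hsymm U (S \ U)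
  omega

/-- Greedy sampling: there is a small set `T ⊆ S` such that the vertices with at most `k`
neighbours in `T` carry a small part of the total degree. -/
theorem exists_sample {Adj : α → α → Prop} (S : Finset α)
    (k : ℕ) (η : ℝ) (hη : 0 < η) :
    ∃ T ⊆ S, η * T.card ≤ (k + 1) * links Adj S S ∧
      ∀ U ⊆ S, (∀ i ∈ U, (nbrs Adj T i).card ≤ k) →
        ∑ i ∈ U, ((nbrs Adj S i).card : ℝ) * ((nbrs Adj S i).card - k) ≤ η * S.card := by
  classical
  let Φ : Finset α → ℕ := fun T =>
    ∑ i ∈ S, (nbrs Adj S i).card * min (k + 1) (nbrs Adj T i).card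
  obtain ⟨T, hT, hmax⟩ := Finset.exists_max_image
    (S.powerset.filter fun T => η * T.card ≤ Φ T) Finset.card
    ⟨∅, by simp⟩
  simp only [Finset.mem_filter, Finset.mem_powerset] at hT hmax
  refine ⟨T, hT.1, hT.2.trans ?_, fun U hU hUk => ?_⟩
  · have : Φ T ≤ (k + 1) * links Adj S S := by
      rw [links, Finset.mul_sum]
      refine Finset.sum_le_sum fun i _ => ?_
      rw [mul_comm]
      exact Nat.mul_le_mul_right _ (min_le_left _ _)
    exact_mod_cast this
  · have hj : ∀ j ∈ S \ T, ∑ i ∈ U with Adj i j, ((nbrs Adj S i).card : ℝ) ≤ η := by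
      intro j hj
      rw [Finset.mem_sdiff] at hj
      by_contra! hlt
      have hΦ : (Φ T : ℝ) + ∑ i ∈ U with Adj i j, ((nbrs Adj S i).card : ℝ) ≤
          Φ (insert j T) := by
        have : Φ T + ∑ i ∈ U with Adj i j, (nbrs Adj S i).card ≤ Φ (insert j T) := by
          have hsub : (U.filter fun i => Adj i j) = S.filter fun i => i ∈ U ∧ Adj i j := by
            ext i
            simp only [Finset.mem_filter]
            exact ⟨fun h => ⟨hU h.1, h⟩, fun h => h.2⟩
          rw [hsub, Finset.sum_filter, ← Finset.sum_add_distrib]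
          refine Finset.sum_le_sum fun i _ => ?_
          split_ifs with hi
          · have hins : nbrs Adj (insert j T) i = insert j (nbrs Adj T i) := by
              ext x
              simp only [mem_nbrs, Finset.mem_insert]
              exact ⟨by tauto, by rintro (rfl | h) <;> tauto⟩
            rw [hins, Finset.card_insert_of_notMem fun h => hj.2 (mem_nbrs.1 h).1,
              min_eq_right ((hUk i hi.1).trans (Nat.le_succ k)),
              min_eq_right (Nat.succ_le_succ (hUk i hi.1)), Nat.mul_succ]
          · refine Nat.mul_le_mul_left _ (min_le_min_left _ (Finset.card_le_card fun x hx => ?_))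
            rw [mem_nbrs] at hx ⊢
            exact ⟨Finset.mem_insert_of_mem hx.1, hx.2⟩
        exact_mod_cast this
      have h1 := hmax (insert j T) ⟨Finset.insert_subset hj.1 hT.1, by
        rw [Finset.card_insert_of_notMem hj.2]
        push_cast
        linarith [hT.2]⟩
      rw [Finset.card_insert_of_notMem hj.2] at h1
      omega
    calc ∑ i ∈ U, ((nbrs Adj S i).card : ℝ) * ((nbrs Adj S i).card - k)
        ≤ ∑ i ∈ U, ((nbrs Adj S i).card : ℝ) * (nbrs Adj (S \ T) i).card := by
          refine Finset.sum_le_sum fun i hi => mul_le_mul_of_nonneg_left ?_ (Nat.cast_nonneg _)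
          have h1 : (nbrs Adj S i).card ≤ (nbrs Adj (S \ T) i).card + (nbrs Adj T i).card := by
            rw [← Finset.card_union_of_disjoint]
            · refine Finset.card_le_card fun j hj => ?_
              simp only [Finset.mem_union, mem_nbrs, Finset.mem_sdiff] at hj ⊢
              tauto
            · rw [Finset.disjoint_left]
              intro j hj hj'
              simp only [mem_nbrs, Finset.mem_sdiff] at hj hj'
              tauto
          have h2 := hUk i hi
          have h3 : ((nbrs Adj S i).card : ℝ) ≤ (nbrs Adj (S \ T) i).card + k := by
            exact_mod_cast h1.trans (by omega)
          linarith
      _ = ∑ j ∈ S \ T, ∑ i ∈ U with Adj i j, ((nbrs Adj S i).card : ℝ) := by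
          simp only [nbrs, Finset.sum_filter]
          rw [Finset.sum_comm]
          refine Finset.sum_congr rfl fun i _ => ?_
          rw [← Finset.sum_filter, Finset.sum_const, nsmul_eq_mul, mul_comm]
      _ ≤ ∑ j ∈ S \ T, η := Finset.sum_le_sum hj
      _ ≤ η * S.card := by
          rw [Finset.sum_const, nsmul_eq_mul, mul_comm]
          have : ((S \ T).card : ℝ) ≤ S.card := by
            exact_mod_cast Finset.card_le_card Finset.sdiff_subset
          exact mul_le_mul_of_nonneg_left this hη.le

end Links

section RayGraph

open MvPolynomial

variable {K : Type*} [Field K]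

/-- A graph on rays in which adjacent rays meet and two neighbours of the same ray are skew. -/
structure IsRayGraph (Adj : K × K × K → K × K × K → Prop) : Prop where
  symm : ∀ i j, Adj i j → Adj j i
  dir : ∀ i j, Adj i j → i.1 ≠ j.1
  meet : ∀ i j, Adj i j → meetForm i j = 0
  skew : ∀ i j k, Adj i j → Adj i k → j ≠ k → meetForm j k ≠ 0

variable {Adj : K × K × K → K × K × K → Prop}

theorem IsRayGraph.restrict_eq_zero (hG : IsRayGraph Adj) {i : K × K × K}
    {H : MvPolynomial (Fin 3) K} (T : Finset (K × K × K)) (hT : ∀ j ∈ T, Adj i j)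
    (hcard : H.totalDegree < T.card)
    (h : ∀ j ∈ T, ∀ t, rayPt i t = rayPt j t → eval (rayPt i t) H = 0) : restrict i H = 0 := by
  classical
  have hex : ∀ j, ∃ t, j ∈ T → rayPt i t = rayPt j t := fun j => by
    by_cases hj : j ∈ T
    · obtain ⟨t, ht⟩ := exists_rayPt_eq (hG.dir i j (hT j hj)) (hG.meet i j (hT j hj))
      exact ⟨t, fun _ => ht⟩
    · exact ⟨0, fun h => (hj h).elim⟩
  choose τ hτ using hex
  refine restrict_eq_zero_of_card i le_rfl (T.image τ) ?_ ?_
  · rwa [Finset.card_image_of_injOn]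
    intro j hj k hk hjk
    by_contra hne
    refine hG.skew i j k (hT j hj) (hT k hk) hne
      (meetForm_eq_zero_of_rayPt_eq (s := τ j) (t := τ k) ?_)
    rw [← hτ j hj, ← hτ k hk]
    exact congr_arg _ hjk
  · intro t ht
    obtain ⟨j, hj, rfl⟩ := Finset.mem_image.1 ht
    exact h j hj _ (hτ j hj)

theorem IsRayGraph.card_nbrs_le (hG : IsRayGraph Adj) {i : K × K × K}
    {H : MvPolynomial (Fin 3) K} (hH : restrict i H ≠ 0) {S : Finset (K × K × K)}
    (hS : ∀ j ∈ S, restrict j H = 0) : (nbrs Adj S i).card ≤ H.totalDegree := by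
  by_contra! hlt
  refine hH (hG.restrict_eq_zero _ (fun j hj => (mem_nbrs.1 hj).2) hlt fun j hj t ht => ?_)
  rw [ht, ← eval_restrict, hS j (mem_nbrs.1 hj).1, Polynomial.eval_zero]

/-- The data of a polynomial `F` of least degree vanishing on a set `S ⊆ L` of rays spanning many
edges of the graph, `S` being as small as possible. -/
structure IsCritical (Adj : K × K × K → K × K × K → Prop) (L : Finset (K × K × K)) (M : ℕ)
    (F : MvPolynomial (Fin 3) K) (S : Finset (K × K × K)) : Prop where
  subset : S ⊆ L
  ne_zero : F ≠ 0
  vanish : ∀ l ∈ S, restrict l F = 0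
  heavy : (1000 * F.totalDegree + 2 * M) * S.card < links Adj S S
  minimal : ∀ G : MvPolynomial (Fin 3) K, G ≠ 0 → ∀ S' ⊆ L, (∀ l ∈ S', restrict l G = 0) →
    (G.totalDegree < F.totalDegree ∨ G.totalDegree = F.totalDegree ∧ S'.card < S.card) →
      links Adj S' S' ≤ (1000 * G.totalDegree + 2 * M) * S'.card

theorem exists_isCritical (L : Finset (K × K × K)) (M : ℕ) {F₀ : MvPolynomial (Fin 3) K}
    (h0 : F₀ ≠ 0) (hv : ∀ l ∈ L, restrict l F₀ = 0)
    (hheavy : (1000 * F₀.totalDegree + 2 * M) * L.card < links Adj L L) :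
    ∃ F S, IsCritical Adj L M F S ∧ F.totalDegree ≤ F₀.totalDegree := by
  classical
  let P : ℕ → Prop := fun δ => ∃ (F : MvPolynomial (Fin 3) K) (S : Finset (K × K × K)),
    F.totalDegree = δ ∧ S ⊆ L ∧ F ≠ 0 ∧ (∀ l ∈ S, restrict l F = 0) ∧
      (1000 * F.totalDegree + 2 * M) * S.card < links Adj S S
  have hP : ∃ δ, P δ := ⟨_, F₀, L, rfl, Finset.Subset.refl L, h0, hv, hheavy⟩
  let Q : ℕ → Prop := fun n => ∃ (F : MvPolynomial (Fin 3) K) (S : Finset (K × K × K)),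
    S.card = n ∧ F.totalDegree = Nat.find hP ∧ S ⊆ L ∧ F ≠ 0 ∧ (∀ l ∈ S, restrict l F = 0) ∧
      (1000 * F.totalDegree + 2 * M) * S.card < links Adj S S
  have hQ : ∃ n, Q n := by
    obtain ⟨F, S, h⟩ := Nat.find_spec hP
    exact ⟨_, F, S, rfl, h⟩
  obtain ⟨F, S, h1, h2, h3, h4, h5, h6⟩ := Nat.find_spec hQ
  refine ⟨F, S, ⟨h3, h4, h5, h6, fun G hG0 S' hS' hv' hlt => ?_⟩, ?_⟩
  · by_contra! hcon
    rcases hlt with hlt | ⟨heq, hlt⟩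
    · exact Nat.find_min hP (h2 ▸ hlt) ⟨G, S', rfl, hS', hG0, hv', hcon⟩
    · exact Nat.find_min hQ (h1 ▸ hlt) ⟨G, S', rfl, heq.trans h2, hS', hG0, hv', hcon⟩
  · rw [h2]
    exact Nat.find_min' hP ⟨F₀, L, rfl, Finset.Subset.refl L, h0, hv, hheavy⟩

variable {L S : Finset (K × K × K)} {M : ℕ} {F : MvPolynomial (Fin 3) K}

theorem IsCritical.card_pos (hc : IsCritical Adj L M F S) : 0 < S.card := by
  rw [Finset.card_pos, Finset.nonempty_iff_ne_empty]
  rintro rfl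
  simpa [links] using hc.heavy

theorem IsCritical.totalDegree_pos (hc : IsCritical Adj L M F S) : 0 < F.totalDegree := by
  rw [Nat.pos_iff_ne_zero]
  intro h0
  rw [totalDegree_eq_zero_iff_eq_C] at h0
  obtain ⟨l, hl⟩ := Finset.card_pos.1 hc.card_pos
  have h1 := hc.vanish l hl
  have h2 := hc.ne_zero
  rw [h0] at h1 h2
  simp [restrict] at h1
  simp [h1] at h2

theorem IsCritical.lt_two_mul_card_nbrs (hG : IsRayGraph Adj) (hc : IsCritical Adj L M F S)
    {l : K × K × K} (hl : l ∈ S) :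
    1000 * F.totalDegree + 2 * M < 2 * (nbrs Adj S l).card := by
  classical
  by_contra! hle
  have h1 := links_self_le_add hG.symm (Finset.erase_subset l S)
  have h2 := hc.minimal F hc.ne_zero (S.erase l) ((Finset.erase_subset l S).trans hc.subset)
    (fun i hi => hc.vanish i (Finset.mem_of_mem_erase hi))
    (Or.inr ⟨rfl, Finset.card_erase_lt_of_mem hl⟩)
  have h3 : links Adj (S \ S.erase l) S = (nbrs Adj S l).card := by
    rw [Finset.sdiff_erase_self hl, links, Finset.sum_singleton]
  have h4 := hc.heavy
  rw [h3] at h1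
  rw [← Finset.card_erase_add_one hl, mul_add, mul_one] at h4
  omega

theorem IsCritical.prime (hG : IsRayGraph Adj) (hc : IsCritical Adj L M F S) : Prime F := by
  classical
  refine Irreducible.prime ⟨fun hu => ?_, fun {P Q} hPQ => ?_⟩
  · have := hc.totalDegree_pos
    rw [(isUnit_iff_totalDegree_of_isReduced.1 hu).2] at this
    omega
  · by_contra! hcon
    have hP0 : P ≠ 0 := fun h => hc.ne_zero (by rw [hPQ, h, zero_mul])
    have hQ0 : Q ≠ 0 := fun h => hc.ne_zero (by rw [hPQ, h, mul_zero])
    have hpos : ∀ R : MvPolynomial (Fin 3) K, R ≠ 0 → ¬IsUnit R → 0 < R.totalDegree := by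
      intro R hR hu
      rw [Nat.pos_iff_ne_zero]
      intro h0
      rw [totalDegree_eq_zero_iff_eq_C] at h0
      rw [h0] at hR hu
      exact hu (((isUnit_iff_ne_zero).2 fun h => hR (by rw [h, C_0])).map C)
    have hdeg : F.totalDegree = P.totalDegree + Q.totalDegree := by
      rw [hPQ, totalDegree_mul_of_isDomain hP0 hQ0]
    have hPpos := hpos P hP0 hcon.1
    have hQpos := hpos Q hQ0 hcon.2
    set U := S.filter fun l => restrict l P = 0 with hU
    set V := S.filter fun l => ¬restrict l P = 0 with hV
    have hUS : U ⊆ S := Finset.filter_subset _ _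
    have hVS : V ⊆ S := Finset.filter_subset _ _
    have hdisj : Disjoint U V := Finset.disjoint_filter_filter_not _ _ _
    have hunion : U ∪ V = S := Finset.filter_union_filter_not_eq _ _
    have hcard : U.card + V.card = S.card := by rw [← hunion, Finset.card_union_of_disjoint hdisj]
    have h1 := hc.minimal P hP0 U (hUS.trans hc.subset) (fun l hl => (Finset.mem_filter.1 hl).2)
      (Or.inl (by omega))
    have h2 := hc.minimal Q hQ0 V (hVS.trans hc.subset) (fun l hl => by
      have h := hc.vanish l (hVS hl)
      rw [hPQ, map_mul] at h
      exact (mul_eq_zero.1 h).resolve_left (Finset.mem_filter.1 hl).2) (Or.inl (by omega))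
    have h3 := links_union_self hG.symm hdisj
    have h4 : links Adj V U ≤ V.card * P.totalDegree := by
      rw [links, ← smul_eq_mul]
      refine Finset.sum_le_card_nsmul _ _ _ fun l hl => ?_
      exact hG.card_nbrs_le (Finset.mem_filter.1 hl).2 fun j hj => (Finset.mem_filter.1 hj).2
    have h5 := hc.heavy
    rw [hunion] at h3
    rw [h3, ← hcard, hdeg] at h5
    nlinarith [mul_pos hPpos hQpos, Nat.zero_le (U.card * Q.totalDegree),
      Nat.zero_le (V.card * P.totalDegree)]

end RayGraph

section RayGraph

open MvPolynomial

variable {K : Type*} [Field K] {Adj : K × K × K → K × K × K → Prop}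
  {L S : Finset (K × K × K)} {M : ℕ} {F : MvPolynomial (Fin 3) K}

theorem IsCritical.four_mul_sq_lt_card (hG : IsRayGraph Adj) (hc : IsCritical Adj L M F S) :
    4 * F.totalDegree ^ 2 < S.card := by
  classical
  by_contra! hle
  have hδ := hc.totalDegree_pos
  have hn := hc.card_pos
  have hheavy := hc.heavy
  have hdeg : ∀ l ∈ S, 1000 * F.totalDegree + 2 * M < 2 * (nbrs Adj S l).card :=
    fun l hl => hc.lt_two_mul_card_nbrs hG hl
  set δ := F.totalDegree with hδdef
  set W := links Adj S S with hW
  set k := δ / 2 with hk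
  have hWpos : 0 < W := by omega
  have hδR : (0 : ℝ) < δ := by exact_mod_cast hδ
  have hnR : (0 : ℝ) < S.card := by exact_mod_cast hn
  have hWR : (0 : ℝ) < W := by exact_mod_cast hWpos
  set η : ℝ := 1000 * δ * W / (16 * S.card) with hη
  have hηpos : 0 < η := by positivity
  obtain ⟨T, hTS, hTcard, hTU⟩ := exists_sample (Adj := Adj) S k η hηpos
  have hleR : (S.card : ℝ) ≤ 4 * δ ^ 2 := by exact_mod_cast hle
  have hT : (1000 : ℝ) * T.card ≤ 64 * δ * (k + 1) := by
    have h1 : (1000 * δ * W * T.card : ℝ) ≤ 16 * S.card * ((k + 1) * W) := by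
      have h2 : η * T.card * (16 * S.card) ≤ (k + 1) * W * (16 * S.card) :=
        mul_le_mul_of_nonneg_right hTcard (by positivity)
      have h3 : η * T.card * (16 * S.card) = 1000 * δ * W * T.card := by
        rw [hη]
        field_simp
      linarith
    have h4 : 16 * (S.card : ℝ) * ((k + 1) * W) ≤ 16 * (4 * δ ^ 2) * ((k + 1) * W) := by
      gcongr
    have h5 : (δ * W : ℝ) * (1000 * T.card) ≤ (δ * W) * (64 * δ * (k + 1)) := by linarith
    exact le_of_mul_le_mul_left h5 (by positivity)
  have hT' : 1000 * T.card ≤ 64 * δ * (k + 1) := by exact_mod_cast hT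
  have hδk : δ ≤ 2 * k + 1 := by omega
  have hT6 : 6 * T.card < (k + 2) * (k + 3) := by nlinarith
  obtain ⟨G, hG0, hGdeg, hGv⟩ := exists_vanishing T k hT6
  set U := S.filter fun l => ¬(nbrs Adj T l).card ≤ k with hU
  have hUS : U ⊆ S := Finset.filter_subset _ _
  have hSU : S \ U = S.filter fun l => (nbrs Adj T l).card ≤ k := by
    ext l
    simp only [hU, Finset.mem_sdiff, Finset.mem_filter]
    tauto
  have hUv : ∀ l ∈ U, restrict l G = 0 := by
    intro l hl
    by_contra hne
    have h1 := hG.card_nbrs_le hne hGv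
    have h2 := (Finset.mem_filter.1 hl).2
    omega
  have h1 := hc.minimal G hG0 U (hUS.trans hc.subset) hUv (Or.inl (by omega))
  have h2 := links_self_le_add hG.symm hUS
  have h3 := hTU (S \ U) Finset.sdiff_subset fun i hi => by
    rw [hSU] at hi
    exact (Finset.mem_filter.1 hi).2
  have h4 : ((1000 * δ + 2 * M : ℝ) / 4) * links Adj (S \ U) S ≤ η * S.card := by
    refine le_trans ?_ h3
    rw [links, Nat.cast_sum, Finset.mul_sum]
    refine Finset.sum_le_sum fun i hi => ?_
    rw [mul_comm]
    refine mul_le_mul_of_nonneg_left ?_ (Nat.cast_nonneg _)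
    have h5 : (1000 * δ + 2 * M : ℝ) ≤ 2 * (nbrs Adj S i).card := by
      exact_mod_cast (hdeg i (Finset.sdiff_subset hi)).le
    have h6 : (2 * k : ℝ) ≤ δ := by exact_mod_cast (by omega : 2 * k ≤ δ)
    have h7 : (0 : ℝ) ≤ M := Nat.cast_nonneg M
    linarith
  have h5 : η * S.card = 1000 * δ * W / 16 := by
    rw [hη]
    field_simp
  rw [h5] at h4
  have h6 : (4 * (1000 * δ + 2 * M) : ℝ) * links Adj (S \ U) S ≤ 1000 * δ * W := by linarith
  have h6 : 4 * (1000 * δ + 2 * M) * links Adj (S \ U) S ≤ 1000 * δ * W := by exact_mod_cast h6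
  have h7 : U.card ≤ S.card := Finset.card_le_card hUS
  have h8 : (1000 * G.totalDegree + 2 * M) * U.card ≤ (500 * δ + 2 * M) * S.card :=
    Nat.mul_le_mul (by omega) h7
  have h9 : W ≤ (500 * δ + 2 * M) * S.card + 2 * links Adj (S \ U) S := by omega
  have h10 : 2 * (1000 * δ + 2 * M) * W ≤
      2 * (1000 * δ + 2 * M) * ((500 * δ + 2 * M) * S.card) + 1000 * δ * W := by
    nlinarith
  have h11 : (1000 * δ + 4 * M) * W ≤ (1000 * δ + 4 * M) * ((1000 * δ + 2 * M) * S.card) := by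
    nlinarith
  exact absurd (Nat.le_of_mul_le_mul_left h11 (by omega)) (not_le.2 hheavy)

theorem IsCritical.dvd_of_vanish (hG : IsRayGraph Adj) (hc : IsCritical Adj L M F S)
    {H : MvPolynomial (Fin 3) K} (hH : H.totalDegree ≤ 4 * F.totalDegree)
    (hv : ∀ l ∈ S, restrict l H = 0) : F ∣ H := by
  by_contra hdvd
  have h1 := card_common_rays_le (hc.prime hG) hdvd S fun l hl => ⟨hc.vanish l hl, hv l hl⟩
  have h2 := hc.four_mul_sq_lt_card hG
  have h3 : F.totalDegree * H.totalDegree ≤ F.totalDegree * (4 * F.totalDegree) :=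
    Nat.mul_le_mul_left _ hH
  nlinarith

theorem IsCritical.dvd_of_vanish_at_meets (hG : IsRayGraph Adj) (hc : IsCritical Adj L M F S)
    {H : MvPolynomial (Fin 3) K} (hH : H.totalDegree ≤ 4 * F.totalDegree)
    (hv : ∀ i ∈ S, ∀ j ∈ S, Adj i j → ∀ t, rayPt i t = rayPt j t → eval (rayPt i t) H = 0) :
    F ∣ H := by
  refine hc.dvd_of_vanish hG hH fun i hi => ?_
  refine hG.restrict_eq_zero (nbrs Adj S i) (fun j hj => (mem_nbrs.1 hj).2) ?_
    fun j hj => hv i hi j (mem_nbrs.1 hj).1 (mem_nbrs.1 hj).2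
  have := hc.lt_two_mul_card_nbrs hG hi
  omega

theorem eval_dirDeriv_eq_zero {l : K × K × K} (h : restrict l F = 0) (t : K) :
    eval (rayPt l t) (dirDeriv l.1 F) = 0 := by
  rw [← eval_restrict, ← derivative_restrict, h]
  simp

theorem eval_dirDeriv (x : Fin 3 → K) (θ : K) : eval x (dirDeriv θ F) =
    eval x (pderiv 0 F) + θ * eval x (pderiv 1 F) + θ ^ 2 * eval x (pderiv 2 F) := by
  simp [dirDeriv]

theorem eq_zero_of_dvd_of_totalDegree_lt {H : MvPolynomial (Fin 3) K}
    (hH : H.totalDegree < F.totalDegree) (hdvd : F ∣ H) : H = 0 := by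
  by_contra hne
  exact absurd (totalDegree_le_of_dvd_of_isDomain hdvd hne) (not_le.2 hH)

theorem IsCritical.totalDegree_pderiv_lt (hc : IsCritical Adj L M F S) (i : Fin 3) :
    (pderiv i F).totalDegree < F.totalDegree := by
  have h1 := totalDegree_pderiv_le i F
  have h2 := hc.totalDegree_pos
  omega

theorem IsCritical.pderiv_two_ne_zero (hG : IsRayGraph Adj) (hc : IsCritical Adj L M F S) {d : ℕ}
    (hd : ∀ k : ℕ, 0 < k → k ≤ d → (k : K) ≠ 0) (hF : F.totalDegree ≤ d) : pderiv 2 F ≠ 0 := by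
  intro h2
  have key : ∀ i ∈ S, ∀ j ∈ S, Adj i j → ∀ t, rayPt i t = rayPt j t →
      eval (rayPt i t) (pderiv 0 F) = 0 ∧ eval (rayPt i t) (pderiv 1 F) = 0 := by
    intro i hi j hj hij t ht
    have e1 := eval_dirDeriv_eq_zero (hc.vanish i hi) t
    have e2 := eval_dirDeriv_eq_zero (hc.vanish j hj) t
    rw [← ht] at e2
    rw [eval_dirDeriv, h2, map_zero, mul_zero, add_zero] at e1 e2
    have h1 : (i.1 - j.1) * eval (rayPt i t) (pderiv 1 F) = 0 := by linear_combination e1 - e2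
    have h1 := (mul_eq_zero.1 h1).resolve_left (sub_ne_zero.2 (hG.dir i j hij))
    rw [h1, mul_zero, add_zero] at e1
    exact ⟨e1, h1⟩
  have hz : ∀ i, pderiv i F = 0 := by
    intro i
    have hlt := hc.totalDegree_pderiv_lt i
    refine eq_zero_of_dvd_of_totalDegree_lt hlt ?_
    fin_cases i
    · exact hc.dvd_of_vanish_at_meets hG (by simp only [Fin.zero_eta] at hlt ⊢; omega)
        fun i hi j hj hij t ht => (key i hi j hj hij t ht).1
    · exact hc.dvd_of_vanish_at_meets hG (by simp only [Fin.mk_one] at hlt ⊢; omega)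
        fun i hi j hj hij t ht => (key i hi j hj hij t ht).2
    · exact h2 ▸ dvd_zero F
  have := eq_C_of_pderiv_eq_zero hd hF hz
  have := hc.totalDegree_pos
  omega

theorem IsCritical.dvd_flexRem (hG : IsRayGraph Adj) (hc : IsCritical Adj L M F S) :
    F ∣ flexRem F 0 ∧ F ∣ flexRem F 1 := by
  have key : ∀ i ∈ S, ∀ j ∈ S, Adj i j → ∀ t, rayPt i t = rayPt j t →
      eval (rayPt i t) (flexRem F 0) = 0 ∧ eval (rayPt i t) (flexRem F 1) = 0 := by
    intro i hi j hj hij t ht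
    have aux : ∀ l ∈ S, eval (rayPt l t) (flexRem F 0) +
        l.1 * eval (rayPt l t) (flexRem F 1) = 0 := by
      intro l hl
      obtain ⟨q, hq⟩ := exists_flexRem_eq F l.1
      have hq := congr_arg (eval (rayPt l t)) hq
      have h1 : restrict l (dirDeriv l.1 F) = 0 := by
        rw [← derivative_restrict, hc.vanish l hl, map_zero]
      rw [map_mul, eval_dirDeriv_eq_zero h1, map_add, map_mul,
        eval_dirDeriv_eq_zero (hc.vanish l hl), map_add, map_mul, eval_C] at hq
      linear_combination -hq
    have e1 := aux i hi
    have e2 := aux j hj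
    rw [← ht] at e2
    have h1 : (i.1 - j.1) * eval (rayPt i t) (flexRem F 1) = 0 := by linear_combination e1 - e2
    have h1 := (mul_eq_zero.1 h1).resolve_left (sub_ne_zero.2 (hG.dir i j hij))
    rw [h1, mul_zero, add_zero] at e1
    exact ⟨e1, h1⟩
  exact ⟨hc.dvd_of_vanish_at_meets hG (totalDegree_flexRem_le F 0)
      fun i hi j hj hij t ht => (key i hi j hj hij t ht).1,
    hc.dvd_of_vanish_at_meets hG (totalDegree_flexRem_le F 1)
      fun i hi j hj hij t ht => (key i hi j hj hij t ht).2⟩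

end RayGraph

section RayGraph

open MvPolynomial

variable {K : Type*} [Field K] {Adj : K × K × K → K × K × K → Prop}
  {L S : Finset (K × K × K)} {M : ℕ} {F : MvPolynomial (Fin 3) K}

theorem rayNum_eq_of_meetForm {ρ l : K × K × K} (h : meetForm ρ l = 0) (t : K) :
    eval (rayPt ρ t) (rayNum l) = ρ.1 * eval (rayPt ρ t) (rayDen l) := by
  rw [← rayThrough_rayPt ρ t, meetForm_rayThrough, sub_eq_zero] at h
  exact h

theorem restrict_tangentForm [Infinite K] {ρ l : K × K × K} (h : meetForm ρ l = 0)
    (hF : restrict ρ F = 0) : restrict ρ (tangentForm F l) = 0 := by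
  refine Polynomial.funext fun t => ?_
  have h1 := eval_dirDeriv_eq_zero hF t
  rw [eval_dirDeriv] at h1
  rw [eval_restrict, Polynomial.eval_zero, tangentForm]
  simp only [map_add, map_mul, map_pow, rayNum_eq_of_meetForm h]
  linear_combination (eval (rayPt ρ t) (rayDen l)) ^ 2 * h1

theorem exists_eval_ne_zero [Infinite K] {l : K × K × K} {H : MvPolynomial (Fin 3) K}
    (h : restrict l H ≠ 0) : ∃ t, eval (rayPt l t) H ≠ 0 := by
  by_contra! hcon
  exact h (Polynomial.funext fun t => by rw [eval_restrict, hcon, Polynomial.eval_zero])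

/-- The second direction in which the surface `F = 0` is ruled at the point `x` of the ray `l`. -/
noncomputable def otherDir (F : MvPolynomial (Fin 3) K) (l : K × K × K) (x : Fin 3 → K) : K :=
  -(eval x (pderiv 1 F) / eval x (pderiv 2 F)) - l.1

theorem meetForm_rayThrough_rayPt (l : K × K × K) (t θ : K) :
    meetForm (rayThrough (rayPt l t) θ) l = 0 := by
  rw [meetForm_rayThrough, eval_rayNum_rayPt, eval_rayDen_rayPt]
  ring

theorem IsCritical.restrict_otherDir (hG : IsRayGraph Adj) (hc : IsCritical Adj L M F S) {d : ℕ}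
    (hd : ∀ k : ℕ, 0 < k → k ≤ d → (k : K) ≠ 0) (hF : F.totalDegree ≤ d) {j : K × K × K}
    (hj : j ∈ S) {t : K} (ht : eval (rayPt j t) (pderiv 2 F) ≠ 0) :
    restrict (rayThrough (rayPt j t) (otherDir F j (rayPt j t))) F = 0 := by
  obtain ⟨h0, h1⟩ := hc.dvd_flexRem hG
  have hv : eval (rayPt j t) F = 0 := by
    rw [← eval_restrict, hc.vanish j hj, Polynomial.eval_zero]
  have hv1 := eval_dirDeriv_eq_zero (hc.vanish j hj) t
  refine restrict_eq_zero_of_tangent hd hF h0 h1 _ (rayPt j t 0) ?_ ?_ ?_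
  · rwa [rayPt_rayThrough]
  · rw [rayPt_rayThrough, eval_dirDeriv]
    rw [eval_dirDeriv] at hv1
    simp only [rayThrough, otherDir]
    field_simp
    linear_combination (eval (rayPt j t) (pderiv 2 F)) * hv1
  · rwa [rayPt_rayThrough]

theorem IsCritical.dvd_tangentForm [Infinite K] (hG : IsRayGraph Adj)
    (hc : IsCritical Adj L M F S) {d : ℕ} (hd : ∀ k : ℕ, 0 < k → k ≤ d → (k : K) ≠ 0)
    (hF : F.totalDegree ≤ d) {j : K × K × K} (hj : j ∈ S) (hj3 : restrict j (pderiv 2 F) ≠ 0) :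
    F ∣ tangentForm F j := by
  classical
  by_contra hdvd
  have hdeg := hc.lt_two_mul_card_nbrs hG hj
  have hlt := hc.totalDegree_pderiv_lt 2
  set H : MvPolynomial (Fin 3) K := pderiv 2 F * (pderiv 1 F + C (2 * j.1) * pderiv 2 F) with hH
  have hHne : restrict j H ≠ 0 := by
    rw [hH, map_mul]
    refine mul_ne_zero hj3 fun h0 => hj3 ?_
    refine hG.restrict_eq_zero (nbrs Adj S j) (fun k hk => (mem_nbrs.1 hk).2) (by omega)
      fun k hk t ht => ?_
    have e0 : eval (rayPt j t) (pderiv 1 F + C (2 * j.1) * pderiv 2 F) = 0 := by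
      rw [← eval_restrict, h0, Polynomial.eval_zero]
    have e1 := eval_dirDeriv_eq_zero (hc.vanish j hj) t
    have e2 := eval_dirDeriv_eq_zero (hc.vanish k (mem_nbrs.1 hk).1) t
    rw [← ht] at e2
    rw [eval_dirDeriv] at e1 e2
    simp only [map_add, map_mul, eval_C] at e0
    have hne := sub_ne_zero.2 (hG.dir j k (mem_nbrs.1 hk).2)
    have e3 : (j.1 - k.1) ^ 2 * eval (rayPt j t) (pderiv 2 F) = 0 := by
      linear_combination (j.1 - k.1) * e0 - e1 + e2
    exact (mul_eq_zero.1 e3).resolve_left (pow_ne_zero 2 hne)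
  have hinf : {t | ¬(restrict j H).IsRoot t}.Infinite :=
    Set.Finite.infinite_compl (Polynomial.finite_setOfPred_isRoot hHne)
  obtain ⟨T, hT, hTcard⟩ := hinf.exists_subset_card_eq (F.totalDegree * (F.totalDegree + 2) + 1)
  have hTH : ∀ t ∈ T, eval (rayPt j t) (pderiv 2 F) ≠ 0 ∧
      eval (rayPt j t) (pderiv 1 F) + 2 * j.1 * eval (rayPt j t) (pderiv 2 F) ≠ 0 := by
    intro t ht
    have h := hT ht
    rw [Set.mem_ofPred_eq, Polynomial.IsRoot.def, eval_restrict, hH, map_mul, map_add, map_mul,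
      eval_C] at h
    exact mul_ne_zero_iff.1 h
  set ρ : K → K × K × K := fun t => rayThrough (rayPt j t) (otherDir F j (rayPt j t)) with hρ
  have hinj : Set.InjOn ρ T := by
    intro s hs t ht hst
    have hden : eval (rayPt j s) (rayDen (ρ s)) = eval (rayPt j t) (rayDen (ρ s)) := by
      rw [show rayDen (ρ s) = rayDen (ρ t) by rw [hst]]
      conv_rhs => rw [← rayPt_rayThrough (rayPt j t) (otherDir F j (rayPt j t))]
      rw [eval_rayDen_rayPt, ← hst]
      conv_lhs => rw [← rayPt_rayThrough (rayPt j s) (otherDir F j (rayPt j s))]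
      rw [eval_rayDen_rayPt]
    have hne : j.1 ≠ (ρ s).1 := by
      intro h
      simp only [hρ, rayThrough, otherDir] at h
      obtain ⟨h3, h4⟩ := hTH s hs
      refine h4 ?_
      field_simp at h
      linear_combination h
    have : (j.1 - (ρ s).1) * (s - t) = 0 := by
      simp [rayDen, rayPt] at hden
      linear_combination hden
    exact sub_eq_zero.1 ((mul_eq_zero.1 this).resolve_left (sub_ne_zero.2 hne))
  have h1 := card_common_rays_le (hc.prime hG) hdvd (T.image ρ) fun l hl => by
    obtain ⟨t, ht, rfl⟩ := Finset.mem_image.1 hl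
    have hv := hc.restrict_otherDir hG hd hF hj (hTH t ht).1
    exact ⟨hv, restrict_tangentForm (meetForm_rayThrough_rayPt _ _ _) hv⟩
  rw [Finset.card_image_of_injOn hinj, hTcard] at h1
  have h2 := Nat.mul_le_mul_left F.totalDegree (totalDegree_tangentForm_le F j)
  omega

theorem IsCritical.exists_rich [Infinite K] (hG : IsRayGraph Adj)
    (hc : IsCritical Adj L M F S) {d : ℕ} (hd : ∀ k : ℕ, 0 < k → k ≤ d → (k : K) ≠ 0)
    (hF : F.totalDegree ≤ d) {l : K × K × K} (hl : l ∈ S) (hl3 : restrict l (pderiv 2 F) ≠ 0) :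
    ∃ ρ, ρ ≠ l ∧ ∃ J ⊆ nbrs Adj S l, M < J.card ∧ ∀ j ∈ J, meetForm ρ j = 0 ∧
      restrict j (pderiv 2 F) ≠ 0 := by
  classical
  have hdeg := hc.lt_two_mul_card_nbrs hG hl
  have hlt := hc.totalDegree_pderiv_lt 2
  set N := nbrs Adj S l with hN
  set J := N.filter fun j => ∃ t, rayPt l t = rayPt j t ∧ eval (rayPt j t) (pderiv 2 F) ≠ 0 with hJ
  have hJN : J ⊆ N := Finset.filter_subset _ _
  have hJ3 : ∀ j ∈ J, restrict j (pderiv 2 F) ≠ 0 := by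
    intro j hj h0
    obtain ⟨t, -, h⟩ := (Finset.mem_filter.1 hj).2
    rw [← eval_restrict, h0, Polynomial.eval_zero] at h
    exact h rfl
  have hbad : (N \ J).card ≤ (pderiv 2 F).totalDegree := by
    by_contra! hcon
    refine hl3 (hG.restrict_eq_zero (N \ J)
      (fun j hj => (mem_nbrs.1 (Finset.sdiff_subset hj)).2) hcon fun j hj t ht => ?_)
    by_contra hne
    obtain ⟨h1, h2⟩ := Finset.mem_sdiff.1 hj
    exact h2 (Finset.mem_filter.2 ⟨h1, t, ht, ht ▸ hne⟩)
  have hcard := Finset.card_sdiff_add_card_eq_card hJN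
  have hJM : M < J.card := by omega
  obtain ⟨j₁, hj₁⟩ : J.Nonempty := Finset.card_pos.1 (by omega)
  have hmem : ∀ j ∈ J, j ∈ S ∧ Adj l j := fun j hj => mem_nbrs.1 (hJN hj)
  have hj₁S := (hmem j₁ hj₁).1
  have hden : restrict j₁ (rayDen l) ≠ 0 := by
    intro h0
    have e : ∀ t, eval (rayPt j₁ t) (rayDen l) = 0 := fun t => by
      rw [← eval_restrict, h0, Polynomial.eval_zero]
    have e0 := e 0
    have e1 := e 1
    simp [rayDen, rayPt] at e0 e1
    exact hG.dir l j₁ (hmem j₁ hj₁).2 (by linear_combination e0 - e1)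
  obtain ⟨t, ht⟩ := exists_eval_ne_zero (l := j₁) (H := pderiv 2 F * rayDen l)
    (by rw [map_mul]; exact mul_ne_zero (hJ3 j₁ hj₁) hden)
  rw [map_mul] at ht
  obtain ⟨ht3, htl⟩ := mul_ne_zero_iff.1 ht
  set y := rayPt j₁ t with hy
  have hv1 := eval_dirDeriv_eq_zero (hc.vanish j₁ hj₁S) t
  rw [eval_dirDeriv] at hv1
  refine ⟨rayThrough y (otherDir F j₁ y), ?_, J, hJN, hJM, fun j hj => ⟨?_, hJ3 j hj⟩⟩
  · intro h
    refine htl ?_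
    have := eval_rayDen_rayPt (rayThrough y (otherDir F j₁ y)) (y 0)
    rwa [rayPt_rayThrough, h] at this
  · rcases eq_or_ne j₁ j with rfl | hne
    · exact meetForm_rayThrough_rayPt _ _ _
    have hskew := hG.skew l j₁ j (hmem j₁ hj₁).2 (hmem j hj).2 hne
    have htan : eval y (tangentForm F j) = 0 := by
      obtain ⟨q, hq⟩ := hc.dvd_tangentForm hG hd hF (hmem j hj).1 (hJ3 j hj)
      rw [hq, map_mul, hy, ← eval_restrict, hc.vanish j₁ hj₁S, Polynomial.eval_zero, zero_mul]
    have hm := meetForm_rayThrough y j₁.1 j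
    rw [hy, rayThrough_rayPt, ← hy] at hm
    rw [hm] at hskew
    rw [meetForm_rayThrough]
    simp only [tangentForm, map_add, map_mul, map_pow] at htan
    have key : (eval y (rayNum j) - j₁.1 * eval y (rayDen j)) *
        (eval y (rayNum j) * eval y (pderiv 2 F) + eval y (rayDen j) *
          (eval y (pderiv 1 F) + j₁.1 * eval y (pderiv 2 F))) = 0 := by
      linear_combination htan - eval y (rayDen j) ^ 2 * hv1
    have key := (mul_eq_zero.1 key).resolve_left hskew
    rw [otherDir]
    field_simp
    linear_combination key

theorem links_le_of_not_rich [Infinite K] (hG : IsRayGraph Adj) (L : Finset (K × K × K)) (M : ℕ)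
    {d : ℕ} (hd : ∀ k : ℕ, 0 < k → k ≤ d → (k : K) ≠ 0) (hL : 6 * L.card < (d + 2) * (d + 3))
    {blue : K × K × K → Prop} (hblue : ∀ i j, Adj i j → blue i ∨ blue j)
    (hM : ∀ l ∈ L, blue l → ∀ ρ ≠ l, ∀ J ⊆ nbrs Adj L l, (∀ j ∈ J, meetForm ρ j = 0) →
      J.card ≤ M) :
    links Adj L L ≤ (1000 * d + 2 * M) * L.card := by
  classical
  obtain ⟨F₀, hF₀, hdeg, hv⟩ := exists_vanishing L d hL
  by_contra! hlt
  obtain ⟨F, S, hc, hFF⟩ := exists_isCritical (Adj := Adj) L M hF₀ hv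
    (lt_of_le_of_lt (Nat.mul_le_mul_right _ (by omega)) hlt)
  have hF : F.totalDegree ≤ d := hFF.trans hdeg
  obtain ⟨l, hl, hl3⟩ : ∃ l ∈ S, restrict l (pderiv 2 F) ≠ 0 := by
    by_contra! hcon
    have hlt := hc.totalDegree_pderiv_lt 2
    exact hc.pderiv_two_ne_zero hG hd hF (eq_zero_of_dvd_of_totalDegree_lt hlt
      (hc.dvd_of_vanish hG (by omega) hcon))
  obtain ⟨l, hl, hb, hl3⟩ : ∃ l ∈ S, blue l ∧ restrict l (pderiv 2 F) ≠ 0 := by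
    by_cases hb : blue l
    · exact ⟨l, hl, hb, hl3⟩
    obtain ⟨ρ, -, J, hJ, hJM, h⟩ := hc.exists_rich hG hd hF hl hl3
    obtain ⟨j, hj⟩ : J.Nonempty := Finset.card_pos.1 (by omega)
    obtain ⟨hjS, hlj⟩ := mem_nbrs.1 (hJ hj)
    exact ⟨j, hjS, (hblue l j hlj).resolve_left hb, (h j hj).2⟩
  obtain ⟨ρ, hρ, J, hJ, hJM, h⟩ := hc.exists_rich hG hd hF hl hl3
  refine absurd (hM l (hc.subset hl) hb ρ hρ J (fun j hj => ?_) fun j hj => (h j hj).1)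
    (not_le.2 hJM)
  exact mem_nbrs.2 ⟨hc.subset (mem_nbrs.1 (hJ hj)).1, (mem_nbrs.1 (hJ hj)).2⟩

end RayGraph

section Incidence

variable {K : Type*} [Field K]

theorem exists_linear_ne_zero [Infinite K] (T : Finset (K × K)) (hT : ∀ c ∈ T, c ≠ 0) :
    ∃ a : K, ∀ c ∈ T, c.1 + a * c.2 ≠ 0 := by
  have hne : ∏ c ∈ T, (Polynomial.C c.1 + Polynomial.X * Polynomial.C c.2) ≠ 0 := by
    refine Finset.prod_ne_zero_iff.2 fun c hc h0 => hT c hc ?_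
    have h1 := congr_arg (Polynomial.coeff · 0) h0
    have h2 := congr_arg (Polynomial.coeff · 1) h0
    simp [Polynomial.coeff_C] at h1 h2
    exact Prod.ext h1 h2
  obtain ⟨a, ha⟩ : ∃ a, (∏ c ∈ T, (Polynomial.C c.1 + Polynomial.X * Polynomial.C c.2)).eval a
      ≠ 0 := by
    by_contra! hcon
    exact hne (Polynomial.funext fun a => by rw [hcon, Polynomial.eval_zero])
  refine ⟨a, fun c hc => ?_⟩
  rw [Polynomial.eval_prod] at ha
  simpa [mul_comm a] using Finset.prod_ne_zero_iff.1 ha c hc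

theorem exists_bilinear_ne_zero [Infinite K] (T : Finset (K × K × K)) (hT : ∀ c ∈ T, c ≠ 0) :
    ∃ a e : K, ∀ c ∈ T, c.1 + a * c.2.1 + e * c.2.2 ≠ 0 := by
  classical
  obtain ⟨a, ha⟩ := exists_linear_ne_zero ((T.image fun c => (c.1, c.2.1)).erase 0)
    fun c hc => Finset.ne_of_mem_erase hc
  obtain ⟨e, he⟩ := exists_linear_ne_zero (T.image fun c => (c.1 + a * c.2.1, c.2.2)) (by
    intro d hd h0
    obtain ⟨c, hc, rfl⟩ := Finset.mem_image.1 hd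
    simp only [Prod.mk_eq_zero] at h0
    by_cases h : ((c.1, c.2.1) : K × K) = 0
    · simp only [Prod.mk_eq_zero] at h
      exact hT c hc (Prod.ext h.1 (Prod.ext h.2 h0.2))
    · exact ha _ (Finset.mem_erase.2 ⟨h, Finset.mem_image_of_mem _ hc⟩) h0.1)
  exact ⟨a, e, fun c hc => he _ (Finset.mem_image_of_mem _ hc)⟩

/-- The point `P = (X, Y, Z)` lies on the plane `A X + B Y + Z + D = 0` given by
`π = (A, B, D)`. -/
def Incident (P π : K × K × K) : Prop := π.1 * P.1 + π.2.1 * P.2.1 + P.2.2 + π.2.2 = 0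

/-- The ray attached to a point. -/
def pointRay (a e : K) (P : K × K × K) : K × K × K := (P.1 + a, P.2.1 + e, P.2.2)

/-- The ray attached to a plane. -/
def planeRay (a e : K) (π : K × K × K) : K × K × K :=
  (-π.2.1, π.1, -π.2.2 + e * π.2.1 + a * π.1)

theorem pointRay_injective (a e : K) : Function.Injective (pointRay a e) := by
  rintro ⟨X, Y, Z⟩ ⟨X', Y', Z'⟩ h
  simpa [pointRay] using h

theorem planeRay_injective (a e : K) : Function.Injective (planeRay a e) := by
  rintro ⟨A, B, D⟩ ⟨A', B', D'⟩ h
  simp only [planeRay, Prod.mk.injEq, neg_inj] at h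
  obtain ⟨rfl, rfl, h⟩ := h
  simpa using h

theorem planeRay_surjective (a e : K) : Function.Surjective (planeRay a e) := by
  rintro ⟨θ, β, w⟩
  refine ⟨(β, -θ, -w + e * -θ + a * β), ?_⟩
  simp only [planeRay, neg_neg, Prod.mk.injEq, true_and]
  ring

theorem meetForm_planeRay_pointRay (a e : K) (π P : K × K × K) :
    meetForm (planeRay a e π) (pointRay a e P) =
      -(π.1 * P.1 + π.2.1 * P.2.1 + P.2.2 + π.2.2) := by
  simp only [meetForm, planeRay, pointRay]
  ring

theorem links_le_of_incident [Infinite K] {ι κ : Type*} (s : Finset ι) (t : Finset κ)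
    (f : ι → K × K × K) (g : κ → K × K × K) (hf : Set.InjOn f s)
    (hg : Set.InjOn g t) (R : ι → κ → Prop)
    (hR : ∀ i ∈ s, ∀ j ∈ t, R i j → Incident (f i) (g j)) (M : ℕ)
    (hM : ∀ j ∈ t, ∀ π ≠ g j, ∀ J ⊆ s, (∀ i ∈ J, R i j ∧ Incident (f i) π) → J.card ≤ M)
    {d : ℕ} (hd : ∀ k : ℕ, 0 < k → k ≤ d → (k : K) ≠ 0)
    (hcard : 6 * (s.card + t.card) < (d + 2) * (d + 3)) :
    links R s t ≤ (1000 * d + 2 * M) * (s.card + t.card) := by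
  classical
  obtain ⟨a, e, hae⟩ := exists_bilinear_ne_zero
    (((s ×ˢ s).image fun x => ((f x.1).2.2 - (f x.2).2.2 + (f x.1).1 * (f x.2).2.1 -
        (f x.2).1 * (f x.1).2.1, (f x.2).2.1 - (f x.1).2.1, (f x.1).1 - (f x.2).1)).erase 0 ∪
      ((t ×ˢ t).image fun x => ((g x.2).2.2 - (g x.1).2.2 + (g x.2).2.1 * (g x.1).1 -
        (g x.1).2.1 * (g x.2).1, (g x.1).1 - (g x.2).1, (g x.1).2.1 - (g x.2).2.1)).erase 0 ∪
      (s ×ˢ t).image fun x => ((f x.1).1 + (g x.2).2.1, 1, 0)) (by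
    intro c hc
    simp only [Finset.mem_union, or_assoc] at hc
    rcases hc with hc | hc | hc
    · exact Finset.ne_of_mem_erase hc
    · exact Finset.ne_of_mem_erase hc
    · obtain ⟨x, -, rfl⟩ := Finset.mem_image.1 hc
      simp)
  have hpp : ∀ i ∈ s, ∀ i' ∈ s, f i ≠ f i' →
      meetForm (pointRay a e (f i)) (pointRay a e (f i')) ≠ 0 := by
    intro i hi i' hi' hne h0
    refine hae _ (Finset.mem_union_left _ (Finset.mem_union_left _ (Finset.mem_erase.2
      ⟨?_, Finset.mem_image_of_mem _ (Finset.mk_mem_product hi hi')⟩))) ?_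
    · intro h
      simp only [Prod.mk_eq_zero] at h
      obtain ⟨h1, h2, h3⟩ := h
      have h2 := sub_eq_zero.1 h2
      have h3 := sub_eq_zero.1 h3
      rw [h2, h3] at h1
      exact hne (Prod.ext h3 (Prod.ext h2.symm (by linear_combination h1)))
    · simp only [meetForm, pointRay] at h0
      linear_combination h0
  have hll : ∀ j ∈ t, ∀ j' ∈ t, g j ≠ g j' →
      meetForm (planeRay a e (g j)) (planeRay a e (g j')) ≠ 0 := by
    intro i hi i' hi' hne h0
    refine hae _ (Finset.mem_union_left _ (Finset.mem_union_right _ (Finset.mem_erase.2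
      ⟨?_, Finset.mem_image_of_mem _ (Finset.mk_mem_product hi hi')⟩))) ?_
    · intro h
      simp only [Prod.mk_eq_zero] at h
      obtain ⟨h1, h2, h3⟩ := h
      have h2 := sub_eq_zero.1 h2
      have h3 := sub_eq_zero.1 h3
      rw [h2, h3] at h1
      exact hne (Prod.ext h2 (Prod.ext h3 (by linear_combination -h1)))
    · simp only [meetForm, planeRay] at h0
      linear_combination h0
  have hpl : ∀ i ∈ s, ∀ j ∈ t, (pointRay a e (f i)).1 ≠ (planeRay a e (g j)).1 := by
    intro i hi j hj h0
    refine hae _ (Finset.mem_union_right _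
      (Finset.mem_image_of_mem _ (Finset.mk_mem_product hi hj))) ?_
    simp only [pointRay, planeRay] at h0
    linear_combination h0
  set red : ι → K × K × K := fun i => pointRay a e (f i) with hred
  set blu : κ → K × K × K := fun j => planeRay a e (g j) with hblu
  have hredinj : Set.InjOn red s := fun i hi i' hi' h => hf hi hi' (pointRay_injective a e h)
  have hbluinj : Set.InjOn blu t := fun i hi i' hi' h => hg hi hi' (planeRay_injective a e h)
  let E : K × K × K → K × K × K → Prop :=
    fun l l' => ∃ i ∈ s, ∃ j ∈ t, R i j ∧ l = red i ∧ l' = blu j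
  let Adj : K × K × K → K × K × K → Prop := fun l l' => E l l' ∨ E l' l
  have hmeet : ∀ i ∈ s, ∀ j ∈ t, R i j → meetForm (blu j) (red i) = 0 := by
    intro i hi j hj h
    rw [hblu, hred, meetForm_planeRay_pointRay, hR i hi j hj h, neg_zero]
  have hG : IsRayGraph Adj := by
    refine ⟨fun _ _ => Or.symm, ?_, ?_, ?_⟩
    · rintro _ _ (⟨i, hi, j, hj, -, rfl, rfl⟩ | ⟨i, hi, j, hj, -, rfl, rfl⟩)
      · exact hpl i hi j hj
      · exact (hpl i hi j hj).symm
    · rintro _ _ (⟨i, hi, j, hj, h, rfl, rfl⟩ | ⟨i, hi, j, hj, h, rfl, rfl⟩)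
      · rw [meetForm_swap, hmeet i hi j hj h, neg_zero]
      · exact hmeet i hi j hj h
    · rintro l _ _ (⟨i, hi, j, hj, -, hl, rfl⟩ | ⟨i, hi, j, hj, -, rfl, hl⟩)
        (⟨i', hi', j', hj', -, hl', rfl⟩ | ⟨i', hi', j', hj', -, rfl, hl'⟩) hne
      · exact hll j hj j' hj' fun h => hne (congr_arg (planeRay a e) h)
      · exact absurd (congr_arg Prod.fst (hl.symm.trans hl')) (hpl i hi j' hj')
      · exact absurd (congr_arg Prod.fst (hl'.symm.trans hl)) (hpl i' hi' j hj)
      · exact hpp i hi i' hi' fun h => hne (congr_arg (pointRay a e) h)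
  set L := s.image red ∪ t.image blu with hL
  have hLcard : L.card ≤ s.card + t.card := (Finset.card_union_le _ _).trans
    (add_le_add Finset.card_image_le Finset.card_image_le)
  have hmain := links_le_of_not_rich hG L M hd (by omega) (blue := fun l => l ∈ t.image blu) (by
      rintro _ _ (⟨i, hi, j, hj, h, rfl, rfl⟩ | ⟨i, hi, j, hj, h, rfl, rfl⟩)
      · exact Or.inr (Finset.mem_image_of_mem _ hj)
      · exact Or.inl (Finset.mem_image_of_mem _ hj)) (by
      intro l _ hl ρ hρ J hJ hmJ
      obtain ⟨j, hj, rfl⟩ := Finset.mem_image.1 hl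
      obtain ⟨π, rfl⟩ := planeRay_surjective a e ρ
      have hsub : J ⊆ ((nbrs (fun j i => R i j) s j).filter fun i => red i ∈ J).image red := by
        intro l hl
        rcases (mem_nbrs.1 (hJ hl)).2 with
          ⟨i, hi, j', hj', -, h, rfl⟩ | ⟨i, hi, j', hj', h1, rfl, h2⟩
        · exact absurd (congr_arg Prod.fst h).symm (hpl i hi j hj)
        · refine Finset.mem_image_of_mem _ (Finset.mem_filter.2 ⟨mem_nbrs.2 ⟨hi, ?_⟩, hl⟩)
          rwa [hbluinj hj hj' h2]
      refine (Finset.card_le_card hsub).trans (Finset.card_image_le.trans ?_)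
      refine hM j hj π (fun h => hρ (congr_arg _ h)) _ (fun i hi => ?_) fun i hi => ?_
      · exact (mem_nbrs.1 (Finset.mem_filter.1 hi).1).1
      · obtain ⟨h1, h2⟩ := Finset.mem_filter.1 hi
        refine ⟨(mem_nbrs.1 h1).2, ?_⟩
        have := hmJ _ h2
        rw [hred, meetForm_planeRay_pointRay, neg_eq_zero] at this
        exact this)
  refine le_trans ?_ (hmain.trans (Nat.mul_le_mul_left _ hLcard))
  calc links R s t ≤ ∑ i ∈ s, (nbrs Adj L (red i)).card := by
        refine Finset.sum_le_sum fun i hi => ?_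
        rw [← Finset.card_image_of_injOn (hbluinj.mono fun j hj => (mem_nbrs.1 hj).1)]
        refine Finset.card_le_card fun l hl => ?_
        obtain ⟨j, hj, rfl⟩ := Finset.mem_image.1 hl
        obtain ⟨hj, h⟩ := mem_nbrs.1 hj
        exact mem_nbrs.2 ⟨Finset.mem_union_right _ (Finset.mem_image_of_mem _ hj),
          Or.inl ⟨i, hi, j, hj, h, rfl, rfl⟩⟩
    _ = ∑ l ∈ s.image red, (nbrs Adj L l).card := by
        rw [Finset.sum_image hredinj]
    _ ≤ links Adj L L := Finset.sum_le_sum_of_subset Finset.subset_union_left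

end Incidence

section Chunks

theorem le_mul_of_chunks {α : Type*} [DecidableEq α] (g : Finset α → ℝ) (h0 : g ∅ ≤ 0)
    (hadd : ∀ s t, Disjoint s t → g (s ∪ t) ≤ g s + g t) {c : ℝ} (hc0 : 0 ≤ c) {q : ℕ}
    (s₀ : Finset α)
    (hc : ∀ s ⊆ s₀, s.card ≤ q → g s ≤ c) (m : ℕ) {s : Finset α} (hs : s ⊆ s₀)
    (hcard : s.card ≤ m * q) : g s ≤ m * c := by
  induction m generalizing s with
  | zero =>
    rw [zero_mul, Nat.le_zero, Finset.card_eq_zero] at hcard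
    subst hcard
    simpa using h0
  | succ m ih =>
    rw [Nat.cast_succ, add_one_mul]
    rw [Nat.succ_mul] at hcard
    rcases le_total s.card q with hq | hq
    · have := hc s hs hq
      have := mul_nonneg (Nat.cast_nonneg (α := ℝ) m) hc0
      linarith
    · obtain ⟨u, hu, hucard⟩ := Finset.exists_subset_card_eq hq
      have h1 := ih (s := s \ u) (Finset.sdiff_subset.trans hs) (by
        rw [Finset.card_sdiff_of_subset hu]; omega)
      have h2 := hadd (s \ u) u Finset.sdiff_disjoint
      rw [Finset.sdiff_union_of_subset hu] at h2
      have h3 := hc u (hu.trans hs) hucard.le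
      linarith

theorem links_union_right {α β : Type*} [DecidableEq β] {R : α → β → Prop} (s : Finset α)
    (t t' : Finset β) : links R s (t ∪ t') ≤ links R s t + links R s t' := by
  classical
  rw [links, links, links, ← Finset.sum_add_distrib]
  refine Finset.sum_le_sum fun i _ => ?_
  rw [nbrs, Finset.filter_union]
  exact Finset.card_union_le _ _

variable {K : Type*} [Field K]

theorem links_le_of_incident_of_card_lt [Infinite K] {ι κ : Type*} {s : Finset ι} {t : Finset κ}
    {f : ι → K × K × K} {g : κ → K × K × K} (hf : Set.InjOn f s) (hg : Set.InjOn g t)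
    {R : ι → κ → Prop} (hR : ∀ i ∈ s, ∀ j ∈ t, R i j → Incident (f i) (g j)) {M : ℕ}
    (hM : ∀ j ∈ t, ∀ π ≠ g j, ∀ J ⊆ s, (∀ i ∈ J, R i j ∧ Incident (f i) π) → J.card ≤ M)
    {p : ℕ} (hp : ∀ k : ℕ, 0 < k → k < p → (k : K) ≠ 0)
    {n : ℕ} (hn : 12 * n < p ^ 2) (hs : s.card ≤ n) (ht : t.card ≤ n) :
    (links R s t : ℝ) ≤ 8000 * (n * √n) + 4 * M * n := by
  set d := Nat.sqrt (12 * n) with hd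
  have h1 : d * d ≤ 12 * n := Nat.sqrt_le _
  have h2 : 12 * n < (d + 1) * (d + 1) := Nat.lt_succ_sqrt _
  have hdp : d < p := by nlinarith
  have h3 := links_le_of_incident s t f g hf hg R hR M hM (d := d)
    (fun k hk hkd => hp k hk (by omega)) (by nlinarith)
  have h4 : links R s t ≤ (1000 * d + 2 * M) * (2 * n) :=
    h3.trans (Nat.mul_le_mul_left _ (by omega))
  have h5 : (d : ℝ) ≤ 4 * √n := by
    rw [show (4 : ℝ) * √n = √(16 * n) by
      rw [Real.sqrt_mul (by norm_num), show (16 : ℝ) = 4 ^ 2 by norm_num,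
        Real.sqrt_sq (by norm_num)]]
    refine Real.le_sqrt_of_sq_le ?_
    have : (d * d : ℝ) ≤ 12 * n := by exact_mod_cast h1
    nlinarith [(Nat.cast_nonneg n : (0 : ℝ) ≤ n)]
  have h6 : (links R s t : ℝ) ≤ (1000 * d + 2 * M) * (2 * n) := by exact_mod_cast h4
  have h7 : (0 : ℝ) ≤ n := Nat.cast_nonneg n
  nlinarith

theorem links_le_of_incident_of_card_le [Infinite K] {ι κ : Type*} {s : Finset ι} {t : Finset κ}
    {f : ι → K × K × K} {g : κ → K × K × K} (hf : Set.InjOn f s) (hg : Set.InjOn g t)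
    {R : ι → κ → Prop} (hR : ∀ i ∈ s, ∀ j ∈ t, R i j → Incident (f i) (g j)) {M : ℕ}
    (hM : ∀ j ∈ t, ∀ π ≠ g j, ∀ J ⊆ s, (∀ i ∈ J, R i j ∧ Incident (f i) π) → J.card ≤ M)
    {p : ℕ} (hp5 : 5 ≤ p) (hp : ∀ k : ℕ, 0 < k → k < p → (k : K) ≠ 0)
    {n : ℕ} (hs : s.card ≤ n) (ht : t.card ≤ n) :
    (links R s t : ℝ) ≤
      160000 * (n * √n + M * n + (n : ℝ) ^ 2 / p + M * ((n : ℝ) ^ 2 / p ^ 2)) := by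
  classical
  have hn0 : (0 : ℝ) ≤ n := Nat.cast_nonneg n
  have hM0 : (0 : ℝ) ≤ M := Nat.cast_nonneg M
  have hpR : (0 : ℝ) < p := by exact_mod_cast (by omega : 0 < p)
  have hMn := mul_nonneg hM0 hn0
  have hnn := mul_nonneg hn0 (Real.sqrt_nonneg n)
  have hnp : 0 ≤ (n : ℝ) ^ 2 / p := by positivity
  have hnp2 : 0 ≤ M * ((n : ℝ) ^ 2 / p ^ 2) := by positivity
  set q := (p ^ 2 - 1) / 12 with hq
  have hp2 : 25 ≤ p ^ 2 := by nlinarith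
  have hq1 : 12 * q < p ^ 2 := by omega
  have hq2 : p ^ 2 ≤ 24 * q := by omega
  rcases le_or_gt n q with hnq | hnq
  · have := links_le_of_incident_of_card_lt hf hg hR hM hp (n := n) (by omega) hs ht
    nlinarith
  set c : ℝ := 8000 * (q * √q) + 4 * M * q with hc
  set m := n / q + 1 with hm
  have hnm : n ≤ m * q := by
    have := Nat.div_add_mod n q
    have := Nat.mod_lt n (by omega : 0 < q)
    nlinarith
  have hcc : 0 ≤ c := by positivity
  have hbase : ∀ s' ⊆ s, s'.card ≤ q → ∀ t' ⊆ t, t'.card ≤ q → (links R s' t' : ℝ) ≤ c := by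
    intro s' hs' hs'q t' ht' ht'q
    exact links_le_of_incident_of_card_lt (hf.mono hs') (hg.mono ht')
      (fun i hi j hj => hR i (hs' hi) j (ht' hj))
      (fun j hj π hπ J hJ => hM j (ht' hj) π hπ J (hJ.trans hs')) hp hq1 hs'q ht'q
  have hone : ∀ s' ⊆ s, s'.card ≤ q → (links R s' t : ℝ) ≤ m * c := by
    intro s' hs' hs'q
    refine le_mul_of_chunks (fun t' => (links R s' t' : ℝ)) ?_ ?_ hcc t
      (fun t' ht' ht'q => hbase s' hs' hs'q t' ht' ht'q) m (Finset.Subset.refl t) (by omega)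
    · simp [links, nbrs]
    · intro t₁ t₂ _
      exact_mod_cast links_union_right s' t₁ t₂
  have htwo : (links R s t : ℝ) ≤ m * (m * c) := by
    refine le_mul_of_chunks (fun s' => (links R s' t : ℝ)) ?_ ?_ (by positivity) s
      hone m (Finset.Subset.refl s) (by omega)
    · simp [links]
    · intro s₁ s₂ h
      have : links R (s₁ ∪ s₂) t = links R s₁ t + links R s₂ t := Finset.sum_union h
      exact_mod_cast this.le
  have hqpos : (0 : ℝ) < q := by exact_mod_cast (by omega : 0 < q)
  have hmR : (m : ℝ) * q ≤ 2 * n := by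
    have := Nat.div_mul_le_self n q
    have : m * q ≤ 2 * n := by nlinarith
    exact_mod_cast this
  have hq2R : (p : ℝ) ^ 2 ≤ 24 * q := by exact_mod_cast hq2
  have hsq : (p : ℝ) ≤ 5 * √q := by
    rw [show (5 : ℝ) * √q = √(25 * q) by
      rw [Real.sqrt_mul (by norm_num), show (25 : ℝ) = 5 ^ 2 by norm_num,
        Real.sqrt_sq (by norm_num)]]
    exact Real.le_sqrt_of_sq_le (by linarith)
  have hmn : (m : ℝ) ≤ 2 * n / q := by rwa [le_div_iff₀ hqpos]
  have hsq2 : √(q : ℝ) * √q = q := Real.mul_self_sqrt hqpos.le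
  have hsqpos : 0 < √(q : ℝ) := Real.sqrt_pos.2 hqpos
  calc (links R s t : ℝ) ≤ m * (m * c) := htwo
    _ ≤ (2 * n / q) * ((2 * n / q) * c) := by gcongr
    _ = 32000 * ((n : ℝ) ^ 2 / √q) + 16 * (M * ((n : ℝ) ^ 2 / q)) := by
      rw [hc]
      have : (q : ℝ) * √q / q ^ 2 = 1 / √q := by
        field_simp
        linarith
      field_simp
      field_simp at this
      linear_combination (4 * 8000 : ℝ) * n ^ 2 * this
    _ ≤ 32000 * ((n : ℝ) ^ 2 / (p / 5)) + 16 * (M * ((n : ℝ) ^ 2 / (p ^ 2 / 24))) := by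
      gcongr <;> linarith
    _ = 160000 * ((n : ℝ) ^ 2 / p) + 384 * (M * ((n : ℝ) ^ 2 / p ^ 2)) := by
      field_simp
      ring
    _ ≤ _ := by linarith

end Chunks

section Curves

variable {K : Type*} [Field K]

theorem quadratic_eq_zero {c₂ c₁ c₀ x y z : K} (hxy : x ≠ y) (hxz : x ≠ z) (hyz : y ≠ z)
    (hx : c₂ * x ^ 2 + c₁ * x + c₀ = 0) (hy : c₂ * y ^ 2 + c₁ * y + c₀ = 0)
    (hz : c₂ * z ^ 2 + c₁ * z + c₀ = 0) : c₂ = 0 ∧ c₁ = 0 ∧ c₀ = 0 := by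
  have h1 : (x - y) * (c₂ * (x + y) + c₁) = 0 := by linear_combination hx - hy
  have h2 : (x - z) * (c₂ * (x + z) + c₁) = 0 := by linear_combination hx - hz
  have h1 := (mul_eq_zero.1 h1).resolve_left (sub_ne_zero.2 hxy)
  have h2 := (mul_eq_zero.1 h2).resolve_left (sub_ne_zero.2 hxz)
  have h3 : (y - z) * c₂ = 0 := by linear_combination h1 - h2
  have h3 := (mul_eq_zero.1 h3).resolve_left (sub_ne_zero.2 hyz)
  subst h3
  have h4 : c₁ = 0 := by linear_combination h1
  subst h4
  exact ⟨rfl, rfl, by linear_combination hx⟩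

/-- The point `x` lies on the curve `e u v + α u + β v + γ = 0` given by `Γ = (e, α, β, γ)`. -/
def OnCurve (Γ : K × K × K × K) (x : K × K) : Prop :=
  Γ.1 * x.1 * x.2 + Γ.2.1 * x.1 + Γ.2.2.1 * x.2 + Γ.2.2.2 = 0

/-- The curve `Γ` is a graph of an invertible fractional linear map. -/
def IsGraph (Γ : K × K × K × K) : Prop := Γ.2.1 * Γ.2.2.1 - Γ.1 * Γ.2.2.2 ≠ 0

variable {Γ Γ' : K × K × K × K}

theorem IsGraph.den_ne_zero (hΓ : IsGraph Γ) {x : K × K} (hx : OnCurve Γ x) :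
    Γ.1 * x.1 + Γ.2.2.1 ≠ 0 := by
  intro h
  simp only [OnCurve] at hx
  refine hΓ ?_
  have h1 : Γ.2.1 * x.1 + Γ.2.2.2 = 0 := by linear_combination hx - x.2 * h
  linear_combination Γ.2.1 * h - Γ.1 * h1

theorem IsGraph.fst_ne (hΓ : IsGraph Γ) {x y : K × K} (hx : OnCurve Γ x) (hy : OnCurve Γ y)
    (hxy : x ≠ y) : x.1 ≠ y.1 := by
  intro h
  have hd := hΓ.den_ne_zero hx
  simp only [OnCurve] at hx hy
  rw [← h] at hy
  have h1 : (Γ.1 * x.1 + Γ.2.2.1) * (x.2 - y.2) = 0 := by linear_combination hx - hy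
  exact hxy (Prod.ext h (sub_eq_zero.1 ((mul_eq_zero.1 h1).resolve_left hd)))

theorem IsGraph.coeff_eq (hΓ : IsGraph Γ) {x y z : K × K} (hx : OnCurve Γ x) (hy : OnCurve Γ y)
    (hz : OnCurve Γ z) (hx' : OnCurve Γ' x) (hy' : OnCurve Γ' y) (hz' : OnCurve Γ' z)
    (hxy : x ≠ y) (hxz : x ≠ z) (hyz : y ≠ z) :
    Γ'.2.1 * Γ.1 - Γ'.1 * Γ.2.1 = 0 ∧
      Γ'.2.1 * Γ.2.2.1 + Γ'.2.2.2 * Γ.1 - Γ'.1 * Γ.2.2.2 - Γ'.2.2.1 * Γ.2.1 = 0 ∧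
      Γ'.2.2.2 * Γ.2.2.1 - Γ'.2.2.1 * Γ.2.2.2 = 0 := by
  refine quadratic_eq_zero (hΓ.fst_ne hx hy hxy) (hΓ.fst_ne hx hz hxz) (hΓ.fst_ne hy hz hyz)
    ?_ ?_ ?_
  · simp only [OnCurve] at hx hx'
    linear_combination (Γ.1 * x.1 + Γ.2.2.1) * hx' - (Γ'.1 * x.1 + Γ'.2.2.1) * hx
  · simp only [OnCurve] at hy hy'
    linear_combination (Γ.1 * y.1 + Γ.2.2.1) * hy' - (Γ'.1 * y.1 + Γ'.2.2.1) * hy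
  · simp only [OnCurve] at hz hz'
    linear_combination (Γ.1 * z.1 + Γ.2.2.1) * hz' - (Γ'.1 * z.1 + Γ'.2.2.1) * hz

theorem IsGraph.onCurve (hΓ : IsGraph Γ) {x y z : K × K} (hx : OnCurve Γ x) (hy : OnCurve Γ y)
    (hz : OnCurve Γ z) (hx' : OnCurve Γ' x) (hy' : OnCurve Γ' y) (hz' : OnCurve Γ' z)
    (hxy : x ≠ y) (hxz : x ≠ z) (hyz : y ≠ z) {w : K × K} (hw : OnCurve Γ w) : OnCurve Γ' w := by
  obtain ⟨h2, h1, h0⟩ := hΓ.coeff_eq hx hy hz hx' hy' hz' hxy hxz hyz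
  have hd := hΓ.den_ne_zero hw
  refine (mul_eq_zero.1 ?_).resolve_left hd
  simp only [OnCurve] at hw
  linear_combination (Γ'.1 * w.1 + Γ'.2.2.1) * hw + w.1 ^ 2 * h2 + w.1 * h1 + h0

/-- The quadratic form of the plane in isotropic coordinates. -/
def isoDist (x y : K × K) : K := (x.1 - y.1) * (x.2 - y.2)

theorem isoDist_comm (x y : K × K) : isoDist x y = isoDist y x := by
  simp only [isoDist]
  ring

/-- The circle of centre `a` through points at distance `r`. -/
def circle (a : K × K) (r : K) : K × K × K × K := (1, -a.2, -a.1, a.1 * a.2 - r)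

theorem onCurve_circle {a x : K × K} {r : K} : OnCurve (circle a r) x ↔ isoDist a x = r := by
  simp only [OnCurve, circle, isoDist]
  rw [← sub_eq_zero (b := r)]
  ring_nf

theorem isGraph_circle {a : K × K} {r : K} : IsGraph (circle a r) ↔ r ≠ 0 := by
  simp only [IsGraph, circle]
  ring_nf

theorem circle_center_eq {a a' x y z : K × K} {r r' : K} (hr : r ≠ 0)
    (hx : isoDist a x = r) (hy : isoDist a y = r) (hz : isoDist a z = r)
    (hx' : isoDist a' x = r') (hy' : isoDist a' y = r') (hz' : isoDist a' z = r')
    (hxy : x ≠ y) (hxz : x ≠ z) (hyz : y ≠ z) : a = a' := by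
  obtain ⟨h2, h1, h0⟩ := (isGraph_circle.2 hr).coeff_eq (onCurve_circle.2 hx) (onCurve_circle.2 hy)
    (onCurve_circle.2 hz) (onCurve_circle.2 hx') (onCurve_circle.2 hy') (onCurve_circle.2 hz')
    hxy hxz hyz
  simp only [circle] at h2 h1 h0
  have e2 : a.2 = a'.2 := by linear_combination h2
  rw [← e2] at h1 h0
  have h3 : r * (a.1 - a'.1) = 0 := by linear_combination a.1 * h1 + h0
  exact Prod.ext (sub_eq_zero.1 ((mul_eq_zero.1 h3).resolve_left hr)) e2

end Curves

section Blocks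

theorem sum_card_le_of_card_inter_le {α : Type*} [DecidableEq α] {B : Finset α}
    {𝓒 : Finset (Finset α)} (hB : ∀ S ∈ 𝓒, S ⊆ B) {M : ℕ} (hM : ∀ S ∈ 𝓒, M ≤ S.card)
    (hM2 : 4 * B.card ≤ M ^ 2) (h : ∀ S ∈ 𝓒, ∀ T ∈ 𝓒, S ≠ T → (S ∩ T).card ≤ 2) :
    ∑ S ∈ 𝓒, S.card ≤ 2 * B.card := by
  classical
  set Y := ∑ S ∈ 𝓒, S.card with hY
  let k : α → ℕ := fun b => (𝓒.filter (b ∈ ·)).card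
  have h1 : ∑ b ∈ B, k b = Y := by
    rw [hY]
    have := Finset.sum_card_bipartiteAbove_eq_sum_card_bipartiteBelow (fun (b : α) S => b ∈ S)
      (s := B) (t := 𝓒)
    refine this.trans (Finset.sum_congr rfl fun S hS => congr_arg _ ?_)
    rw [Finset.bipartiteBelow, Finset.filter_mem_eq_inter, Finset.inter_eq_right.2 (hB S hS)]
  have h2 : ∑ b ∈ B, k b ^ 2 ≤ Y + 2 * 𝓒.card ^ 2 := by
    have h3 : ∑ b ∈ B, k b ^ 2 = ∑ x ∈ 𝓒 ×ˢ 𝓒, (x.1 ∩ x.2).card := by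
      have := Finset.sum_card_bipartiteAbove_eq_sum_card_bipartiteBelow
        (fun (b : α) (x : Finset α × Finset α) => b ∈ x.1 ∧ b ∈ x.2) (s := B) (t := 𝓒 ×ˢ 𝓒)
      convert this using 2 with b hb x hx
      · rw [Finset.bipartiteAbove, Finset.filter_product (b ∈ ·) (b ∈ ·), Finset.card_product, sq]
      · rw [Finset.bipartiteBelow]
        congr 1
        ext b
        simp only [Finset.mem_inter, Finset.mem_filter]
        exact ⟨fun hb => ⟨hB _ (Finset.mem_product.1 hx).1 hb.1, hb⟩, fun hb => hb.2⟩
    rw [h3, Finset.sum_product]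
    calc ∑ S ∈ 𝓒, ∑ T ∈ 𝓒, (S ∩ T).card ≤ ∑ S ∈ 𝓒, (S.card + ∑ T ∈ 𝓒, 2) := by
          refine Finset.sum_le_sum fun S hS => ?_
          rw [← Finset.add_sum_erase _ _ hS, Finset.inter_self]
          refine Nat.add_le_add_left ((Finset.sum_le_sum fun T hT => ?_).trans
            (Finset.sum_le_sum_of_subset (Finset.erase_subset S 𝓒))) _
          exact h S hS T (Finset.mem_of_mem_erase hT) (Finset.ne_of_mem_erase hT).symm
      _ = Y + 2 * 𝓒.card ^ 2 := by
          rw [Finset.sum_add_distrib, Finset.sum_const, Finset.sum_const, smul_eq_mul, smul_eq_mul]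
          ring
  have h3 : M * 𝓒.card ≤ Y := by
    rw [hY, mul_comm, ← smul_eq_mul]
    exact Finset.card_nsmul_le_sum _ _ _ hM
  have h4 : Y ^ 2 ≤ B.card * ∑ b ∈ B, k b ^ 2 := by
    rw [← h1]
    exact sq_sum_le_card_mul_sum_sq
  rcases Nat.eq_zero_or_pos Y with h0 | h0
  · omega
  have h5 : Y ^ 2 ≤ B.card * Y + 2 * (B.card * 𝓒.card ^ 2) := by nlinarith
  have h6 : 4 * (B.card * 𝓒.card ^ 2) ≤ Y ^ 2 := by
    calc 4 * (B.card * 𝓒.card ^ 2) = (4 * B.card) * 𝓒.card ^ 2 := by ring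
      _ ≤ M ^ 2 * 𝓒.card ^ 2 := Nat.mul_le_mul_right _ hM2
      _ = (M * 𝓒.card) ^ 2 := by ring
      _ ≤ Y ^ 2 := Nat.pow_le_pow_left h3 2
  have h7 : Y * Y ≤ (2 * B.card) * Y := by nlinarith
  exact Nat.le_of_mul_le_mul_right h7 h0

variable {K V : Type*} [Field K]

/-- `S` consists of the points of `B` on a curve containing more than `M` of them. -/
def IsBlock (φ : V → K × K) (B : Finset V) (M : ℕ) (S : Finset V) : Prop :=
  M < S.card ∧ ∃ Γ, IsGraph Γ ∧ ∀ x, x ∈ S ↔ x ∈ B ∧ OnCurve Γ (φ x)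

open Classical in
/-- The family of all blocks. -/
noncomputable def blocks (φ : V → K × K) (B : Finset V) (M : ℕ) : Finset (Finset V) :=
  B.powerset.filter (IsBlock φ B M)

variable {φ : V → K × K} {B : Finset V} {M : ℕ}

theorem mem_blocks {S : Finset V} : S ∈ blocks φ B M ↔ IsBlock φ B M S := by
  classical
  rw [blocks, Finset.mem_filter, Finset.mem_powerset, and_iff_right_iff_imp]
  rintro ⟨-, Γ, -, h⟩ x hx
  exact ((h x).1 hx).1

theorem exists_block {Γ : K × K × K × K} (hΓ : IsGraph Γ) {T : Finset V} (hT : T ⊆ B)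
    (hM : M < T.card) (h : ∀ x ∈ T, OnCurve Γ (φ x)) :
    ∃ S ∈ blocks φ B M, ∀ x ∈ B, OnCurve Γ (φ x) → x ∈ S := by
  classical
  refine ⟨B.filter fun x => OnCurve Γ (φ x), mem_blocks.2 ⟨hM.trans_le (Finset.card_le_card
    fun x hx => Finset.mem_filter.2 ⟨hT hx, h x hx⟩), Γ, hΓ, fun x => Finset.mem_filter⟩,
    fun x hx hxΓ => Finset.mem_filter.2 ⟨hx, hxΓ⟩⟩

theorem IsBlock.onCurve (hφ : Function.Injective φ) {S : Finset V} (hS : IsBlock φ B M S)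
    {Γ : K × K × K × K} {T : Finset V} (hT : T ⊆ S) (hcard : 2 < T.card)
    (h : ∀ x ∈ T, OnCurve Γ (φ x)) : ∀ x ∈ S, OnCurve Γ (φ x) := by
  classical
  obtain ⟨x, hx, y, hy, z, hz, hxy, hxz, hyz⟩ := Finset.two_lt_card.1 hcard
  obtain ⟨-, Γ₀, hΓ₀, hS⟩ := hS
  have hS' : ∀ w ∈ S, OnCurve Γ₀ (φ w) := fun w hw => ((hS w).1 hw).2
  intro w hw
  exact hΓ₀.onCurve (hS' x (hT hx)) (hS' y (hT hy)) (hS' z (hT hz)) (h x hx) (h y hy) (h z hz)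
    (hφ.ne hxy) (hφ.ne hxz) (hφ.ne hyz) (hS' w hw)

theorem sum_card_blocks_le (hφ : Function.Injective φ) (hM : 4 * B.card ≤ M ^ 2) :
    ∑ S ∈ blocks φ B M, S.card ≤ 2 * B.card := by
  classical
  have hsub : ∀ S ∈ blocks φ B M, S ⊆ B := fun S hS => by
    obtain ⟨-, Γ, -, h⟩ := mem_blocks.1 hS
    exact fun x hx => ((h x).1 hx).1
  refine sum_card_le_of_card_inter_le hsub (fun S hS => (mem_blocks.1 hS).1.le) hM ?_
  have key : ∀ S ∈ blocks φ B M, ∀ T ∈ blocks φ B M, 2 < (S ∩ T).card → S ⊆ T := by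
    intro S hS T hT hcard x hx
    obtain ⟨-, Γ, -, hΓ⟩ := mem_blocks.1 hT
    refine (hΓ x).2 ⟨hsub S hS hx, ?_⟩
    exact (mem_blocks.1 hS).onCurve hφ Finset.inter_subset_left hcard
      (fun y hy => ((hΓ y).1 (Finset.mem_inter.1 hy).2).2) x hx
  intro S hS T hT hne
  by_contra! hcard
  exact hne ((key S hS T hT hcard).antisymm (key T hT S hS (by rwa [Finset.inter_comm])))

end Blocks

section Axes

variable {K V : Type*} [Field K]

/-- The bisector of `x` and `y` is that of `x'` and `y'`. -/
def SameAxis (x y x' y' : K × K) : Prop := ∃ c : K, c ≠ 0 ∧ y'.1 - x'.1 = c * (y.1 - x.1) ∧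
  y'.2 - x'.2 = c * (y.2 - x.2) ∧ x'.1 * x'.2 - y'.1 * y'.2 = c * (x.1 * x.2 - y.1 * y.2)

variable {x y x' y' : K × K}

theorem SameAxis.symm (h : SameAxis x y x' y') : SameAxis x' y' x y := by
  obtain ⟨c, hc, h1, h2, h3⟩ := h
  refine ⟨c⁻¹, inv_ne_zero hc, ?_, ?_, ?_⟩
  · rw [h1, inv_mul_cancel_left₀ hc]
  · rw [h2, inv_mul_cancel_left₀ hc]
  · rw [h3, inv_mul_cancel_left₀ hc]

theorem SameAxis.rel_fst (h : SameAxis x y x' y') :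
    (x.1 - y.1) * (x.2 - x'.2) = (y.1 - y'.1) * (y.2 - x.2) := by
  obtain ⟨c, hc, h1, h2, h3⟩ := h
  have key : c * ((x.1 - y.1) * (x.2 - x'.2)) = c * ((y.1 - y'.1) * (y.2 - x.2)) := by
    linear_combination (-x'.2) * h1 + (-y'.1) * h2 - h3
  exact mul_left_cancel₀ hc key

theorem SameAxis.rel_snd (h : SameAxis x y x' y') :
    (x.2 - y.2) * (x.1 - x'.1) = (y.2 - y'.2) * (y.1 - x.1) := by
  obtain ⟨c, hc, h1, h2, h3⟩ := h
  have key : c * ((x.2 - y.2) * (x.1 - x'.1)) = c * ((y.2 - y'.2) * (y.1 - x.1)) := by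
    linear_combination (-x'.1) * h2 + (-y'.2) * h1 - h3
  exact mul_left_cancel₀ hc key

theorem SameAxis.isoDist_eq (h : SameAxis x y x' y') (hxy : isoDist x y ≠ 0) :
    isoDist x x' = isoDist y y' := by
  have h1 := h.rel_fst
  have h2 := h.rel_snd
  simp only [isoDist] at *
  refine mul_left_cancel₀ hxy ?_
  linear_combination (x.2 - y.2) * (x.1 - x'.1) * h1 + (y.1 - y'.1) * (y.2 - x.2) * h2

/-- The pairs of points of `B` with non-isotropic difference that do not lie on a block. -/
def Kept (φ : V → K × K) (B : Finset V) (M : ℕ) (g : V × V) : Prop :=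
  g.1 ∈ B ∧ g.2 ∈ B ∧ isoDist (φ g.1) (φ g.2) ≠ 0 ∧ ¬∃ S ∈ blocks φ B M, g.1 ∈ S ∧ g.2 ∈ S

open Classical in
/-- The pairs of points of `B` equidistant from `a`, at non-zero distance. -/
noncomputable def legs (φ : V → K × K) (B : Finset V) (a : V) : Finset (V × V) :=
  (B ×ˢ B).filter fun g => isoDist (φ a) (φ g.1) = isoDist (φ a) (φ g.2) ∧
    isoDist (φ a) (φ g.1) ≠ 0

variable {φ : V → K × K} {A B : Finset V} {M : ℕ}

theorem mem_legs {a : V} {g : V × V} : g ∈ legs φ B a ↔ (g.1 ∈ B ∧ g.2 ∈ B) ∧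
    isoDist (φ a) (φ g.1) = isoDist (φ a) (φ g.2) ∧ isoDist (φ a) (φ g.1) ≠ 0 := by
  classical
  rw [legs, Finset.mem_filter, Finset.mem_product]

theorem sum_le_of_le_off_one {α : Type*} {A : Finset α} {f : α → ℕ} {m n : ℕ} (P : α → Prop)
    (hP : ∀ a b, P a → P b → a = b) (h1 : ∀ a ∈ A, ¬P a → f a ≤ m) (h2 : ∀ a ∈ A, f a ≤ n) :
    ∑ a ∈ A, f a ≤ A.card * m + n := by
  classical
  by_cases h : ∃ a ∈ A, P a
  · obtain ⟨a, ha, hPa⟩ := h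
    rw [← Finset.add_sum_erase _ _ ha, add_comm]
    refine add_le_add ?_ (h2 a ha)
    refine (Finset.sum_le_card_nsmul _ _ m fun b hb => ?_).trans ?_
    · exact h1 b (Finset.mem_of_mem_erase hb) fun hPb => Finset.ne_of_mem_erase hb (hP b a hPb hPa)
    · exact Nat.mul_le_mul_right _ (Finset.card_le_card (Finset.erase_subset _ _))
  · push Not at h
    exact (Finset.sum_le_card_nsmul _ _ m fun b hb => h1 b hb (h b hb)).trans (Nat.le_add_right _ _)

theorem IsBlock.sum_card_legs_le (hφ : Function.Injective φ) {S : Finset V}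
    (hS : IsBlock φ B M S) (hSA : S.card ≤ A.card) :
    ∑ a ∈ A, (legs φ S a).card ≤ 3 * A.card * S.card := by
  classical
  have key := sum_le_of_le_off_one (A := A) (f := fun a => (legs φ S a).card) (m := 2 * S.card)
    (n := S.card * S.card)
    (fun a => ∃ r, r ≠ 0 ∧ 2 < (S.filter fun x => isoDist (φ a) (φ x) = r).card) ?_ ?_ ?_
  · refine key.trans ?_
    nlinarith [Nat.mul_le_mul_right S.card hSA]
  · rintro a a' ⟨r, hr, hcard⟩ ⟨r', hr', hcard'⟩
    have h' := hS.onCurve hφ (Γ := circle (φ a') r') (Finset.filter_subset _ _) hcard'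
      fun x hx => onCurve_circle.2 (Finset.mem_filter.1 hx).2
    obtain ⟨x, hx, y, hy, z, hz, hxy, hxz, hyz⟩ := Finset.two_lt_card.1 hcard
    rw [Finset.mem_filter] at hx hy hz
    exact hφ (circle_center_eq hr hx.2 hy.2 hz.2 (onCurve_circle.1 (h' x hx.1))
      (onCurve_circle.1 (h' y hy.1)) (onCurve_circle.1 (h' z hz.1))
      (hφ.ne hxy) (hφ.ne hxz) (hφ.ne hyz))
  · intro a _ ha
    push Not at ha
    refine Finset.card_le_mul_card_image_of_maps_to (f := Prod.fst)
      (fun g hg => (mem_legs.1 hg).1.1) 2 fun x hx => ?_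
    by_cases h0 : isoDist (φ a) (φ x) = 0
    · rw [Finset.card_eq_zero.2]
      · norm_num
      refine Finset.filter_eq_empty_iff.2 fun g hg hgx => (mem_legs.1 hg).2.2 ?_
      rw [hgx, h0]
    refine le_trans ?_ (ha _ h0)
    refine Finset.card_le_card_of_injOn Prod.snd (fun g hg => ?_) fun g hg g' hg' h => ?_
    · obtain ⟨hg1, hgx⟩ := Finset.mem_filter.1 hg
      obtain ⟨h1, h2, -⟩ := mem_legs.1 hg1
      refine Finset.mem_filter.2 ⟨h1.2, ?_⟩
      rw [← h2, hgx]
    · exact Prod.ext ((Finset.mem_filter.1 hg).2.trans (Finset.mem_filter.1 hg').2.symm) h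
  · intro a _
    rw [← Finset.card_product]
    exact Finset.card_filter_le _ _

open Classical in
theorem sum_card_not_kept_le (hφ : Function.Injective φ) (hM : 4 * B.card ≤ M ^ 2)
    (hBA : B.card ≤ A.card) :
    ∑ a ∈ A, ((legs φ B a).filter fun g => isoDist (φ g.1) (φ g.2) ≠ 0 ∧ ¬Kept φ B M g).card ≤
      6 * A.card ^ 2 := by
  calc _ ≤ ∑ a ∈ A, ∑ S ∈ blocks φ B M, (legs φ S a).card := by
        refine Finset.sum_le_sum fun a _ => le_trans (Finset.card_le_card ?_) Finset.card_biUnion_le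
        intro g hg
        obtain ⟨hg, hg0, hk⟩ := Finset.mem_filter.1 hg
        obtain ⟨hB, hd⟩ := mem_legs.1 hg
        have : ∃ S ∈ blocks φ B M, g.1 ∈ S ∧ g.2 ∈ S := by
          by_contra hcon
          exact hk ⟨hB.1, hB.2, hg0, hcon⟩
        obtain ⟨S, hS, hgS⟩ := this
        exact Finset.mem_biUnion.2 ⟨S, hS, mem_legs.2 ⟨hgS, hd⟩⟩
    _ = ∑ S ∈ blocks φ B M, ∑ a ∈ A, (legs φ S a).card := Finset.sum_comm
    _ ≤ ∑ S ∈ blocks φ B M, 3 * A.card * S.card := by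
        refine Finset.sum_le_sum fun S hS => (mem_blocks.1 hS).sum_card_legs_le hφ ?_
        refine (Finset.card_le_card fun x hx => ?_).trans hBA
        obtain ⟨-, Γ, -, h⟩ := mem_blocks.1 hS
        exact ((h x).1 hx).1
    _ = 3 * A.card * ∑ S ∈ blocks φ B M, S.card := by rw [Finset.mul_sum]
    _ ≤ 3 * A.card * (2 * A.card) := by
        refine Nat.mul_le_mul_left _ ((sum_card_blocks_le hφ hM).trans ?_)
        omega
    _ = 6 * A.card ^ 2 := by ring

end Axes

section Quadruples

theorem card_le_links {α β ξ : Type*} {R : α → β → Prop} {S : Finset α} {T : Finset β}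
    {X : Finset ξ} (e : ξ → α) (f : ξ → β)
    (hinj : ∀ x ∈ X, ∀ y ∈ X, e x = e y → f x = f y → x = y)
    (h : ∀ x ∈ X, e x ∈ S ∧ f x ∈ T ∧ R (e x) (f x)) : X.card ≤ links R S T := by
  rw [links, ← Finset.card_sigma]
  refine Finset.card_le_card_of_injOn (fun x => ⟨e x, f x⟩) (fun x hx => ?_) fun x hx y hy hxy => ?_
  · exact Finset.mem_sigma.2 ⟨(h x hx).1, mem_nbrs.2 (h x hx).2⟩
  · simp only [Sigma.mk.injEq, heq_eq_eq] at hxy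
    exact hinj x hx y hy hxy.1 hxy.2

variable {K V : Type*}

/-- In one of the two isotropic directions no line contains more than `M` points of `B`. -/
def FewOnLines (φ : V → K × K) (B : Finset V) (M : ℕ) : Prop :=
  (∀ S ⊆ B, ∀ c, (∀ b ∈ S, (φ b).1 = c) → S.card ≤ M) ∨
    ∀ S ⊆ B, ∀ c, (∀ b ∈ S, (φ b).2 = c) → S.card ≤ M

theorem FewOnLines.card_le {φ : V → K × K} {B : Finset V} {M : ℕ}
    (hB : FewOnLines φ B M) {ι : Type*} {J : Finset ι} {e e' : ι → V} (he : Set.InjOn e J)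
    (he' : Set.InjOn e' J) (hmem : ∀ i ∈ J, e i ∈ B)
    (hmem' : ∀ i ∈ J, e' i ∈ B) {c c' : K} (h : ∀ i ∈ J, (φ (e i)).1 = c)
    (h' : ∀ i ∈ J, (φ (e' i)).2 = c') : J.card ≤ M := by
  classical
  rcases hB with hB | hB
  · rw [← Finset.card_image_of_injOn he]
    refine hB _ (fun x hx => ?_) c fun x hx => ?_
    · obtain ⟨i, hi, rfl⟩ := Finset.mem_image.1 hx
      exact hmem i hi
    · obtain ⟨i, hi, rfl⟩ := Finset.mem_image.1 hx
      exact h i hi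
  · rw [← Finset.card_image_of_injOn he']
    refine hB _ (fun x hx => ?_) c' fun x hx => ?_
    · obtain ⟨i, hi, rfl⟩ := Finset.mem_image.1 hx
      exact hmem' i hi
    · obtain ⟨i, hi, rfl⟩ := Finset.mem_image.1 hx
      exact h' i hi

variable [Field K]

theorem SameAxis.eq_of_fst_eq {x y x' y' x₁ : K × K} (h : SameAxis x y x' y')
    (h₁ : SameAxis x y x₁ y') (hxy : isoDist x y ≠ 0) : x' = x₁ := by
  have hf := h.rel_fst
  have hs := h.rel_snd
  have hf₁ := h₁.rel_fst
  have hs₁ := h₁.rel_snd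
  obtain ⟨hu, hv⟩ := mul_ne_zero_iff.1 hxy
  refine Prod.ext (mul_left_cancel₀ hv ?_) (mul_left_cancel₀ hu ?_)
  · linear_combination hs₁ - hs
  · linear_combination hf₁ - hf

variable (φ : V → K × K) (B : Finset V) (M : ℕ)

open Classical in
/-- The pairs of points of `B` at distance `r`. -/
noncomputable def atDist (r : K) : Finset (V × V) :=
  (B ×ˢ B).filter fun g => isoDist (φ g.1) (φ g.2) = r

/-- `(b, b')` and `(c, c')` are such that `(b, c)` and `(b', c')` are kept pairs with the same
bisector. -/
def Linked (i j : V × V) : Prop :=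
  Kept φ B M (i.1, j.1) ∧ Kept φ B M (i.2, j.2) ∧
    SameAxis (φ i.1) (φ j.1) (φ i.2) (φ j.2)

variable {φ B M}

theorem mem_atDist {r : K} {g : V × V} :
    g ∈ atDist φ B r ↔ (g.1 ∈ B ∧ g.2 ∈ B) ∧ isoDist (φ g.1) (φ g.2) = r := by
  classical
  rw [atDist, Finset.mem_filter, Finset.mem_product]

theorem card_le_of_onCurve {ι : Type*} {J : Finset ι} {e : ι → V} (he : Set.InjOn e J) {c : V}
    (hk : ∀ i ∈ J, Kept φ B M (e i, c)) {Γ : K × K × K × K} (hΓ : IsGraph Γ)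
    (hc : OnCurve Γ (φ c)) (h : ∀ i ∈ J, OnCurve Γ (φ (e i))) : J.card ≤ M := by
  classical
  by_contra! hM
  rw [← Finset.card_image_of_injOn he] at hM
  obtain ⟨S, hS, hmem⟩ := exists_block hΓ (B := B) (T := J.image e)
    (fun x hx => by
      obtain ⟨i, hi, rfl⟩ := Finset.mem_image.1 hx
      exact (hk i hi).1) hM
    (fun x hx => by
      obtain ⟨i, hi, rfl⟩ := Finset.mem_image.1 hx
      exact h i hi)
  obtain ⟨x, hx⟩ := Finset.card_pos.1 ((Nat.zero_le M).trans_lt hM)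
  obtain ⟨i, hi, rfl⟩ := Finset.mem_image.1 hx
  obtain ⟨hi1, hi2, -, hk'⟩ := hk i hi
  exact hk' ⟨S, hS, hmem _ hi1 (h i hi), hmem _ hi2 hc⟩

/-- The point attached to a pair. -/
def pairPoint (x x' : K × K) : K × K × K := (x.1 * (x.2 - x'.2), x.2 - x'.2, x.2)

/-- The plane attached to a pair. -/
def pairPlane (y y' : K × K) : K × K × K := ((y.1 - y'.1)⁻¹, -(y.1 * (y.1 - y'.1)⁻¹), -y.2)

theorem incident_pair {x x' y y' : K × K} (hy : isoDist y y' ≠ 0) (h : SameAxis x y x' y') :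
    Incident (pairPoint x x') (pairPlane y y') := by
  have hz := (mul_ne_zero_iff.1 hy).1
  have h1 := h.rel_fst
  simp only [Incident, pairPoint, pairPlane]
  field_simp
  linear_combination h1

theorem injOn_pairPoint (hφ : Function.Injective φ) {r : K} (hr : r ≠ 0) :
    Set.InjOn (fun i : V × V => pairPoint (φ i.1) (φ i.2)) (atDist φ B r) := by
  intro i hi j hj h
  have hi := (mem_atDist.1 hi).2
  have hj := (mem_atDist.1 hj).2
  simp only [pairPoint, Prod.mk.injEq] at h
  obtain ⟨h1, h2, h3⟩ := h
  have hw := (mul_ne_zero_iff.1 (hi.trans_ne hr)).2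
  have e2 : (φ i.2).2 = (φ j.2).2 := by linear_combination h3 - h2
  have e1 : (φ i.1).1 = (φ j.1).1 := mul_right_cancel₀ hw (by rw [h1, h2])
  simp only [isoDist] at hi hj
  rw [← h2, ← e1] at hj
  have e3 := mul_right_cancel₀ hw (hi.trans hj.symm)
  exact Prod.ext (hφ (Prod.ext e1 h3)) (hφ (Prod.ext (by linear_combination -e3) e2))

theorem injOn_pairPlane (hφ : Function.Injective φ) {r : K} (hr : r ≠ 0) :
    Set.InjOn (fun i : V × V => pairPlane (φ i.1) (φ i.2)) (atDist φ B r) := by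
  intro i hi j hj h
  have hi := (mem_atDist.1 hi).2
  have hj := (mem_atDist.1 hj).2
  simp only [pairPlane, Prod.mk.injEq, neg_inj] at h
  obtain ⟨h1, h2, h3⟩ := h
  have hz := (mul_ne_zero_iff.1 (hi.trans_ne hr)).1
  rw [← h1] at h2
  have e1 := mul_right_cancel₀ (inv_ne_zero hz) h2
  have e0 := inv_injective h1
  simp only [isoDist] at hi hj
  rw [← e0, ← h3] at hj
  have e3 := mul_left_cancel₀ hz (hi.trans hj.symm)
  exact Prod.ext (hφ (Prod.ext e1 h3))
    (hφ (Prod.ext (by linear_combination e1 - e0) (by linear_combination -e3)))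

theorem card_linked_incident_le (hφ : Function.Injective φ) (hB : FewOnLines φ B M) {r : K}
    (hr : r ≠ 0) {j : V × V} (hj : isoDist (φ j.1) (φ j.2) = r) {π : K × K × K}
    (hπ : π ≠ pairPlane (φ j.1) (φ j.2)) {J : Finset (V × V)} (hJ : J ⊆ atDist φ B r)
    (h : ∀ i ∈ J, Linked φ B M i j ∧ Incident (pairPoint (φ i.1) (φ i.2)) π) : J.card ≤ M := by
  rcases J.eq_empty_or_nonempty with rfl | ⟨i₀, hi₀⟩
  · exact Nat.zero_le _
  have hJB : ∀ i ∈ J, (i.1 ∈ B ∧ i.2 ∈ B) ∧ isoDist (φ i.1) (φ i.2) = r :=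
    fun i hi => mem_atDist.1 (hJ hi)
  obtain ⟨hz, ht⟩ := mul_ne_zero_iff.1 (hj.trans_ne hr)
  have inj1 : Set.InjOn (fun i : V × V => i.1) J := by
    intro i hi k hk hik
    simp only at hik
    have h1 := (h i hi).1
    have h2 := (h k hk).1
    refine Prod.ext hik (hφ (h1.2.2.eq_of_fst_eq (y' := φ j.2) ?_ h1.1.2.2.1))
    rw [hik]
    exact h2.2.2
  have inj2 : Set.InjOn (fun i : V × V => i.2) J := by
    intro i hi k hk hik
    simp only at hik
    have h1 := (h i hi).1
    have h2 := (h k hk).1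
    refine Prod.ext (hφ (h1.2.2.symm.eq_of_fst_eq (y' := φ j.1) ?_ h1.2.1.2.2.1)) hik
    rw [hik]
    exact h2.2.2.symm
  obtain ⟨A', B', D'⟩ := π
  set s₁ := (φ j.1).1 with hs₁
  set t₁ := (φ j.1).2 with ht₁
  set s₂ := (φ j.2).1 with hs₂
  set t₂ := (φ j.2).2 with ht₂
  obtain ⟨a, ha⟩ : ∃ a, a = A' - (s₁ - s₂)⁻¹ := ⟨_, rfl⟩
  obtain ⟨b, hb⟩ : ∃ b, b = B' + s₁ * (s₁ - s₂)⁻¹ := ⟨_, rfl⟩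
  obtain ⟨d, hd⟩ : ∃ d, d = D' + t₁ := ⟨_, rfl⟩
  have key : ∀ i ∈ J, ((φ i.1).2 - (φ i.2).2) * (a * (φ i.1).1 + b) + d = 0 := by
    intro i hi
    have h1 := (h i hi).2
    have h2 := incident_pair (hj.trans_ne hr) (h i hi).1.2.2
    simp only [Incident, pairPoint, pairPlane] at h1 h2
    rw [ha, hb, hd]
    linear_combination h1 - h2
  have E1 := fun i hi => (h i hi).1.2.2.rel_fst
  have E3 := fun i hi => (h i hi).1.2.2.symm.rel_fst
  have E4 := fun i hi => (h i hi).1.2.2.symm.rel_snd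
  simp only [← hs₁, ← ht₁, ← hs₂, ← ht₂] at E1 E3 E4
  by_cases hd0 : d = 0
  · have ha0 : a ≠ 0 := by
      intro ha0
      by_cases hb0 : b = 0
      · refine hπ ?_
        simp only [pairPlane, Prod.mk.injEq]
        refine ⟨?_, ?_, ?_⟩
        · linear_combination ha0 - ha
        · linear_combination hb0 - hb
        · linear_combination hd0 - hd
      have hw := (mul_ne_zero_iff.1 ((hJB i₀ hi₀).2.trans_ne hr)).2
      have := key i₀ hi₀
      rw [hd0, ha0, zero_mul, zero_add, add_zero] at this
      exact mul_ne_zero hw hb0 this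
    obtain ⟨u, hu⟩ : ∃ u, u = -b / a := ⟨_, rfl⟩
    have hu' : a * u = -b := by rw [hu]; field_simp
    have hJu : ∀ i ∈ J, (φ i.1).1 = u := by
      intro i hi
      have hw := (mul_ne_zero_iff.1 ((hJB i hi).2.trans_ne hr)).2
      have h1 := key i hi
      rw [hd0, add_zero] at h1
      have h1 := (mul_eq_zero.1 h1).resolve_left hw
      exact mul_left_cancel₀ ha0 (by linear_combination h1 - hu')
    by_cases hus : u = s₂
    · refine hB.card_le inj1 inj2 (fun i hi => (hJB i hi).1.1) (fun i hi => (hJB i hi).1.2) hJu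
        (c' := t₁) fun i hi => ?_
      have h4 := E4 i hi
      rw [hJu i hi, hus] at h4
      have hne := (mul_ne_zero_iff.1 (h i hi).1.2.1.2.2.1).1
      exact mul_left_cancel₀ hne (by linear_combination h4)
    · refine card_le_of_onCurve inj2 (fun i hi => (h i hi).1.2.1)
        (Γ := (-1, t₁, u, -t₂ * u - (t₁ - t₂) * s₂)) ?_ ?_ fun i hi => ?_
      · simp only [IsGraph]
        refine fun h0 => mul_ne_zero ht (sub_ne_zero.2 hus) ?_
        linear_combination h0
      · simp only [OnCurve, ← hs₂, ← ht₂]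
        ring
      · have h4 := E4 i hi
        rw [hJu i hi] at h4
        simp only [OnCurve]
        linear_combination -h4
  by_cases hba : b + a * s₁ = 0
  · have hav : ∀ i ∈ J, (s₁ - s₂) * a * ((φ i.1).2 - t₁) = d := by
      intro i hi
      linear_combination -key i hi + a * E1 i hi + ((φ i.1).2 - (φ i.2).2) * hba
    have hne : (s₁ - s₂) * a ≠ 0 := by
      intro h0
      have := hav i₀ hi₀
      rw [h0, zero_mul] at this
      exact hd0 this.symm
    obtain ⟨v, hv⟩ : ∃ v, v = (φ i₀.1).2 := ⟨_, rfl⟩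
    have hJv : ∀ i ∈ J, (φ i.1).2 = v := by
      intro i hi
      have h1 := mul_left_cancel₀ hne ((hav i hi).trans (hav i₀ hi₀).symm)
      rw [hv]
      linear_combination h1
    by_cases hvt : v = t₂
    · refine hB.card_le inj2 inj1 (fun i hi => (hJB i hi).1.2) (fun i hi => (hJB i hi).1.1)
        (c := s₁) (fun i hi => ?_) hJv
      have h3 := E3 i hi
      rw [hJv i hi, hvt] at h3
      have hne := (mul_ne_zero_iff.1 (h i hi).1.2.1.2.2.1).2
      exact mul_left_cancel₀ hne (by linear_combination h3)
    · refine card_le_of_onCurve inj2 (fun i hi => (h i hi).1.2.1)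
        (Γ := (-1, v, s₁, -s₂ * v - (s₁ - s₂) * t₂)) ?_ ?_ fun i hi => ?_
      · simp only [IsGraph]
        refine fun h0 => mul_ne_zero hz (sub_ne_zero.2 hvt) ?_
        linear_combination h0
      · simp only [OnCurve, ← hs₂, ← ht₂]
        ring
      · have h3 := E3 i hi
        rw [hJv i hi] at h3
        simp only [OnCurve]
        linear_combination -h3
  · refine card_le_of_onCurve inj1 (fun i hi => (h i hi).1.1)
      (Γ := (-(s₁ - s₂) * a, (s₁ - s₂) * t₁ * a + d, -(s₁ - s₂) * b,
        (s₁ - s₂) * t₁ * b - d * s₁)) ?_ ?_ fun i hi => ?_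
    · simp only [IsGraph]
      refine fun h0 => mul_ne_zero (mul_ne_zero hz hd0) hba ?_
      linear_combination -h0
    · simp only [OnCurve, ← hs₁, ← ht₁]
      ring
    · simp only [OnCurve]
      linear_combination ((φ i.1).1 - s₁) * key i hi - (a * (φ i.1).1 + b) * E1 i hi

end Quadruples

section QuadrupleCount

variable {V : Type*}

theorem card_le_of_determined {L : Type*} {B : Finset V} {M : ℕ} {X : Finset ((V × V) × (V × V))}
    (ψ : (V × V) × (V × V) → V) (hX : ∀ x ∈ X, x.1.1 ∈ B ∧ x.1.2 ∈ B)
    (hinj : ∀ x ∈ X, ∀ y ∈ X, x.1 = y.1 → ψ x = ψ y → x = y) (k : V × V → L) (l : V → L)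
    (hψ : ∀ x ∈ X, ψ x ∈ B ∧ l (ψ x) = k x.1)
    (hM : ∀ S ⊆ B, ∀ c, (∀ b ∈ S, l b = c) → S.card ≤ M) : X.card ≤ M * B.card ^ 2 := by
  classical
  rw [sq, ← Finset.card_product]
  refine Finset.card_le_mul_card_image_of_maps_to (f := Prod.fst)
    (fun x hx => Finset.mem_product.2 (hX x hx)) M fun g hg => ?_
  rw [← Finset.card_image_of_injOn (f := ψ)]
  · refine hM _ (fun b hb => ?_) (k g) fun b hb => ?_
    · obtain ⟨x, hx, rfl⟩ := Finset.mem_image.1 hb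
      exact (hψ x (Finset.mem_filter.1 hx).1).1
    · obtain ⟨x, hx, rfl⟩ := Finset.mem_image.1 hb
      obtain ⟨hx', rfl⟩ := Finset.mem_filter.1 hx
      exact (hψ _ hx').2
  · intro x hx y hy hxy
    obtain ⟨hx, hxg⟩ := Finset.mem_filter.1 hx
    obtain ⟨hy, hyg⟩ := Finset.mem_filter.1 hy
    exact hinj x hx y hy (hxg.trans hyg.symm) hxy

variable {K : Type*} [Field K] {φ : V → K × K} {B : Finset V} {M : ℕ}

variable (φ B M) in
open Classical in
/-- The kept pairs. -/
noncomputable def keptPairs : Finset (V × V) := (B ×ˢ B).filter (Kept φ B M)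

variable (φ B M) in
open Classical in
/-- The pairs of kept pairs with the same bisector. -/
noncomputable def coaxialPairs : Finset ((V × V) × (V × V)) :=
  (keptPairs φ B M ×ˢ keptPairs φ B M).filter fun x =>
    SameAxis (φ x.1.1) (φ x.1.2) (φ x.2.1) (φ x.2.2)

theorem mem_keptPairs {g : V × V} : g ∈ keptPairs φ B M ↔ Kept φ B M g := by
  classical
  rw [keptPairs, Finset.mem_filter, Finset.mem_product, and_iff_right_iff_imp]
  exact fun h => ⟨h.1, h.2.1⟩

theorem mem_coaxialPairs {x : (V × V) × (V × V)} : x ∈ coaxialPairs φ B M ↔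
    Linked φ B M (x.1.1, x.2.1) (x.1.2, x.2.2) := by
  classical
  rw [coaxialPairs, Finset.mem_filter, Finset.mem_product, mem_keptPairs, mem_keptPairs, Linked,
    and_assoc]

theorem SameAxis.flip {x y x' y' : K × K} (h : SameAxis x y x' y') : SameAxis y x y' x' := by
  obtain ⟨c, hc, h1, h2, h3⟩ := h
  exact ⟨c, hc, by linear_combination -h1, by linear_combination -h2, by linear_combination -h3⟩

theorem card_coaxialPairs_eq_le (hφ : Function.Injective φ) (hB : FewOnLines φ B M)
    {X : Finset ((V × V) × (V × V))} (hX : X ⊆ coaxialPairs φ B M)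
    (h : (∀ x ∈ X, (φ x.2.1).1 = (φ x.1.1).1 ∧ (φ x.2.2).2 = (φ x.1.2).2) ∨
      ∀ x ∈ X, (φ x.2.1).2 = (φ x.1.1).2 ∧ (φ x.2.2).1 = (φ x.1.2).1) :
    X.card ≤ M * B.card ^ 2 := by
  have hL := fun x (hx : x ∈ X) => mem_coaxialPairs.1 (hX hx)
  have h1 : ∀ x ∈ X, x.1.1 ∈ B ∧ x.1.2 ∈ B := fun x hx => ⟨(hL x hx).1.1, (hL x hx).1.2.1⟩
  have h21 : ∀ x ∈ X, ∀ y ∈ X, x.1 = y.1 → x.2.1 = y.2.1 → x = y := by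
    rintro ⟨⟨b, c⟩, ⟨b', c'⟩⟩ hx ⟨⟨_, _⟩, ⟨_, c₁⟩⟩ hy ⟨⟩ ⟨⟩
    have h := (hL _ hx).2.2.flip.eq_of_fst_eq (hL _ hy).2.2.flip
      (by rw [isoDist_comm]; exact (hL _ hx).1.2.2.1)
    exact congr_arg (fun z => ((b, c), b', z)) (hφ h)
  have h22 : ∀ x ∈ X, ∀ y ∈ X, x.1 = y.1 → x.2.2 = y.2.2 → x = y := by
    rintro ⟨⟨b, c⟩, ⟨b', c'⟩⟩ hx ⟨⟨_, _⟩, ⟨_, c₁⟩⟩ hy ⟨⟩ ⟨⟩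
    have h := (hL _ hx).2.2.eq_of_fst_eq (hL _ hy).2.2 (hL _ hx).1.2.2.1
    exact congr_arg (fun z => ((b, c), z, c')) (hφ h)
  have hb := fun x hx => (hL x hx).2.1.1
  have hc := fun x hx => (hL x hx).2.1.2.1
  rcases hB with hB | hB <;> rcases h with h | h
  · exact card_le_of_determined (fun x => x.2.1) h1 h21 (fun g => (φ g.1).1) _
      (fun x hx => ⟨hb x hx, (h x hx).1⟩) hB
  · exact card_le_of_determined (fun x => x.2.2) h1 h22 (fun g => (φ g.2).1) _
      (fun x hx => ⟨hc x hx, (h x hx).2⟩) hB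
  · exact card_le_of_determined (fun x => x.2.2) h1 h22 (fun g => (φ g.2).2) _
      (fun x hx => ⟨hc x hx, (h x hx).2⟩) hB
  · exact card_le_of_determined (fun x => x.2.1) h1 h21 (fun g => (φ g.1).2) _
      (fun x hx => ⟨hb x hx, (h x hx).1⟩) hB

open Classical in
theorem card_coaxialPairs_le [Infinite K] (hφ : Function.Injective φ) (hB : FewOnLines φ B M)
    {p : ℕ} (hp5 : 5 ≤ p) (hp : ∀ k : ℕ, 0 < k → k < p → (k : K) ≠ 0) :
    ((coaxialPairs φ B M).card : ℝ) ≤ 2 * (M * B.card ^ 2) +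
      ∑ r ∈ ((B ×ˢ B).image fun g => isoDist (φ g.1) (φ g.2)).erase 0,
        160000 * ((atDist φ B r).card * √(atDist φ B r).card + M * (atDist φ B r).card +
          ((atDist φ B r).card : ℝ) ^ 2 / p + M * (((atDist φ B r).card : ℝ) ^ 2 / p ^ 2)) := by
  set D : (V × V) × (V × V) → K := fun x => isoDist (φ x.1.1) (φ x.2.1) with hD
  set R := ((B ×ˢ B).image fun g => isoDist (φ g.1) (φ g.2)).erase 0 with hR
  rw [← Finset.card_filter_add_card_filter_not (fun x => D x = 0), Nat.cast_add]
  refine add_le_add ?_ ?_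
  · have hsub : (coaxialPairs φ B M).filter (fun x => D x = 0) ⊆
        (coaxialPairs φ B M).filter (fun x => (φ x.2.1).1 = (φ x.1.1).1 ∧
          (φ x.2.2).2 = (φ x.1.2).2) ∪
        (coaxialPairs φ B M).filter (fun x => (φ x.2.1).2 = (φ x.1.1).2 ∧
          (φ x.2.2).1 = (φ x.1.2).1) := by
      intro x hx
      obtain ⟨hx, hx0⟩ := Finset.mem_filter.1 hx
      obtain ⟨hk, -, hs⟩ := mem_coaxialPairs.1 hx
      obtain ⟨hu, hv⟩ := mul_ne_zero_iff.1 hk.2.2.1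
      have e1 := hs.rel_fst
      have e2 := hs.rel_snd
      simp only at hu hv e1 e2
      rw [Finset.mem_union, Finset.mem_filter, Finset.mem_filter]
      rcases mul_eq_zero.1 hx0 with h0 | h0
      · refine Or.inl ⟨hx, (sub_eq_zero.1 h0).symm, ?_⟩
        exact mul_left_cancel₀ hu (by linear_combination ((φ x.1.1).2 - (φ x.1.2).2) * h0 - e2)
      · refine Or.inr ⟨hx, (sub_eq_zero.1 h0).symm, ?_⟩
        exact mul_left_cancel₀ hv (by
          linear_combination ((φ x.1.1).1 - (φ x.1.2).1) * h0 - e1)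
    have h1 := card_coaxialPairs_eq_le hφ hB (Finset.filter_subset _ _)
      (Or.inl fun x hx => (Finset.mem_filter.1 hx).2)
    have h2 := card_coaxialPairs_eq_le hφ hB (Finset.filter_subset _ _)
      (Or.inr fun x hx => (Finset.mem_filter.1 hx).2)
    have h3 := (Finset.card_le_card hsub).trans (Finset.card_union_le _ _)
    exact_mod_cast (show _ ≤ 2 * (M * B.card ^ 2) by omega)
  · have hmaps : ∀ x ∈ (coaxialPairs φ B M).filter (fun x => ¬D x = 0), D x ∈ R := by
      intro x hx
      obtain ⟨hx, hx0⟩ := Finset.mem_filter.1 hx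
      obtain ⟨hk, hk', -⟩ := mem_coaxialPairs.1 hx
      exact Finset.mem_erase.2 ⟨hx0, Finset.mem_image.2
        ⟨(x.1.1, x.2.1), Finset.mem_product.2 ⟨hk.1, hk'.1⟩, rfl⟩⟩
    rw [Finset.card_eq_sum_card_fiberwise hmaps, Nat.cast_sum]
    refine Finset.sum_le_sum fun r hr => ?_
    have hr := Finset.ne_of_mem_erase hr
    refine le_trans ?_ (links_le_of_incident_of_card_le (injOn_pairPoint hφ hr)
      (injOn_pairPlane hφ hr) (R := Linked φ B M) (fun i _ j hj h => incident_pair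
        ((mem_atDist.1 hj).2.trans_ne hr) h.2.2)
      (fun j hj π hπ J hJ h => card_linked_incident_le hφ hB hr (mem_atDist.1 hj).2 hπ hJ h)
      hp5 hp le_rfl le_rfl)
    rw [Nat.cast_le]
    refine card_le_links (fun x => (x.1.1, x.2.1)) (fun x => (x.1.2, x.2.2)) ?_ fun x hx => ?_
    · rintro ⟨⟨b, c⟩, ⟨b', c'⟩⟩ - ⟨⟨_, _⟩, ⟨_, _⟩⟩ - ⟨⟩ ⟨⟩
      rfl
    · obtain ⟨hx, hxr⟩ := Finset.mem_filter.1 hx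
      obtain ⟨hx, hx0⟩ := Finset.mem_filter.1 hx
      have hl := mem_coaxialPairs.1 hx
      refine ⟨mem_atDist.2 ⟨⟨hl.1.1, hl.2.1.1⟩, hxr⟩, mem_atDist.2 ⟨⟨hl.1.2.1, hl.2.1.2.1⟩, ?_⟩, hl⟩
      rw [← hxr]
      exact (hl.2.2.isoDist_eq hl.1.2.2.1).symm

end QuadrupleCount

section LineIncidences

theorem sum_card_fiber_sq {α β : Type*} [DecidableEq α] [DecidableEq β] {X : Finset α}
    {T : Finset β} {f : α → β} (h : ∀ x ∈ X, f x ∈ T) :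
    ∑ w ∈ T, (X.filter (f · = w)).card ^ 2 =
      ((X ×ˢ X).filter fun x => f x.1 = f x.2).card := by
  rw [Finset.card_eq_sum_card_fiberwise (f := fun x => f x.1) (t := T)
    (fun x hx => h _ (Finset.mem_product.1 (Finset.mem_filter.1 hx).1).1)]
  refine Finset.sum_congr rfl fun w _ => ?_
  rw [sq, ← Finset.card_product]
  congr 1
  ext x
  simp only [Finset.mem_product, Finset.mem_filter]
  constructor
  · rintro ⟨⟨h1, rfl⟩, h2, h3⟩
    exact ⟨⟨⟨h1, h2⟩, h3.symm⟩, rfl⟩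
  · rintro ⟨⟨⟨h1, h2⟩, h3⟩, rfl⟩
    exact ⟨⟨h1, rfl⟩, h2, h3.symm⟩

variable {F : Type*} [Field F] [DecidableEq F]

/-- The number of points of `A` on the line `w.1 · a = w.2`. -/
def hits (A : Finset (F × F)) (w : (F × F) × F) : ℕ := (A.filter fun a => dot w.1 a = w.2).card

theorem hits_smul (A : Finset (F × F)) {c : F} (hc : c ≠ 0) (w : (F × F) × F) :
    hits A (c • w) = hits A w := by
  rw [hits, hits]
  congr 1
  refine Finset.filter_congr fun a _ => ?_
  have h : dot (c • w).1 a = c * dot w.1 a := by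
    simp only [dot, Prod.smul_fst, Prod.smul_snd, smul_eq_mul]
    ring
  rw [h, Prod.smul_snd, smul_eq_mul]
  exact mul_right_inj' hc

variable [Fintype F]

theorem card_filter_dot_le {x : F × F} (hx : x ≠ 0) :
    (((Finset.univ : Finset (F × F)).erase 0).filter fun m => dot m x = 0).card ≤
      Fintype.card F - 1 := by
  rw [← Finset.card_univ, ← Finset.card_erase_of_mem (Finset.mem_univ (0 : F))]
  by_cases h1 : x.1 = 0
  · have h2 : x.2 ≠ 0 := fun h2 => hx (Prod.ext h1 h2)
    have key : ∀ m : F × F, dot m x = 0 → m.2 = 0 := fun m hm => by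
      simp only [dot, h1, mul_zero, zero_add] at hm
      exact (mul_eq_zero.1 hm).resolve_right h2
    refine Finset.card_le_card_of_injOn Prod.fst (fun m hm => ?_) fun m hm m' hm' h => ?_
    · obtain ⟨hm, hm0⟩ := Finset.mem_filter.1 hm
      refine Finset.mem_erase.2 ⟨fun h => Finset.ne_of_mem_erase hm ?_, Finset.mem_univ _⟩
      exact Prod.ext h (key m hm0)
    · exact Prod.ext h ((key m (Finset.mem_filter.1 hm).2).trans
        (key m' (Finset.mem_filter.1 hm').2).symm)
  · have key : ∀ m m' : F × F, dot m x = 0 → dot m' x = 0 → m.2 = m'.2 → m = m' := by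
      intro m m' hm hm' h
      simp only [dot] at hm hm'
      exact Prod.ext (mul_right_cancel₀ h1 (by linear_combination hm - hm' - x.2 * h)) h
    refine Finset.card_le_card_of_injOn Prod.snd (fun m hm => ?_) fun m hm m' hm' h => ?_
    · obtain ⟨hm, hm0⟩ := Finset.mem_filter.1 hm
      refine Finset.mem_erase.2 ⟨fun h => Finset.ne_of_mem_erase hm ?_, Finset.mem_univ _⟩
      exact key m 0 hm0 (by simp [dot]) h
    · exact key m m' (Finset.mem_filter.1 hm).2 (Finset.mem_filter.1 hm').2 h

theorem sum_hits (A : Finset (F × F)) (m : F × F) : ∑ s, hits A (m, s) = A.card := by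
  simp only [hits]
  exact (Finset.card_eq_sum_card_fiberwise (f := dot m) fun _ _ => Finset.mem_univ _).symm

theorem sum_hits_sq_le (A : Finset (F × F)) :
    ∑ m ∈ (Finset.univ : Finset (F × F)).erase 0, ∑ s, hits A (m, s) ^ 2 ≤
      A.card * (Fintype.card F ^ 2 - 1) + A.card * ((A.card - 1) * (Fintype.card F - 1)) := by
  have h1 : ∀ m : F × F, ∑ s, hits A (m, s) ^ 2 =
      ∑ x ∈ A ×ˢ A, if dot m (x.1 - x.2) = 0 then 1 else 0 := by
    intro m
    rw [← Finset.card_filter]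
    simp only [hits]
    rw [sum_card_fiber_sq fun _ _ => Finset.mem_univ _]
    congr 1
    refine Finset.filter_congr fun x _ => ?_
    rw [← sub_eq_zero]
    simp only [dot, Prod.fst_sub, Prod.snd_sub]
    ring_nf
  simp only [h1]
  rw [Finset.sum_comm, Finset.sum_product, ← mul_add, ← smul_eq_mul]
  refine Finset.sum_le_card_nsmul _ _ _ fun a ha => ?_
  rw [← Finset.add_sum_erase _ _ ha]
  refine add_le_add ?_ ?_
  · simp [dot, Finset.card_univ, sq]
  · rw [← Finset.card_erase_of_mem ha, ← smul_eq_mul]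
    refine Finset.sum_le_card_nsmul _ _ _ fun b hb => ?_
    rw [← Finset.card_filter]
    exact card_filter_dot_le (sub_ne_zero.2 (Finset.ne_of_mem_erase hb).symm)

theorem sum_hits_sub_sq_le (A : Finset (F × F)) :
    ∑ m ∈ (Finset.univ : Finset (F × F)).erase 0,
      ∑ s, ((hits A (m, s) : ℝ) - A.card / Fintype.card F) ^ 2 ≤
      (Fintype.card F - 1) * (Fintype.card F * A.card) := by
  rcases A.eq_empty_or_nonempty with rfl | hA
  · simp [hits]
  set q := Fintype.card F with hq
  have hq1 : 1 ≤ q := Fintype.card_pos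
  have hA1 : 1 ≤ A.card := hA.card_pos
  have h1 : ∀ m : F × F, ∑ s, ((hits A (m, s) : ℝ) - A.card / q) ^ 2 =
      ∑ s, (hits A (m, s) : ℝ) ^ 2 - (A.card : ℝ) ^ 2 / q := by
    intro m
    have h2 : ∑ s, (hits A (m, s) : ℝ) = A.card := by exact_mod_cast sum_hits A m
    simp only [sub_sq]
    rw [Finset.sum_add_distrib, Finset.sum_sub_distrib, Finset.sum_const, Finset.card_univ, ← hq,
      ← Finset.sum_mul, ← Finset.mul_sum, h2, nsmul_eq_mul]
    have : (q : ℝ) ≠ 0 := by positivity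
    field_simp
    ring
  have h2 : (∑ m ∈ (Finset.univ : Finset (F × F)).erase 0, ∑ s, (hits A (m, s) : ℝ) ^ 2) ≤
      A.card * ((q : ℝ) ^ 2 - 1) + A.card * ((A.card - 1) * (q - 1)) := by
    have := sum_hits_sq_le A
    rw [← hq] at this
    have h3 := (Nat.cast_le (α := ℝ)).2 this
    have : 1 ≤ q ^ 2 := Nat.one_le_pow _ _ hq1
    push_cast [Nat.cast_sub this, Nat.cast_sub hq1, Nat.cast_sub hA1] at h3
    exact h3
  simp only [h1]
  rw [Finset.sum_sub_distrib, Finset.sum_const, Finset.card_erase_of_mem (Finset.mem_univ _),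
    Finset.card_univ, Fintype.card_prod, ← hq, nsmul_eq_mul,
    Nat.cast_sub (Nat.mul_le_mul hq1 hq1)]
  have hq1' : (1 : ℝ) ≤ q := by exact_mod_cast hq1
  have hq0 : (0 : ℝ) < q := by linarith
  have h3 : ((q * q : ℕ) - (1 * 1 : ℕ) : ℝ) * ((A.card : ℝ) ^ 2 / q) =
      (q - 1) * ((A.card : ℝ) ^ 2 + (A.card : ℝ) ^ 2 / q) := by
    push_cast
    field_simp
    ring
  have h4 : 0 ≤ ((q : ℝ) - 1) * ((A.card : ℝ) ^ 2 / q) :=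
    mul_nonneg (by linarith) (by positivity)
  rw [h3]
  nlinarith

open Classical in
theorem sum_hits_le {γ : Type*} (A : Finset (F × F)) (G : Finset γ) (v : γ → (F × F) × F)
    (hv : ∀ g ∈ G, (v g).1 ≠ 0) :
    ∑ g ∈ G, (hits A (v g) : ℝ) ≤ G.card * A.card / Fintype.card F +
      √(Fintype.card F * A.card *
        ((G ×ˢ G).filter fun x => ∃ c : F, c ≠ 0 ∧ v x.2 = c • v x.1).card) := by
  set q := Fintype.card F with hq
  set Q := (G ×ˢ G).filter fun x => ∃ c : F, c ≠ 0 ∧ v x.2 = c • v x.1 with hQ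
  set U := (Finset.univ : Finset F).erase 0 with hU
  set T := (Finset.univ : Finset (F × F)).erase 0 ×ˢ (Finset.univ : Finset F) with hT
  let D : (F × F) × F → ℝ := fun w => hits A w - A.card / q
  let f : γ × F → (F × F) × F := fun x => x.2 • v x.1
  have hUq : (U.card : ℝ) = q - 1 := by
    rw [hU, Finset.card_erase_of_mem (Finset.mem_univ _), Finset.card_univ, ← hq,
      Nat.cast_sub Fintype.card_pos, Nat.cast_one]
  have hq1 : (0 : ℝ) < q - 1 := by
    have := Fintype.one_lt_card (α := F)
    rw [← hq] at this
    have : (1 : ℝ) < q := by exact_mod_cast this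
    linarith
  have hmem : ∀ x ∈ G ×ˢ U, f x ∈ T := by
    intro x hx
    obtain ⟨h1, h2⟩ := Finset.mem_product.1 hx
    refine Finset.mem_product.2 ⟨Finset.mem_erase.2 ⟨?_, Finset.mem_univ _⟩, Finset.mem_univ _⟩
    exact smul_ne_zero (Finset.ne_of_mem_erase h2) (hv _ h1)
  have e1 : (q - 1) * ∑ g ∈ G, D (v g) =
      ∑ w ∈ T, (((G ×ˢ U).filter (f · = w)).card : ℝ) * D w := by
    have h1 : ∑ x ∈ G ×ˢ U, D (f x) = (q - 1) * ∑ g ∈ G, D (v g) := by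
      rw [Finset.sum_product, Finset.mul_sum]
      refine Finset.sum_congr rfl fun g _ => ?_
      rw [← hUq, ← nsmul_eq_mul, ← Finset.sum_const]
      refine Finset.sum_congr rfl fun c hc => ?_
      simp only [D, f, hits_smul A (Finset.ne_of_mem_erase hc)]
    rw [← h1, ← Finset.sum_fiberwise_of_maps_to hmem]
    refine Finset.sum_congr rfl fun w _ => ?_
    rw [← nsmul_eq_mul, ← Finset.sum_const]
    exact Finset.sum_congr rfl fun x hx => by rw [(Finset.mem_filter.1 hx).2]
  have e2 : ∑ w ∈ T, (((G ×ˢ U).filter (f · = w)).card : ℝ) ^ 2 ≤ (q - 1) * Q.card := by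
    have h1 : ∑ w ∈ T, ((G ×ˢ U).filter (f · = w)).card ^ 2 ≤ (U ×ˢ Q).card := by
      rw [sum_card_fiber_sq hmem]
      refine Finset.card_le_card_of_injOn (fun x => (x.1.2, (x.1.1, x.2.1))) (fun x hx => ?_)
        fun x hx y hy hxy => ?_
      · obtain ⟨hx, hf⟩ := Finset.mem_filter.1 hx
        obtain ⟨⟨h1, h2⟩, h3, h4⟩ := And.imp Finset.mem_product.1 Finset.mem_product.1
          (Finset.mem_product.1 hx)
        have h5 := Finset.ne_of_mem_erase h2
        have h6 := Finset.ne_of_mem_erase h4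
        refine Finset.mem_product.2 ⟨h2, Finset.mem_filter.2 ⟨Finset.mem_product.2 ⟨h1, h3⟩,
          x.2.2⁻¹ * x.1.2, mul_ne_zero (inv_ne_zero h6) h5, ?_⟩⟩
        rw [mul_smul]
        exact (eq_inv_smul_iff₀ h6).2 hf.symm
      · obtain ⟨hx, hf⟩ := Finset.mem_filter.1 hx
        obtain ⟨hy, hf'⟩ := Finset.mem_filter.1 hy
        obtain ⟨⟨g, c⟩, ⟨g', c'⟩⟩ := x
        obtain ⟨⟨g₁, c₁⟩, ⟨g₁', c₁'⟩⟩ := y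
        simp only [Prod.mk.injEq] at hxy
        obtain ⟨rfl, rfl, rfl⟩ := hxy
        have h3 := (Finset.mem_product.1 (Finset.mem_product.1 hx).2).1
        have h4 : c' • v g' = c₁' • v g' := hf.symm.trans hf'
        have h5 : v g' ≠ 0 := fun h0 => hv _ h3 (by rw [h0]; rfl)
        rw [smul_left_injective F h5 h4]
    rw [Finset.card_product] at h1
    rw [← hUq]
    exact_mod_cast h1
  have e3 : ∑ w ∈ T, D w ^ 2 ≤ (q - 1) * (q * A.card) := by
    rw [hT, Finset.sum_product]
    exact sum_hits_sub_sq_le A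
  have e4 : ((q - 1) * ∑ g ∈ G, D (v g)) ^ 2 ≤ ((q - 1) * √(q * A.card * Q.card)) ^ 2 := by
    rw [e1, mul_pow, Real.sq_sqrt (by positivity)]
    refine (Finset.sum_mul_sq_le_sq_mul_sq _ _ _).trans ?_
    refine (mul_le_mul e2 e3 (Finset.sum_nonneg fun _ _ => sq_nonneg _)
      (mul_nonneg hq1.le (Nat.cast_nonneg _))).trans (le_of_eq ?_)
    ring
  have e5 := abs_le_of_sq_le_sq e4 (mul_nonneg hq1.le (Real.sqrt_nonneg _))
  have e6 := le_of_mul_le_mul_left ((le_abs_self _).trans e5) hq1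
  simp only [D, Finset.sum_sub_distrib, Finset.sum_const, nsmul_eq_mul] at e6
  rw [← mul_div_assoc] at e6
  linarith

end LineIncidences

section Numerics

theorem le_of_self_bound {P N X τ : ℝ} (hP : 1 ≤ P) (h1 : P ^ 2 ≤ N) (h2 : N ^ 3 ≤ P ^ 8)
    (hX0 : 0 ≤ X) (hτ : τ ≤ 2 * (N ^ 18 / P ^ 12) + X)
    (hX : X ≤ 44 * N ^ 12 +
      4000 * √(P ^ 12 * N ^ 12 * √(N ^ 6 * τ) + P ^ 12 * N ^ 21 + N ^ 12 * τ)) :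
    X + 6 * N ^ 12 ≤ 200000000 * (P ^ 8 * N ^ 10 + P ^ 3 * N ^ 12) := by
  have hP0 : 0 < P := by linarith
  have hPN : P ≤ N := by nlinarith
  have hN1 : 1 ≤ N := hP.trans hPN
  have hN0 : 0 < N := by linarith
  set a := P ^ 8 * N ^ 10 with ha
  set b := P ^ 3 * N ^ 12 with hb
  have ha0 : 0 < a := by positivity
  have hb0 : 0 < b := by positivity
  obtain ⟨Y, hY⟩ : ∃ Y, Y = a + b := ⟨_, rfl⟩
  rw [← hY]
  have hN12 : N ^ 12 ≤ b := le_mul_of_one_le_left (by positivity) (one_le_pow₀ hP)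
  have hY0 : 0 < Y := by linarith
  have hYN : N ^ 12 ≤ Y := by linarith
  rcases le_total X Y with hXY | hXY
  · linarith
  have c1 : P ^ 12 * N ^ 21 ≤ X * Y := by
    have : P ^ 12 * N ^ 21 ≤ a * b := by
      rw [ha, hb]
      calc P ^ 12 * N ^ 21 = P * (P ^ 11 * N ^ 21) := by ring
        _ ≤ N * (P ^ 11 * N ^ 21) := mul_le_mul_of_nonneg_right hPN (by positivity)
        _ = _ := by ring
    have : a * b ≤ X * Y := mul_le_mul (by linarith) (by linarith) hb0.le hX0
    linarith
  have c2 : P ^ 6 * N ^ 24 ≤ X * Y := by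
    calc P ^ 6 * N ^ 24 = b * b := by rw [hb]; ring
      _ ≤ X * Y := mul_le_mul (by linarith) (by linarith) hb0.le hX0
  have c3 : N ^ 12 * (N ^ 18 / P ^ 12) ≤ X * Y := by
    refine le_trans ?_ c2
    rw [← mul_div_assoc, div_le_iff₀ (by positivity)]
    calc N ^ 12 * N ^ 18 = N ^ 3 * N ^ 3 * N ^ 24 := by ring
      _ ≤ P ^ 8 * P ^ 8 * N ^ 24 := by gcongr
      _ = P ^ 16 * 1 * N ^ 24 := by ring
      _ ≤ P ^ 16 * P ^ 2 * N ^ 24 := by gcongr; exact one_le_pow₀ hP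
      _ = _ := by ring
  have c4 : √(N ^ 6 * τ) ≤ 2 * (N ^ 12 / P ^ 6) + N ^ 3 * √X := by
    rw [Real.sqrt_le_left (by positivity)]
    have e1 : (N ^ 12 / P ^ 6) ^ 2 = N ^ 6 * (N ^ 18 / P ^ 12) := by field_simp
    have e2 : (N ^ 3 * √X) ^ 2 = N ^ 6 * X := by rw [mul_pow, Real.sq_sqrt hX0]; ring
    have e3 := mul_le_mul_of_nonneg_left hτ (by positivity : 0 ≤ N ^ 6)
    have e4 : 0 ≤ (N ^ 12 / P ^ 6) * (N ^ 3 * √X) := by positivity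
    nlinarith [sq_nonneg (N ^ 12 / P ^ 6)]
  have c5 : P ^ 12 * N ^ 15 * √X ≤ X * Y := by
    refine abs_le_of_sq_le_sq' ?_ (by positivity) |>.2
    calc (P ^ 12 * N ^ 15 * √X) ^ 2 = a * a * a * X := by
          rw [mul_pow, Real.sq_sqrt hX0, ha]; ring
      _ ≤ X * Y * Y * X := by
          have haY : a ≤ Y := by linarith
          have haX : a ≤ X := by linarith
          gcongr
      _ = _ := by ring
  have c6 : P ^ 12 * N ^ 12 * √(N ^ 6 * τ) ≤ 3 * (X * Y) := by
    have e1 := mul_le_mul_of_nonneg_left c4 (by positivity : 0 ≤ P ^ 12 * N ^ 12)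
    have e2 : P ^ 12 * N ^ 12 * (2 * (N ^ 12 / P ^ 6) + N ^ 3 * √X) =
        2 * (P ^ 6 * N ^ 24) + P ^ 12 * N ^ 15 * √X := by
      field_simp
    rw [e2] at e1
    linarith
  have c7 : N ^ 12 * τ ≤ 3 * (X * Y) := by
    have e1 := mul_le_mul_of_nonneg_left hτ (by positivity : 0 ≤ N ^ 12)
    have e2 := mul_le_mul_of_nonneg_left hYN hX0
    linarith
  have c8 : √(P ^ 12 * N ^ 12 * √(N ^ 6 * τ) + P ^ 12 * N ^ 21 + N ^ 12 * τ) ≤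
      X / 8000 + 14000 * Y := by
    rw [Real.sqrt_le_left (by positivity)]
    nlinarith [sq_nonneg (X / 8000 - 14000 * Y), mul_nonneg hX0 hY0.le]
  linarith

theorem le_of_self_bound_rpow {p n X τ : ℝ} (hp : 1 ≤ p) (h1 : p ≤ n) (h2 : n ≤ p ^ ((4 : ℝ) / 3))
    (hX0 : 0 ≤ X) (hτ : τ ≤ 2 * (n ^ 3 / p) + X)
    (hX : X ≤ 44 * n ^ 2 +
      4000 * √(p * n ^ 2 * √(n * τ) + p * (n ^ 3 * √n) + n ^ 2 * τ)) :
    X + 6 * n ^ 2 ≤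
      200000000 * (p ^ ((2 : ℝ) / 3) * n ^ ((5 : ℝ) / 3) + p ^ ((1 : ℝ) / 4) * n ^ 2) := by
  have hp0 : 0 < p := by linarith
  have hn0 : 0 < n := by linarith
  obtain ⟨P, hP⟩ : ∃ P, P = p ^ ((1 : ℝ) / 12) := ⟨_, rfl⟩
  obtain ⟨N, hN⟩ : ∃ N, N = n ^ ((1 : ℝ) / 6) := ⟨_, rfl⟩
  have hP0 : 0 < P := hP ▸ Real.rpow_pos_of_pos hp0 _
  have hN0 : 0 < N := hN ▸ Real.rpow_pos_of_pos hn0 _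
  have hPk : ∀ k : ℕ, P ^ k = p ^ ((k : ℝ) / 12) := fun k => by
    rw [hP, ← Real.rpow_mul_natCast hp0.le]
    ring_nf
  have hNk : ∀ k : ℕ, N ^ k = n ^ ((k : ℝ) / 6) := fun k => by
    rw [hN, ← Real.rpow_mul_natCast hn0.le]
    ring_nf
  have ep : p = P ^ 12 := by rw [hPk]; norm_num
  have en : n = N ^ 6 := by rw [hNk]; norm_num
  have e1 : p ^ ((2 : ℝ) / 3) = P ^ 8 := by rw [hPk]; norm_num
  have e2 : p ^ ((1 : ℝ) / 4) = P ^ 3 := by rw [hPk]; norm_num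
  have e3 : p ^ ((4 : ℝ) / 3) = P ^ 16 := by rw [hPk]; norm_num
  have e4 : n ^ ((5 : ℝ) / 3) = N ^ 10 := by rw [hNk]; norm_num
  have e5 : √n = N ^ 3 := by
    rw [en, show N ^ 6 = (N ^ 3) ^ 2 by ring, Real.sqrt_sq (by positivity)]
  rw [e3] at h2
  rw [e5] at hX
  rw [e1, e2, e4]
  rw [ep] at hp h1 hτ hX
  rw [en] at h1 h2 hτ hX ⊢
  simp only [← pow_mul] at hτ hX ⊢
  refine le_of_self_bound (τ := τ) ?_ ?_ ?_ hX0 hτ (hX.trans_eq ?_)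
  · exact (one_le_pow_iff_of_nonneg hP0.le (by norm_num)).1 hp
  · refine (pow_le_pow_iff_left₀ (by positivity) hN0.le (by norm_num : 6 ≠ 0)).1 ?_
    rwa [← pow_mul]
  · refine (pow_le_pow_iff_left₀ (by positivity) (by positivity) (by norm_num : 2 ≠ 0)).1 ?_
    rwa [← pow_mul, ← pow_mul]
  · rw [← pow_add]

end Numerics

section Energy

variable {K V : Type*} [Field K] {φ : V → K × K} {A B : Finset V} {M : ℕ}

open Classical in
theorem sum_card_atDist_le (R : Finset K) : ∑ r ∈ R, (atDist φ B r).card ≤ B.card ^ 2 := by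
  rw [sq, ← Finset.card_product]
  simp only [atDist]
  rw [← Finset.card_biUnion]
  · exact Finset.card_le_card (Finset.biUnion_subset.2 fun r _ => Finset.filter_subset _ _)
  · intro r _ r' _ hne
    exact Finset.disjoint_filter.2 fun x _ h h' => hne (h.symm.trans h')

open Classical in
theorem sum_card_atDist_sq_le {R : Finset K} (hR : 0 ∉ R) :
    ∑ r ∈ R, (atDist φ A r).card ^ 2 ≤ A.card * ∑ a ∈ A, (legs φ A a).card := by
  have h1 : ∀ r, (atDist φ A r).card =
      ∑ a ∈ A, (A.filter fun b => isoDist (φ a) (φ b) = r).card := by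
    intro r
    rw [atDist, Finset.card_filter, Finset.sum_product]
    exact Finset.sum_congr rfl fun a _ => (Finset.card_filter _ _).symm
  calc _ ≤ ∑ r ∈ R, A.card * ∑ a ∈ A, (A.filter fun b => isoDist (φ a) (φ b) = r).card ^ 2 := by
        refine Finset.sum_le_sum fun r _ => ?_
        rw [h1]
        exact sq_sum_le_card_mul_sum_sq
    _ = A.card * ∑ a ∈ A, ∑ r ∈ R, (A.filter fun b => isoDist (φ a) (φ b) = r).card ^ 2 := by
        rw [← Finset.mul_sum, Finset.sum_comm]
    _ ≤ _ := by
        refine Nat.mul_le_mul_left _ (Finset.sum_le_sum fun a _ => ?_)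
        calc _ = ∑ r ∈ R, ((A.filter fun b => isoDist (φ a) (φ b) ∈ R).filter
                  fun b => isoDist (φ a) (φ b) = r).card ^ 2 := by
              refine Finset.sum_congr rfl fun r hr => ?_
              rw [Finset.filter_filter]
              congr 2
              refine Finset.filter_congr fun b _ => ⟨fun h => ⟨h ▸ hr, h⟩, fun h => h.2⟩
          _ ≤ _ := by
              rw [sum_card_fiber_sq (f := fun b => isoDist (φ a) (φ b))
                fun b hb => (Finset.mem_filter.1 hb).2]
              refine Finset.card_le_card fun g hg => ?_
              obtain ⟨hg, hd⟩ := Finset.mem_filter.1 hg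
              obtain ⟨h1, h2⟩ := Finset.mem_product.1 hg
              obtain ⟨h1, h_mem⟩ := Finset.mem_filter.1 h1
              exact mem_legs.2 ⟨⟨h1, (Finset.mem_filter.1 h2).1⟩, hd,
                fun h0 => hR (h0 ▸ h_mem)⟩

/-- The number of pairs of kept pairs with the same bisector, in terms of the number `τ` of
isosceles triangles. -/
theorem card_coaxialPairs_le_energy [Infinite K] (hφ : Function.Injective φ)
    (hB : FewOnLines φ B M) (hBA : B ⊆ A) {p : ℕ} (hp5 : 5 ≤ p)
    (hp : ∀ k : ℕ, 0 < k → k < p → (k : K) ≠ 0) (hA : A.card ≤ p ^ 2)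
    (hM : (M : ℝ) ≤ 3 * √A.card) {τ : ℝ} (hτ : τ = ∑ a ∈ A, ((legs φ A a).card : ℝ)) :
    ((coaxialPairs φ B M).card : ℝ) ≤ 1000000 * (A.card * √(A.card * τ) +
      (A.card : ℝ) ^ 2 * √A.card + A.card * τ / p) := by
  classical
  refine (card_coaxialPairs_le hφ hB hp5 hp).trans ?_
  set R := ((B ×ˢ B).image fun g => isoDist (φ g.1) (φ g.2)).erase 0
  set n : ℝ := (A.card : ℝ) with hn
  set k : K → ℝ := fun r => (atDist φ B r).card with hk
  have hp0 : (0 : ℝ) < p := by exact_mod_cast (by omega : 0 < p)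
  have hn0 : 0 ≤ n := Nat.cast_nonneg _
  have hτ0 : 0 ≤ τ := hτ ▸ Finset.sum_nonneg fun _ _ => Nat.cast_nonneg _
  have hm : (B.card : ℝ) ≤ n := Nat.cast_le.2 (Finset.card_le_card hBA)
  have hsn : √n ≤ p := by
    rw [Real.sqrt_le_left hp0.le, hn]
    exact_mod_cast hA
  have hk0 : ∀ r, 0 ≤ k r := fun r => Nat.cast_nonneg _
  have s1 : ∑ r ∈ R, k r ≤ n ^ 2 := by
    refine le_trans ?_ (pow_le_pow_left₀ (Nat.cast_nonneg _) hm 2)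
    simp only [hk]
    exact_mod_cast sum_card_atDist_le R
  have s2 : ∑ r ∈ R, k r ^ 2 ≤ n * τ := by
    have h1 : ∑ r ∈ R, (atDist φ B r).card ^ 2 ≤ ∑ r ∈ R, (atDist φ A r).card ^ 2 := by
      refine Finset.sum_le_sum fun r _ => Nat.pow_le_pow_left (Finset.card_le_card fun g hg => ?_) 2
      obtain ⟨⟨h1, h2⟩, h3⟩ := mem_atDist.1 hg
      exact mem_atDist.2 ⟨⟨hBA h1, hBA h2⟩, h3⟩
    simp only [hn, hτ, hk]
    exact_mod_cast h1.trans (sum_card_atDist_sq_le (Finset.notMem_erase _ _))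
  have s3 : ∑ r ∈ R, k r * √(k r) ≤ n * √(n * τ) := by
    refine abs_le_of_sq_le_sq' ?_ (by positivity) |>.2
    refine (Finset.sum_mul_sq_le_sq_mul_sq _ _ _).trans ?_
    rw [mul_pow, Real.sq_sqrt (by positivity), mul_comm]
    simp only [Real.sq_sqrt (hk0 _)]
    exact mul_le_mul s1 s2 (Finset.sum_nonneg fun _ _ => sq_nonneg _) (by positivity)
  have key : ∀ r ∈ R, 160000 * (k r * √(k r) + M * k r + k r ^ 2 / p + M * (k r ^ 2 / p ^ 2)) ≤
      160000 * (k r * √(k r)) + 480000 * √n * k r + 640000 / p * k r ^ 2 := by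
    intro r _
    have h1 := mul_le_mul_of_nonneg_right hM (hk0 r)
    have h2 : M * (k r ^ 2 / p ^ 2) ≤ 3 * (k r ^ 2 / p) := by
      calc M * (k r ^ 2 / p ^ 2) ≤ 3 * p * (k r ^ 2 / p ^ 2) := by gcongr; linarith
        _ = _ := by field_simp
    have h3 : 640000 / p * k r ^ 2 = 640000 * (k r ^ 2 / p) := by ring
    rw [h3]
    linarith
  refine (add_le_add_right (Finset.sum_le_sum key) _).trans ?_
  rw [Finset.sum_add_distrib, Finset.sum_add_distrib, ← Finset.mul_sum, ← Finset.mul_sum,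
    ← Finset.mul_sum]
  have t1 : M * (B.card : ℝ) ^ 2 ≤ 3 * √n * n ^ 2 := by gcongr
  have t2 := mul_le_mul_of_nonneg_left s1 (by positivity : 0 ≤ 480000 * √n)
  have t3 := mul_le_mul_of_nonneg_left s2 (by positivity : 0 ≤ 640000 / (p : ℝ))
  have t4 : 640000 / (p : ℝ) * (n * τ) = 640000 * (n * τ / p) := by ring
  have t5 : 0 ≤ n * τ / p := by positivity
  have t6 : 0 ≤ n * √(n * τ) := by positivity
  have t7 : 0 ≤ n ^ 2 * √n := by positivity
  linarith

end Energy

section Isotropic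

variable {F K : Type*} [Field F] [Field K] [Algebra F K]

/-- The isotropic coordinates of a point, with respect to a square root `i` of `-1`. -/
def iso (i : K) (x : F × F) : K × K :=
  (algebraMap F K x.1 + i * algebraMap F K x.2, algebraMap F K x.1 - i * algebraMap F K x.2)

variable {i : K}

theorem isoDist_iso (hi : i ^ 2 = -1) (a b : F × F) :
    isoDist (iso i a) (iso i b) = algebraMap F K (dist2 a b) := by
  simp only [isoDist, iso, dist2, map_add, map_sub, map_pow]
  linear_combination -(algebraMap F K a.2 - algebraMap F K b.2) ^ 2 * hi

theorem isoDist_iso_eq_iff (hi : i ^ 2 = -1) (a b c d : F × F) :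
    isoDist (iso i a) (iso i b) = isoDist (iso i c) (iso i d) ↔ dist2 a b = dist2 c d := by
  rw [isoDist_iso hi, isoDist_iso hi]
  exact (algebraMap F K).injective.eq_iff

theorem isoDist_iso_eq_zero_iff (hi : i ^ 2 = -1) (a b : F × F) :
    isoDist (iso i a) (iso i b) = 0 ↔ dist2 a b = 0 := by
  rw [isoDist_iso hi]
  exact map_eq_zero _

theorem iso_injective (hi : i ^ 2 = -1) (h2 : (2 : F) ≠ 0) :
    Function.Injective (iso i : F × F → K × K) := by
  intro x y h
  simp only [iso, Prod.mk.injEq] at h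
  have h2' : (2 : K) ≠ 0 := by
    rw [← map_ofNat (algebraMap F K) 2]
    exact (map_ne_zero _).2 h2
  have hi0 : i ≠ 0 := by
    rintro rfl
    norm_num at hi
  refine Prod.ext ((algebraMap F K).injective ?_) ((algebraMap F K).injective ?_)
  · exact mul_left_cancel₀ h2' (by linear_combination h.1 + h.2)
  · exact mul_left_cancel₀ (mul_ne_zero h2' hi0) (by linear_combination h.1 - h.2)

theorem eq_of_iso_fst {x y : F × F} (h : (iso i x).1 = (iso i y).1) (h2 : x.2 = y.2) : x = y := by
  simp only [iso, h2] at h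
  exact Prod.ext ((algebraMap F K).injective (add_right_cancel h)) h2

theorem eq_of_iso_snd {x y : F × F} (h : (iso i x).2 = (iso i y).2) (h2 : x.2 = y.2) : x = y := by
  simp only [iso, h2] at h
  exact Prod.ext ((algebraMap F K).injective (sub_left_injective h)) h2

theorem eq_of_isoDist_eq {x y z : K × K} (h : isoDist x y = isoDist x z) (hx : isoDist x y ≠ 0)
    (hyz : isoDist y z = 0) : y = z := by
  obtain ⟨hu, hv⟩ := mul_ne_zero_iff.1 hx
  simp only [isoDist] at h
  rcases mul_eq_zero.1 hyz with h0 | h0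
  · refine Prod.ext (sub_eq_zero.1 h0) (mul_left_cancel₀ hu ?_)
    linear_combination -h - (x.2 - z.2) * h0
  · refine Prod.ext (mul_left_cancel₀ hv ?_) (sub_eq_zero.1 h0)
    linear_combination -h - (x.1 - z.1) * h0

/-- The coefficients of the bisector of a pair of points. -/
def bisector (g : (F × F) × (F × F)) : (F × F) × F :=
  ((2 * (g.2.1 - g.1.1), 2 * (g.2.2 - g.1.2)), g.2.1 ^ 2 + g.2.2 ^ 2 - (g.1.1 ^ 2 + g.1.2 ^ 2))

theorem dot_bisector_eq_iff (a : F × F) (g : (F × F) × (F × F)) :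
    dot (bisector g).1 a = (bisector g).2 ↔ dist2 a g.1 = dist2 a g.2 := by
  rw [← sub_eq_zero, ← sub_eq_zero (a := dist2 a g.1)]
  simp only [dot, bisector, dist2]
  ring_nf

theorem bisector_fst_ne_zero (h2 : (2 : F) ≠ 0) {g : (F × F) × (F × F)} (hg : g.1 ≠ g.2) :
    (bisector g).1 ≠ 0 := by
  intro h
  simp only [bisector, Prod.mk_eq_zero, mul_eq_zero, h2, false_or, sub_eq_zero] at h
  exact hg (Prod.ext h.1.symm h.2.symm)

theorem sameAxis_of_bisector (hi : i ^ 2 = -1) (h2 : (2 : F) ≠ 0) {g g' : (F × F) × (F × F)}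
    {c : F} (hc : c ≠ 0) (h : bisector g' = c • bisector g) :
    SameAxis (iso i g.1) (iso i g.2) (iso i g'.1) (iso i g'.2) := by
  simp only [bisector, Prod.smul_mk, smul_eq_mul, Prod.mk.injEq] at h
  obtain ⟨⟨e1, e2⟩, e3⟩ := h
  have e1 : g'.2.1 - g'.1.1 = c * (g.2.1 - g.1.1) :=
    mul_left_cancel₀ h2 (by linear_combination e1)
  have e2 : g'.2.2 - g'.1.2 = c * (g.2.2 - g.1.2) :=
    mul_left_cancel₀ h2 (by linear_combination e2)
  have e1 := congr_arg (algebraMap F K) e1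
  have e2 := congr_arg (algebraMap F K) e2
  have e3 := congr_arg (algebraMap F K) e3
  simp only [map_sub, map_mul, map_add, map_pow] at e1 e2 e3
  refine ⟨algebraMap F K c, (map_ne_zero _).2 hc, ?_, ?_, ?_⟩
  · simp only [iso]
    linear_combination e1 + i * e2
  · simp only [iso]
    linear_combination e1 - i * e2
  · simp only [iso]
    linear_combination -e3 + (-(algebraMap F K g'.1.2) ^ 2 + (algebraMap F K g'.2.2) ^ 2 -
      algebraMap F K c * (-(algebraMap F K g.1.2) ^ 2 + (algebraMap F K g.2.2) ^ 2)) * hi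

end Isotropic

section Counting

variable {F K : Type*} [Field F] [Field K] [Algebra F K] {i : K}
  {A B : Finset (F × F)}

theorem Tstar_bounds (hi : i ^ 2 = -1) (h2 : (2 : F) ≠ 0) :
    Tstar A ≤ ∑ a ∈ A, (legs (iso i) A a).card + 2 * A.card ^ 2 ∧
      ∑ a ∈ A, (legs (iso i) A a).card ≤ Tstar A + A.card ^ 2 := by
  classical
  have hdot : ∀ b c : F × F, dot (b - c) (b - c) = dist2 b c := fun b c => by
    simp only [dot, dist2, Prod.fst_sub, Prod.snd_sub]
    ring
  set S := (A ×ˢ (A ×ˢ A)).filter fun t => dist2 t.1 t.2.1 = dist2 t.1 t.2.2 ∧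
    dist2 t.2.1 t.2.2 ≠ 0 with hS
  set S' := (A ×ˢ (A ×ˢ A)).filter fun t => dist2 t.1 t.2.1 = dist2 t.1 t.2.2 ∧
    dist2 t.1 t.2.1 ≠ 0 with hS'
  have e1 : Tstar A = S.card := by
    rw [Tstar, ← Set.ncard_coe_finset]
    congr 1
    ext t
    simp only [hS, hdot, Finset.coe_filter, Finset.mem_product, Set.mem_ofPred_eq]
    tauto
  have e2 : ∑ a ∈ A, (legs (iso i) A a).card = S'.card := by
    rw [hS', Finset.card_filter, Finset.sum_product]
    refine Finset.sum_congr rfl fun a _ => ?_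
    rw [← Finset.card_filter, legs]
    congr 1
    refine Finset.filter_congr fun g _ => ?_
    rw [isoDist_iso_eq_iff hi, Ne, isoDist_iso_eq_zero_iff hi]
  rw [e1, e2]
  constructor
  · have hsub : S ⊆ S' ∪ (S.filter (fun t => (iso i t.1).1 = (iso i t.2.1).1 ∧
        (iso i t.1).2 = (iso i t.2.2).2) ∪ S.filter (fun t =>
        (iso i t.1).2 = (iso i t.2.1).2 ∧ (iso i t.1).1 = (iso i t.2.2).1)) := by
      intro t ht
      obtain ⟨hA, hd, hne⟩ := Finset.mem_filter.1 ht
      by_cases h0 : dist2 t.1 t.2.1 = 0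
      · refine Finset.mem_union_right _ ?_
        have h1 := (isoDist_iso_eq_zero_iff hi _ _).2 h0
        have h2 := (isoDist_iso_eq_zero_iff hi _ _).2 (hd ▸ h0)
        rw [Ne, ← isoDist_iso_eq_zero_iff hi] at hne
        obtain ⟨hu, hv⟩ := mul_ne_zero_iff.1 hne
        rcases mul_eq_zero.1 h1 with h1 | h1 <;> rcases mul_eq_zero.1 h2 with h2 | h2
        · exact absurd (by linear_combination h2 - h1) hu
        · exact Finset.mem_union_left _
            (Finset.mem_filter.2 ⟨ht, sub_eq_zero.1 h1, sub_eq_zero.1 h2⟩)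
        · exact Finset.mem_union_right _
            (Finset.mem_filter.2 ⟨ht, sub_eq_zero.1 h1, sub_eq_zero.1 h2⟩)
        · exact absurd (by linear_combination h2 - h1) hv
      · exact Finset.mem_union_left _ (Finset.mem_filter.2 ⟨hA, hd, h0⟩)
    have hcard : ∀ P : (F × F) × (F × F) × (F × F) → Prop, ∀ _ : DecidablePred P,
        (∀ t t', P t → P t' → t.2 = t'.2 → t.1 = t'.1) → (S.filter P).card ≤ A.card ^ 2 := by
      intro P _ hP
      rw [sq, ← Finset.card_product]
      refine Finset.card_le_card_of_injOn Prod.snd (fun t ht => ?_) fun t ht t' ht' h => ?_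
      · exact (Finset.mem_product.1 (Finset.mem_filter.1 (Finset.mem_filter.1 ht).1).1).2
      · exact Prod.ext (hP t t' (Finset.mem_filter.1 ht).2 (Finset.mem_filter.1 ht').2 h) h
    have h1 := hcard (fun t => (iso i t.1).1 = (iso i t.2.1).1 ∧
        (iso i t.1).2 = (iso i t.2.2).2) inferInstance fun t t' h h' htt =>
      iso_injective hi h2 (Prod.ext (by rw [h.1, h'.1, htt]) (by rw [h.2, h'.2, htt]))
    have h2 := hcard (fun t => (iso i t.1).2 = (iso i t.2.1).2 ∧
        (iso i t.1).1 = (iso i t.2.2).1) inferInstance fun t t' h h' htt =>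
      iso_injective hi h2 (Prod.ext (by rw [h.2, h'.2, htt]) (by rw [h.1, h'.1, htt]))
    have h3 := (Finset.card_le_card hsub).trans (Finset.card_union_le _ _)
    have h4 := Finset.card_union_le (S.filter (fun t => (iso i t.1).1 = (iso i t.2.1).1 ∧
        (iso i t.1).2 = (iso i t.2.2).2)) (S.filter (fun t =>
        (iso i t.1).2 = (iso i t.2.1).2 ∧ (iso i t.1).1 = (iso i t.2.2).1))
    omega
  · have hsub : S' ⊆ S ∪ (A ×ˢ A).image fun x => (x.1, x.2, x.2) := by
      rintro ⟨a, b, c⟩ ht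
      obtain ⟨hA, hd, hne⟩ := Finset.mem_filter.1 ht
      by_cases h0 : dist2 b c = 0
      · refine Finset.mem_union_right _ ?_
        have : b = c := iso_injective hi h2 (eq_of_isoDist_eq
          ((isoDist_iso_eq_iff hi _ _ _ _).2 hd) (mt (isoDist_iso_eq_zero_iff hi _ _).1 hne)
          ((isoDist_iso_eq_zero_iff hi _ _).2 h0))
        subst this
        simp only [Finset.mem_product] at hA
        exact Finset.mem_image.2 ⟨(a, b), Finset.mem_product.2 ⟨hA.1, hA.2.1⟩, rfl⟩
      · exact Finset.mem_union_left _ (Finset.mem_filter.2 ⟨hA, hd, h0⟩)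
    have h3 := (Finset.card_le_card hsub).trans (Finset.card_union_le _ _)
    have h4 := Finset.card_image_le (s := A ×ˢ A)
      (f := fun x => ((x.1, x.2, x.2) : (F × F) × (F × F) × (F × F)))
    rw [Finset.card_product, ← sq] at h4
    omega

variable [Fintype F] [DecidableEq F]

theorem card_dist_zero_le (hi : i ^ 2 = -1) (a : F × F) :
    (B.filter fun b => dist2 a b = 0).card ≤ 2 * Fintype.card F := by
  classical
  have hsub : (B.filter fun b => dist2 a b = 0) ⊆
      B.filter (fun b => (iso i a).1 = (iso i b).1) ∪
      B.filter (fun b => (iso i a).2 = (iso i b).2) := by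
    intro b hb
    obtain ⟨hB, h⟩ := Finset.mem_filter.1 hb
    rw [← isoDist_iso_eq_zero_iff hi] at h
    rw [Finset.mem_union, Finset.mem_filter, Finset.mem_filter]
    rcases mul_eq_zero.1 h with h | h
    · exact Or.inl ⟨hB, sub_eq_zero.1 h⟩
    · exact Or.inr ⟨hB, sub_eq_zero.1 h⟩
  have h1 : (B.filter (fun b => (iso i a).1 = (iso i b).1)).card ≤ Fintype.card F :=
    Finset.card_le_card_of_injOn (t := Finset.univ) Prod.snd (fun _ _ => Finset.mem_univ _)
      fun b hb b' hb' h => eq_of_iso_fst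
        ((Finset.mem_filter.1 hb).2.symm.trans (Finset.mem_filter.1 hb').2) h
  have h2 : (B.filter (fun b => (iso i a).2 = (iso i b).2)).card ≤ Fintype.card F :=
    Finset.card_le_card_of_injOn (t := Finset.univ) Prod.snd (fun _ _ => Finset.mem_univ _)
      fun b hb b' hb' h => eq_of_iso_snd
        ((Finset.mem_filter.1 hb).2.symm.trans (Finset.mem_filter.1 hb').2) h
  have h3 := (Finset.card_le_card hsub).trans (Finset.card_union_le _ _)
  omega

/-- The deviation of the number of points of `B` at given non-zero distance from the points of `A`
from its expected value, in mean square. -/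
noncomputable def deviation (A B : Finset (F × F)) : ℝ :=
  ∑ a ∈ A, ∑ r ∈ Finset.univ.erase 0,
    (((B.filter fun b => dist2 a b = r).card : ℝ) - B.card / Fintype.card F) ^ 2

theorem deviation_nonneg (A B : Finset (F × F)) : 0 ≤ deviation A B :=
  Finset.sum_nonneg fun _ _ => Finset.sum_nonneg fun _ _ => sq_nonneg _

theorem deviation_eq (hi : i ^ 2 = -1) :
    deviation A B = ∑ a ∈ A, ((legs (iso i) B a).card : ℝ) -
      A.card * (B.card : ℝ) ^ 2 / Fintype.card F - A.card * (B.card : ℝ) ^ 2 / Fintype.card F ^ 2 +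
      2 * (B.card / Fintype.card F) * ∑ a ∈ A, ((B.filter fun b => dist2 a b = 0).card : ℝ) := by
  classical
  set q := Fintype.card F with hq
  have hq0 : (q : ℝ) ≠ 0 := Nat.cast_ne_zero.2 Fintype.card_ne_zero
  have key : ∀ a ∈ A, ∑ r ∈ Finset.univ.erase 0,
      (((B.filter fun b => dist2 a b = r).card : ℝ) - B.card / q) ^ 2 =
      (legs (iso i) B a).card - (B.card : ℝ) ^ 2 / q - (B.card : ℝ) ^ 2 / q ^ 2 +
        2 * (B.card / q) * ((B.filter fun b => dist2 a b = 0).card : ℝ) := by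
    intro a _
    have h1 : ∑ r ∈ Finset.univ.erase 0, ((B.filter fun b => dist2 a b = r).card : ℝ) ^ 2 =
        (legs (iso i) B a).card := by
      have h2 := sum_card_fiber_sq (X := B.filter fun b => dist2 a b ≠ 0)
        (T := (Finset.univ : Finset F).erase 0) (f := dist2 a)
        fun b hb => Finset.mem_erase.2 ⟨(Finset.mem_filter.1 hb).2, Finset.mem_univ _⟩
      have h3 : ∑ r ∈ (Finset.univ : Finset F).erase 0,
          (B.filter fun b => dist2 a b = r).card ^ 2 = (legs (iso i) B a).card := by
        convert h2 using 1
        · refine Finset.sum_congr rfl fun r hr => ?_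
          rw [Finset.filter_filter]
          congr 2
          refine Finset.filter_congr fun b _ => ⟨fun h => ⟨?_, h⟩, fun h => h.2⟩
          rw [h]
          exact Finset.ne_of_mem_erase hr
        · congr 1
          ext g
          rw [mem_legs, isoDist_iso_eq_iff hi, Ne, isoDist_iso_eq_zero_iff hi, Finset.mem_filter,
            Finset.mem_product, Finset.mem_filter, Finset.mem_filter]
          constructor
          · rintro ⟨⟨h1, h2⟩, h3, h4⟩
            exact ⟨⟨⟨h1, h4⟩, h2, h3 ▸ h4⟩, h3⟩
          · rintro ⟨⟨⟨h1, h4⟩, h2, -⟩, h3⟩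
            exact ⟨⟨h1, h2⟩, h3, h4⟩
      exact_mod_cast h3
    have h4 : ∑ r ∈ Finset.univ.erase 0, ((B.filter fun b => dist2 a b = r).card : ℝ) =
        B.card - (B.filter fun b => dist2 a b = 0).card := by
      rw [eq_sub_iff_add_eq, Finset.sum_erase_add _ _ (Finset.mem_univ _)]
      exact_mod_cast (Finset.card_eq_sum_card_fiberwise (f := dist2 a)
        fun _ _ => Finset.mem_univ _).symm
    have h5 : ((Finset.univ : Finset F).erase 0).card = (q : ℝ) - 1 := by
      rw [Finset.card_erase_of_mem (Finset.mem_univ _), Finset.card_univ, ← hq,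
        Nat.cast_sub Fintype.card_pos, Nat.cast_one]
    simp only [sub_sq]
    rw [Finset.sum_add_distrib, Finset.sum_sub_distrib, Finset.sum_const, ← Finset.sum_mul,
      ← Finset.mul_sum, h1, h4, nsmul_eq_mul, h5]
    field_simp
    ring
  rw [deviation, ← hq, Finset.sum_congr rfl key]
  simp only [Finset.sum_add_distrib, Finset.sum_sub_distrib, Finset.sum_const, nsmul_eq_mul,
    ← Finset.mul_sum]
  ring

theorem deviation_bounds (hi : i ^ 2 = -1) (hBA : B.card ≤ A.card) :
    deviation A B ≤ ∑ a ∈ A, ((legs (iso i) B a).card : ℝ) -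
        A.card * (B.card : ℝ) ^ 2 / Fintype.card F + 4 * (A.card : ℝ) ^ 2 ∧
      ∑ a ∈ A, ((legs (iso i) B a).card : ℝ) - A.card * (B.card : ℝ) ^ 2 / Fintype.card F ≤
        deviation A B + (A.card : ℝ) ^ 2 := by
  rw [deviation_eq hi]
  have hq0 : (0 : ℝ) < Fintype.card F := Nat.cast_pos.2 Fintype.card_pos
  have hm : (B.card : ℝ) ≤ A.card := Nat.cast_le.2 hBA
  have hmq : (B.card : ℝ) ≤ (Fintype.card F : ℝ) ^ 2 := by
    have := Finset.card_le_univ B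
    rw [Fintype.card_prod, ← sq] at this
    exact_mod_cast this
  have hZ0 : 0 ≤ ∑ a ∈ A, ((B.filter fun b => dist2 a b = 0).card : ℝ) :=
    Finset.sum_nonneg fun _ _ => Nat.cast_nonneg _
  have hZ1 : ∑ a ∈ A, ((B.filter fun b => dist2 a b = 0).card : ℝ) ≤
      A.card * (2 * Fintype.card F) := by
    rw [← nsmul_eq_mul]
    refine Finset.sum_le_card_nsmul _ _ _ fun a _ => ?_
    have := card_dist_zero_le (B := B) hi a
    exact_mod_cast this
  generalize ∑ a ∈ A, ((B.filter fun b => dist2 a b = 0).card : ℝ) = Z at hZ0 hZ1 ⊢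
  generalize (Fintype.card F : ℝ) = q at hq0 hmq hZ1 ⊢
  have hm0 : (0 : ℝ) ≤ B.card := Nat.cast_nonneg _
  generalize (B.card : ℝ) = m at hm hmq hm0 ⊢
  generalize (A.card : ℝ) = n at hm hZ1 ⊢
  have hn0 : 0 ≤ n := hm0.trans hm
  have h1 : 0 ≤ n * m ^ 2 / q ^ 2 := by positivity
  have h2 : n * m ^ 2 / q ^ 2 ≤ n ^ 2 := by
    rw [div_le_iff₀ (by positivity)]
    calc n * m ^ 2 = n * (m * m) := by ring
      _ ≤ n * (n * q ^ 2) := by gcongr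
      _ = n ^ 2 * q ^ 2 := by ring
  have h3 : 0 ≤ 2 * (m / q) * Z := by positivity
  have h4 : 2 * (m / q) * Z ≤ 4 * n ^ 2 := by
    calc 2 * (m / q) * Z ≤ 2 * (n / q) * (n * (2 * q)) := by gcongr
      _ = _ := by field_simp; ring
  constructor <;> linarith

end Counting

section Deviation

variable {F K : Type*} [Field F] [Field K] [Algebra F K] [DecidableEq F] {i : K}
  {A B : Finset (F × F)} {M : ℕ}

theorem card_legs_le (hi : i ^ 2 = -1) (h2 : (2 : F) ≠ 0) (hM : 4 * B.card ≤ M ^ 2)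
    (hBA : B.card ≤ A.card) :
    ∑ a ∈ A, (legs (iso i) B a).card ≤ A.card * B.card + 6 * A.card ^ 2 +
      ∑ g ∈ keptPairs (iso i) B M, hits A (bisector g) := by
  classical
  have hsub : ∀ a ∈ A, legs (iso i) B a ⊆ B.image (fun b => (b, b)) ∪
      (((legs (iso i) B a).filter fun g => isoDist (iso i g.1) (iso i g.2) ≠ 0 ∧
        ¬Kept (iso i) B M g) ∪
      (keptPairs (iso i) B M).filter fun g => dot (bisector g).1 a = (bisector g).2) := by
    intro a _ g hg
    obtain ⟨⟨hg1, hg2⟩, hd, h0⟩ := mem_legs.1 hg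
    by_cases hz : isoDist (iso i g.1) (iso i g.2) = 0
    · have h := iso_injective hi h2 (eq_of_isoDist_eq hd h0 hz)
      exact Finset.mem_union_left _ (Finset.mem_image.2 ⟨g.1, hg1, Prod.ext rfl h⟩)
    · refine Finset.mem_union_right _ ?_
      by_cases hk : Kept (iso i) B M g
      · exact Finset.mem_union_right _ (Finset.mem_filter.2 ⟨mem_keptPairs.2 hk,
          (dot_bisector_eq_iff a g).2 ((isoDist_iso_eq_iff hi _ _ _ _).1 hd)⟩)
      · exact Finset.mem_union_left _ (Finset.mem_filter.2 ⟨hg, hz, hk⟩)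
  have hhits : ∑ a ∈ A, ((keptPairs (iso i) B M).filter fun g =>
      dot (bisector g).1 a = (bisector g).2).card =
      ∑ g ∈ keptPairs (iso i) B M, hits A (bisector g) :=
    Finset.sum_card_bipartiteAbove_eq_sum_card_bipartiteBelow
      fun a g => dot (bisector g).1 a = (bisector g).2
  have hfew := sum_card_not_kept_le (A := A) (iso_injective hi h2) hM hBA
  rw [← hhits]
  calc _ ≤ ∑ a ∈ A, (B.card + (((legs (iso i) B a).filter fun g =>
          isoDist (iso i g.1) (iso i g.2) ≠ 0 ∧ ¬Kept (iso i) B M g).card +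
          ((keptPairs (iso i) B M).filter fun g =>
            dot (bisector g).1 a = (bisector g).2).card)) := by
        refine Finset.sum_le_sum fun a ha => (Finset.card_le_card (hsub a ha)).trans ?_
        refine (Finset.card_union_le _ _).trans ?_
        exact Nat.add_le_add Finset.card_image_le (Finset.card_union_le _ _)
    _ ≤ _ := by
        rw [Finset.sum_add_distrib, Finset.sum_add_distrib, Finset.sum_const, smul_eq_mul]
        omega

variable [Fintype F]

/-- The deviation is controlled by the pairs of pairs of points with a common bisector. -/
theorem deviation_le (hi : i ^ 2 = -1) (h2 : (2 : F) ≠ 0) (hM : 4 * B.card ≤ M ^ 2)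
    (hBA : B.card ≤ A.card) :
    deviation A B ≤ 11 * (A.card : ℝ) ^ 2 +
      √(Fintype.card F * A.card * (coaxialPairs (iso i) B M).card) := by
  classical
  have hm : (B.card : ℝ) ≤ A.card := Nat.cast_le.2 hBA
  have hG : ((keptPairs (iso i) B M).card : ℝ) ≤ (B.card : ℝ) ^ 2 := by
    have h : (keptPairs (iso i) B M).card ≤ B.card ^ 2 := by
      rw [sq, ← Finset.card_product]
      exact Finset.card_le_card fun g hg => Finset.mem_product.2
        ⟨(mem_keptPairs.1 hg).1, (mem_keptPairs.1 hg).2.1⟩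
    exact_mod_cast h
  have hbis : ∀ g ∈ keptPairs (iso i) B M, (bisector g).1 ≠ 0 := by
    intro g hg
    refine bisector_fst_ne_zero h2 fun h => (mem_keptPairs.1 hg).2.2.1 ?_
    rw [h]
    simp [isoDist]
  have hpairs : (((keptPairs (iso i) B M ×ˢ keptPairs (iso i) B M).filter fun x =>
      ∃ c : F, c ≠ 0 ∧ bisector x.2 = c • bisector x.1).card : ℝ) ≤
      (coaxialPairs (iso i) B M).card := by
    refine Nat.cast_le.2 (Finset.card_le_card fun x hx => ?_)
    obtain ⟨hx, c, hc, h⟩ := Finset.mem_filter.1 hx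
    rw [coaxialPairs]
    exact Finset.mem_filter.2 ⟨hx, sameAxis_of_bisector hi h2 hc h⟩
  have h1 : ∑ a ∈ A, ((legs (iso i) B a).card : ℝ) ≤ A.card * B.card + 6 * (A.card : ℝ) ^ 2 +
      ∑ g ∈ keptPairs (iso i) B M, (hits A (bisector g) : ℝ) := by
    have h := card_legs_le hi h2 hM hBA
    exact_mod_cast h
  have h3 := sum_hits_le A (keptPairs (iso i) B M) bisector hbis
  have h4 := (deviation_bounds hi hBA).1
  have h5 : √(Fintype.card F * A.card *
      ((keptPairs (iso i) B M ×ˢ keptPairs (iso i) B M).filter fun x =>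
        ∃ c : F, c ≠ 0 ∧ bisector x.2 = c • bisector x.1).card) ≤
      √(Fintype.card F * A.card * (coaxialPairs (iso i) B M).card) := by gcongr
  have h6 : (keptPairs (iso i) B M).card * (A.card : ℝ) / Fintype.card F ≤
      A.card * (B.card : ℝ) ^ 2 / Fintype.card F := by
    rw [mul_comm]
    gcongr
  have h7 : (A.card : ℝ) * B.card ≤ (A.card : ℝ) ^ 2 := by
    rw [sq]
    gcongr
  linarith

theorem deviation_union_le {B₁ B₂ : Finset (F × F)} (hd : Disjoint B₁ B₂) (h : B₁ ∪ B₂ = B) :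
    deviation A B ≤ 2 * deviation A B₁ + 2 * deviation A B₂ := by
  subst h
  simp only [deviation, Finset.mul_sum]
  rw [← Finset.sum_add_distrib]
  refine Finset.sum_le_sum fun a _ => ?_
  rw [← Finset.sum_add_distrib]
  refine Finset.sum_le_sum fun r _ => ?_
  rw [Finset.filter_union, Finset.card_union_of_disjoint (Finset.disjoint_filter_filter hd),
    Finset.card_union_of_disjoint hd, Nat.cast_add, Nat.cast_add, add_div]
  generalize ((B₁.filter fun b => dist2 a b = r).card : ℝ) = x
  generalize ((B₂.filter fun b => dist2 a b = r).card : ℝ) = y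
  nlinarith [sq_nonneg ((x - B₁.card / Fintype.card F) - (y - B₂.card / Fintype.card F))]

end Deviation

section Splitting

variable {K V : Type*} [DecidableEq V] {φ : V → K × K}

/-- Every set of points is the union of two sets, one of them with few points on each line of the
first isotropic direction, the other one with few points on those of the second direction. -/
theorem exists_fewOnLines_union (hφ : Function.Injective φ) (A : Finset V) {M : ℕ}
    (hM : A.card < (M + 1) ^ 2) : ∃ A₁ A₂, Disjoint A₁ A₂ ∧ A₁ ∪ A₂ = A ∧
      FewOnLines φ A₁ M ∧ FewOnLines φ A₂ M := by
  classical
  set P : V → Prop := fun a => M < (A.filter fun b => (φ b).1 = (φ a).1).card with hP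
  refine ⟨A.filter P, A.filter (¬P ·), Finset.disjoint_filter_filter_not _ _ _,
    Finset.filter_union_filter_not_eq _ _, Or.inr fun S hS c hc => ?_,
    Or.inl fun S hS c hc => ?_⟩
  · by_contra! hlt
    have hinj : Set.InjOn (fun a => (φ a).1) S := fun a ha b hb h =>
      hφ (Prod.ext h ((hc a ha).trans (hc b hb).symm))
    have h1 : S.card * (M + 1) ≤ A.card := by
      rw [← Finset.card_image_of_injOn hinj]
      refine le_trans ?_ (Finset.card_le_card (Finset.biUnion_subset.2
        fun u (_ : u ∈ S.image fun a => (φ a).1) => Finset.filter_subset (fun b => (φ b).1 = u) A))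
      rw [Finset.card_biUnion]
      · rw [← smul_eq_mul]
        refine Finset.card_nsmul_le_sum _ _ _ fun u hu => ?_
        obtain ⟨a, ha, rfl⟩ := Finset.mem_image.1 hu
        exact (Finset.mem_filter.1 (hS ha)).2
      · intro u _ u' _ hne
        refine Finset.disjoint_filter.2 fun b _ h h' => hne (h.symm.trans h')
    nlinarith
  · rcases S.eq_empty_or_nonempty with rfl | ⟨a, ha⟩
    · simp
    · refine le_trans (Finset.card_le_card fun b hb => ?_)
        (not_lt.1 (Finset.mem_filter.1 (hS ha)).2)
      exact Finset.mem_filter.2 ⟨(Finset.mem_filter.1 (hS hb)).1, (hc b hb).trans (hc a ha).symm⟩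

end Splitting

/-- The asymptotic formula for primes `p ≥ 5`. -/
theorem abs_Tstar_sub_le {p : ℕ} (hp : p.Prime) (hp5 : 5 ≤ p) {A : Finset (ZMod p × ZMod p)}
    (h1 : (p : ℝ) ≤ A.card) (h2 : (A.card : ℝ) ≤ (p : ℝ) ^ ((4 : ℝ) / 3)) :
    |(Tstar A : ℝ) - (A.card : ℝ) ^ 3 / p| ≤ 200000000 *
      ((p : ℝ) ^ ((2 : ℝ) / 3) * (A.card : ℝ) ^ ((5 : ℝ) / 3) +
        (p : ℝ) ^ ((1 : ℝ) / 4) * (A.card : ℝ) ^ 2) := by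
  classical
  have := Fact.mk hp
  let K := AlgebraicClosure (ZMod p)
  have : CharP K p := charP_of_injective_algebraMap (algebraMap (ZMod p) K).injective p
  obtain ⟨i, hi⟩ := IsAlgClosed.exists_pow_nat_eq (-1 : K) two_pos
  have hF2 : (2 : ZMod p) ≠ 0 := by
    intro h
    have := (ZMod.natCast_eq_zero_iff 2 p).1 (by exact_mod_cast h)
    have := Nat.le_of_dvd two_pos this
    omega
  have hK : ∀ k : ℕ, 0 < k → k < p → (k : K) ≠ 0 := fun k hk0 hkp h =>
    Nat.not_dvd_of_pos_of_lt hk0 hkp ((CharP.cast_eq_zero_iff K p k).1 h)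
  have hq : Fintype.card (ZMod p) = p := ZMod.card p
  have hp0 : (0 : ℝ) < p := Nat.cast_pos.2 hp.pos
  have hp1 : (1 : ℝ) ≤ p := Nat.one_le_cast.2 hp.pos
  have hA1 : 1 ≤ A.card := hp.pos.trans_le (Nat.cast_le.1 h1)
  have hAp : A.card ≤ p ^ 2 := by
    have := Finset.card_le_univ A
    rwa [Fintype.card_prod, hq, ← sq] at this
  set M := Nat.sqrt (4 * A.card) + 1 with hM
  have hM4 : 4 * A.card ≤ M ^ 2 := (Nat.lt_succ_sqrt' _).le
  have hM3 : (M : ℝ) ≤ 3 * √A.card := by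
    have e1 : ((Nat.sqrt (4 * A.card) : ℕ) : ℝ) ≤ 2 * √A.card := by
      refine Real.nat_sqrt_le_real_sqrt.trans (le_of_eq ?_)
      rw [Nat.cast_mul, Real.sqrt_mul (by positivity)]
      congr 1
      rw [Real.sqrt_eq_iff_mul_self_eq (by positivity) (by positivity)]
      norm_num
    have e2 : 1 ≤ √(A.card : ℝ) := Real.one_le_sqrt.2 (Nat.one_le_cast.2 hA1)
    rw [hM, Nat.cast_add, Nat.cast_one]
    linarith
  obtain ⟨A₁, A₂, hd, hu, hf₁, hf₂⟩ := exists_fewOnLines_union (iso_injective hi hF2) A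
    (M := M) (by nlinarith)
  set τ : ℝ := ∑ a ∈ A, ((legs (iso i) A a).card : ℝ) with hτ
  set n : ℝ := (A.card : ℝ) with hn
  set s : ℝ := √(p * n ^ 2 * √(n * τ) + p * (n ^ 3 * √n) + n ^ 2 * τ) with hs
  have hn0 : 0 < n := hp0.trans_le h1
  have hdev : ∀ B ⊆ A, FewOnLines (iso i) B M → deviation A B ≤ 11 * n ^ 2 + 1000 * s := by
    intro B hB hf
    have hBA := Finset.card_le_card hB
    refine (deviation_le hi hF2 (M := M) (by omega) hBA).trans ?_
    have h := card_coaxialPairs_le_energy (iso_injective hi hF2) hf hB hp5 hK hAp hM3 hτ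
    rw [hq]
    refine add_le_add_right ?_ _
    rw [hs]
    have e : (1000 : ℝ) = √(1000 ^ 2) := (Real.sqrt_sq (by norm_num)).symm
    rw [e, ← Real.sqrt_mul (by norm_num)]
    refine Real.sqrt_le_sqrt ?_
    calc _ ≤ p * n * (1000000 * (n * √(n * τ) + n ^ 2 * √n + n * τ / p)) := by gcongr
      _ = _ := by
        field_simp
        ring
  have hX := deviation_union_le (A := A) hd hu
  have hX1 := hdev A₁ (hu ▸ Finset.subset_union_left) hf₁
  have hX2 := hdev A₂ (hu ▸ Finset.subset_union_right) hf₂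
  obtain ⟨b1, b2⟩ := deviation_bounds hi (le_refl A.card)
  obtain ⟨t1, t2⟩ := Tstar_bounds (A := A) hi hF2
  have t1 : (Tstar A : ℝ) ≤ τ + 2 * n ^ 2 := by
    rw [hτ, hn]
    exact_mod_cast t1
  have t2 : τ ≤ Tstar A + n ^ 2 := by
    rw [hτ, hn]
    exact_mod_cast t2
  have hX0 := deviation_nonneg A A
  rw [hq, ← hτ, ← hn] at b1 b2
  have e3 : n * n ^ 2 / p = n ^ 3 / p := by ring
  rw [e3] at b1 b2
  have e4 : n ^ 2 ≤ n ^ 3 / p := by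
    rw [le_div_iff₀ hp0]
    nlinarith [sq_nonneg n]
  refine le_trans ?_ (le_of_self_bound_rpow hp1 h1 h2 hX0 (τ := τ) (by linarith) (by linarith))
  rw [abs_le]
  constructor <;> nlinarith [sq_nonneg n]

theorem abs_Tstar_sub_le_of_small {p : ℕ} (hp : p.Prime) (hp5 : p < 5)
    {A : Finset (ZMod p × ZMod p)} (h1 : (p : ℝ) ≤ A.card) :
    |(Tstar A : ℝ) - (A.card : ℝ) ^ 3 / p| ≤ 200000000 *
      ((p : ℝ) ^ ((2 : ℝ) / 3) * (A.card : ℝ) ^ ((5 : ℝ) / 3) +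
        (p : ℝ) ^ ((1 : ℝ) / 4) * (A.card : ℝ) ^ 2) := by
  have := Fact.mk hp
  have hp1 : (1 : ℝ) ≤ p := Nat.one_le_cast.2 hp.pos
  have hn1 : (1 : ℝ) ≤ A.card := hp1.trans h1
  have hn : A.card ≤ 16 := by
    have := Finset.card_le_univ A
    rw [Fintype.card_prod, ZMod.card] at this
    nlinarith
  have hT : Tstar A ≤ A.card ^ 3 := by
    have h : A.card ^ 3 = (A ×ˢ (A ×ˢ A)).card := by
      rw [Finset.card_product, Finset.card_product]
      ring
    rw [h, Tstar, ← Set.ncard_coe_finset]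
    refine Set.ncard_le_ncard (fun t ht => ?_) (Finset.finite_toSet _)
    exact Finset.mem_coe.2 (Finset.mem_product.2 ⟨ht.1, Finset.mem_product.2 ⟨ht.2.1, ht.2.2.1⟩⟩)
  have hT : (Tstar A : ℝ) ≤ (A.card : ℝ) ^ 3 := by exact_mod_cast hT
  have hn3 : (A.card : ℝ) ^ 3 ≤ 16 ^ 3 := by
    gcongr
    exact_mod_cast hn
  have h3 : (A.card : ℝ) ^ 3 / p ≤ (A.card : ℝ) ^ 3 := div_le_self (by positivity) hp1
  have h4 : 0 ≤ (A.card : ℝ) ^ 3 / p := by positivity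
  have h5 : (1 : ℝ) ≤ (p : ℝ) ^ ((1 : ℝ) / 4) := Real.one_le_rpow hp1 (by norm_num)
  have h6 : 1 ≤ (p : ℝ) ^ ((1 : ℝ) / 4) * (A.card : ℝ) ^ 2 :=
    one_le_mul_of_one_le_of_one_le h5 (one_le_pow₀ hn1)
  have h7 : 0 ≤ (p : ℝ) ^ ((2 : ℝ) / 3) * (A.card : ℝ) ^ ((5 : ℝ) / 3) := by positivity
  have h8 : (0 : ℝ) ≤ Tstar A := Nat.cast_nonneg _
  rw [abs_le]
  constructor <;> linarith

/-- Asymptotic formula for isosceles triangles over `F_p`: there is an absolute constant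
`C > 0` such that for every prime `p` and `A ⊆ F_p²` with `p ≤ |A| ≤ p^(4/3)`,
`|T*(A) - |A|³/p| ≤ C·(p^(2/3)|A|^(5/3) + p^(1/4)|A|²)`. -/
theorem isosceles_triangle_asymptotic :
    ∃ C : ℝ, 0 < C ∧
      ∀ p : ℕ, p.Prime →
        ∀ A : Finset (ZMod p × ZMod p),
          (p : ℝ) ≤ (A.card : ℝ) →
          (A.card : ℝ) ≤ (p : ℝ) ^ ((4 : ℝ) / 3) →
          |(Tstar A : ℝ) - (A.card : ℝ) ^ 3 / (p : ℝ)| ≤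
            C * ((p : ℝ) ^ ((2 : ℝ) / 3) * (A.card : ℝ) ^ ((5 : ℝ) / 3) +
              (p : ℝ) ^ ((1 : ℝ) / 4) * (A.card : ℝ) ^ 2) := by
  refine ⟨200000000, by norm_num, fun p hp A h1 h2 => ?_⟩
  rcases lt_or_ge p 5 with hp5 | hp5
  · exact abs_Tstar_sub_le_of_small hp hp5 h1
  · exact abs_Tstar_sub_le hp hp5 h1 h2

end Stmt6
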